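/- Every 2-extendable non-bipartite finite simple graph with 12 vertices and at most 20 edges is isomorphic to the graph G_2 defined as follows: vertex set {0,1,…,11}, with edge set consisting of the 8-cycle 0-1-2-3-4-5-6-7-0, the 4-cycle 8-9-10-11-8, and the eight additional edges (0,8), (3,8), (2,9), (5,9), (4,10), (7,10), (6,11), (1,11). In particular, up to isomorphism G_2 is the unique 2-extendable non-bipartite graph with 12 vertices and 20 edges. -/

import Mathlib

open SimpleGraph

/-- `G` is `n`-factor-critical if for every set `S` of exactly `n` vertices,
the graph obtained by deleting `S` has a perfect matching; formalized as:
there is a matching of `G` whose vertex set is exactly the complement of `S`. -/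
def IsFactorCritical {V : Type*} (G : SimpleGraph V) (n : ℕ) : Prop :=
  ∀ S : Finset V, S.card = n →
    ∃ M : G.Subgraph, M.IsMatching ∧ M.verts = (↑S : Set V)ᶜ

/-- `G` is `k`-extendable if it is connected, has a matching with `k` edges,
and every matching with `k` edges is contained in a perfect matching. -/
def IsExtendable {V : Type*} (G : SimpleGraph V) (k : ℕ) : Prop :=
  G.Connected ∧
  (∃ M : G.Subgraph, M.IsMatching ∧ M.edgeSet.ncard = k) ∧
  ∀ M : G.Subgraph, M.IsMatching → M.edgeSet.ncard = k →
    ∃ P : G.Subgraph, P.IsPerfectMatching ∧ M ≤ P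

/-- The graph `G₂`: the 8-cycle `0-1-2-3-4-5-6-7-0`, the 4-cycle `8-9-10-11-8`,
and the edges `(0,8), (3,8), (2,9), (5,9), (4,10), (7,10), (6,11), (1,11)`. -/
def GTwo : SimpleGraph (Fin 12) :=
  SimpleGraph.fromRel (fun i j => (i, j) ∈
    ([(0, 1), (1, 2), (2, 3), (3, 4), (4, 5), (5, 6), (6, 7), (7, 0),
      (8, 9), (9, 10), (10, 11), (11, 8),
      (0, 8), (3, 8), (2, 9), (5, 9), (4, 10), (7, 10), (6, 11), (1, 11)] :
      List (Fin 12 × Fin 12)))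

/-- Whether bit `i` of `m` is set. -/
def hasBit (m i : ℕ) : Bool := Nat.beq (Nat.land (Nat.shiftRight m i) 1) 1

/-- The adjacency matrix of a graph on `{0, …, 11}` is packed into a number: row `i` sits at the bits
from `12 * i + 64` on. The low `64` bits carry no information about the graph; `addEdge` scrambles
them so that different matrices hash differently. -/
def row (M i : ℕ) : ℕ :=
  Nat.land (Nat.shiftRight M (Nat.add (Nat.mul 12 i) 64)) 4095

/-- Evaluates `x` to a literal before passing it on to `k`. -/
def force {α : Type} (x : ℕ) (k : ℕ → α) : α :=
  Nat.rec (k 0) (fun n _ => k (Nat.succ n)) x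

def edgeMask (w j : ℕ) : ℕ :=
  Nat.lor (Nat.shiftLeft 1 (Nat.add (Nat.mul 12 w) j))
    (Nat.shiftLeft 1 (Nat.add (Nat.mul 12 j) w))

def addEdge (M w j : ℕ) : ℕ :=
  force (edgeMask w j) fun E =>
  Nat.xor (Nat.lor M (Nat.shiftLeft E 64)) (Nat.mod E 8123456789123456791)

/-- The number of bits of `x < 4096`. -/
def popcount (x : ℕ) : ℕ :=
  Nat.mod (Nat.land (Nat.mul x 35185445863425) 76861433640456465) 15

/-- The increase of `max 3 (popcount x)` when a bit is added to `x`. -/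
def bump (x : ℕ) : ℕ := cond (Nat.ble 3 (popcount x)) 1 0

/-- The union of the rows of `M` over the bits of a number. -/
def unionRows (M fuel : ℕ) : ℕ → ℕ :=
  Nat.rec (fun _ => 0) (fun _ ih x => cond (Nat.beq x 0) 0
      (Nat.lor (row M (Nat.log2 x))
        (ih (Nat.xor x (Nat.shiftLeft 1 (Nat.log2 x)))))) fuel

/-- The set `I` has too few neighbours outside `used` for a matching. -/
def deficient (M used I : ℕ) : Bool :=
  Nat.blt (popcount (Nat.land (unionRows M 12 I) (Nat.xor 4095 used))) (popcount I)

/-- The edges `ab` and `cd` lie in no perfect matching, since the set `I` of closed vertices has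
too few neighbours besides `a, b, c, d`. -/
def refutes (M C a b c d I : ℕ) : Bool :=
  cond (hasBit (row M a) b) (cond (hasBit (row M c) d)
    (cond (Nat.beq (Nat.land C I) I)
      (force (Nat.lor (Nat.shiftLeft 1 a) (Nat.shiftLeft 1 b)) fun m =>
        force (Nat.lor (Nat.shiftLeft 1 c) (Nat.shiftLeft 1 d)) fun m' =>
          cond (Nat.beq (Nat.land m m') 0)
            (force (Nat.lor m m') fun used => cond (Nat.beq (Nat.land used I) 0)
               (deficient M used I) false) false) false) false) false

/-- Tries the packed list `t` of candidates for `refutes`. -/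
def kills (M C fuel : ℕ) : ℕ → Bool :=
  Nat.rec (fun _ => false) (fun _ ih t =>
   cond (Nat.beq t 0) false
      (cond (refutes M C (Nat.land t 15) (Nat.land (Nat.shiftRight t 4) 15)
          (Nat.land (Nat.shiftRight t 8) 15) (Nat.land (Nat.shiftRight t 12) 15)
          (Nat.land (Nat.shiftRight t 16) 4095))
        true
        (force (Nat.shiftRight t 28) ih))) fuel

/-- Joining `w` and `j` creates no odd cycle shorter than `R`, as far as lengths `3` and `5` go. -/
def girthOK (R M w j : ℕ) : Bool :=
  cond (Nat.ble 5 R)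
    (cond (Nat.beq (Nat.land (row M w) (row M j)) 0)
      (cond (Nat.ble 7 R)
        (Nat.beq (Nat.land (unionRows M 12 (row M w)) (unionRows M 12 (row M j))) 0) true) false) true

def rowsBelow (M d i : ℕ) : Bool :=
  Nat.rec true (fun i ih => cond (Nat.ble (popcount (row M i)) d) ih false) i

/-- The degrees on the cycle `0, …, R - 1` are compatible with the normalization of its labels. -/
def capOK (R M C : ℕ) : Bool :=
  cond (cond (hasBit C 0) (force (popcount (row M 0)) fun d => rowsBelow M d R) true)
    (cond (hasBit C 1) (Nat.ble (popcount (row M (Nat.sub R 1))) (popcount (row M 1))) true) false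

/-- A search procedure takes the number of labels in use, the matrix, a lower bound for the sum of
the degrees, the set of closed vertices and the remaining certificate. -/
abbrev Continuation := ℕ → ℕ → ℕ → ℕ → List ℕ → Option (List ℕ)

/-- Declares the neighbourhood of `w` complete. -/
def closeVertex (R w t : ℕ) (next : Continuation) (n M B C : ℕ) (s : List ℕ) :
    Option (List ℕ) :=
  cond (Nat.ble 3 (popcount (row M w)))
    (force (Nat.lor C (Nat.shiftLeft 1 w)) fun C' =>
      cond (capOK R M C') (cond (kills M C' 16 t) (some s) (next n M B C' s)) (some s)) (some s)

def chain (o : Option (List ℕ)) (k : List ℕ → Option (List ℕ)) : Option (List ℕ) :=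
  Option.rec none k o

/-- Joins `w` to any number of new labels and then closes it. -/
def addFresh (R w t : ℕ) (next : Continuation) (C fuel : ℕ) :
    ℕ → ℕ → ℕ → List ℕ → Option (List ℕ) :=
  Nat.rec (fun _ _ _ _ => none) (fun _ ih n M B s =>
    chain (closeVertex R w t next n M B C s) fun s' =>
     cond (Nat.ble 12 n) (some s')
        (force (Nat.add B (bump (row M w))) fun B' => cond (Nat.ble B' 40)
          (force (addEdge M w n) fun M' => force (Nat.succ n) fun n' =>
            ih n' M' B' s') (some s'))) fuel

/-- Branches over the sets of neighbours of `w` among the labels `X`. -/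
def expand (R w t : ℕ) (next : Continuation) (n C fuel : ℕ) :
    ℕ → ℕ → ℕ → List ℕ → Option (List ℕ) :=
  Nat.rec (fun _ _ _ _ => none) (fun _ ih X M B s =>
    cond (Nat.beq X 0) (addFresh R w t next C 13 n M B s)
      (force (Nat.log2 X) fun j => force (Nat.xor X (Nat.shiftLeft 1 j)) fun X' =>
        chain (force (Nat.add B (Nat.add (bump (row M w)) (bump (row M j)))) fun B' =>
          cond (Nat.ble B' 40) (cond (girthOK R M w j)
            (force (addEdge M w j) fun M' => ih X' M' B' s) (some s)) (some s)) fun s' => ih X' M B s')) fuel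

/-- The labels in use which may still be joined to `w`. -/
def candidates (n M C w : ℕ) : ℕ :=
  Nat.land (Nat.sub (Nat.shiftLeft 1 n) 1)
    (Nat.xor 4095 (Nat.lor C (Nat.lor (row M w) (Nat.shiftLeft 1 w))))

/-- The adjacency matrix of `GTwo`. -/
def twoRows : ℕ := 135249972742107454976089441146660095883777713171956079504916480

/-- The hexadecimal digits of `t` give an isomorphism from `M` to `GTwo`. -/
def relabels (M t : ℕ) : Bool :=
  (List.range 12).all fun i => Nat.blt (t / 16 ^ i % 16) 12 && (List.range 12).all fun j =>
    (hasBit (row M i) j == hasBit (row twoRows (t / 16 ^ i % 16)) (t / 16 ^ j % 16)) &&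
      (i == j || !(t / 16 ^ i % 16 == t / 16 ^ j % 16))

def pop (s : List ℕ) (k : ℕ → List ℕ → Option (List ℕ)) : Option (List ℕ) :=
  List.rec none (fun t s _ => force t fun t => k t s) s

/-- Enumerates the graphs which extend a partial matrix, guided by a certificate which names the
vertex to expand next and the violated Hall conditions. -/
def search (R fuel : ℕ) : Continuation :=
  Nat.rec (fun _ _ _ _ _ => none) (fun _ ih n M B C s =>
    cond (Nat.beq (Nat.succ C) (Nat.shiftLeft 1 n))
      (cond (Nat.blt n 12) (some s)
        (pop s fun t s' => cond (relabels M t) (some s') none))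
      (pop s fun t s' => force (Nat.mod t 16) fun w => force (Nat.div t 16) fun t' =>
          cond (Nat.blt w n) (force (candidates n M C w) fun X => expand R w t' ih n C 14 X M B s') none)) fuel

/-- The certificate `s` shows that `GTwo` is the only graph which extends `M`. -/
def verifies (R M : ℕ) (s : List ℕ) : Bool :=
  Option.rec false (fun _ => true) (search R 14 R M 36 0 s)

theorem force_eq {α : Type} (x : ℕ) (k : ℕ → α) : force x k = k x := by
  cases x <;> rfl

theorem hasBit_eq (m i : ℕ) : hasBit m i = m.testBit i := by
  rw [Bool.eq_iff_iff, Nat.testBit_eq_decide_div_mod_eq, decide_eq_true_iff, hasBit, Nat.beq_eq]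
  change (m >>> i) &&& 1 = 1 ↔ _
  rw [Nat.and_one_is_mod, Nat.shiftRight_eq_div_pow]

/-- The row of `x` in the packed adjacency matrix `M` has the bit `y`. -/
def Edge (M x y : ℕ) : Prop := (row M x).testBit y = true

theorem testBit_and_4095 (x j : ℕ) : (x &&& 4095).testBit j = (decide (j < 12) && x.testBit j) := by
  rw [Nat.testBit_and, show 4095 = 2 ^ 12 - 1 by norm_num, Nat.testBit_two_pow_sub_one, Bool.and_comm]

theorem edge_iff (M x y : ℕ) : Edge M x y ↔ y < 12 ∧ M.testBit (12 * x + 64 + y) = true := by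
  unfold Edge row
  change ((M >>> (12 * x + 64)) &&& 4095).testBit y = true ↔ _
  rw [testBit_and_4095, Nat.testBit_shiftRight]
  simp

theorem row_lt (M x : ℕ) : row M x < 4096 :=
  Nat.lt_of_le_of_lt Nat.and_le_right (by norm_num)

theorem edgeMask_eq (w j : ℕ) : edgeMask w j = 2 ^ (12 * w + j) ||| 2 ^ (12 * j + w) := by
  unfold edgeMask
  change 1 <<< (12 * w + j) ||| 1 <<< (12 * j + w) = _
  simp [Nat.shiftLeft_eq]

theorem edge_addEdge (M : ℕ) {w j : ℕ} (hw : w < 12) (hj : j < 12) (x y : ℕ) :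
    Edge (addEdge M w j) x y ↔ Edge M x y ∨ (x = w ∧ y = j) ∨ (x = j ∧ y = w) := by
  rw [edge_iff, edge_iff, addEdge, force_eq]
  change _ ∧ ((M ||| edgeMask w j <<< 64) ^^^ (edgeMask w j % 8123456789123456791)).testBit _ = true ↔ _
  have hlow : (edgeMask w j % 8123456789123456791).testBit (12 * x + 64 + y) = false :=
    Nat.testBit_lt_two_pow ((Nat.mod_lt _ (by norm_num)).trans_le
      (le_trans (by norm_num : 8123456789123456791 ≤ 2 ^ 64) (Nat.pow_le_pow_right (by norm_num) (by omega))))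
  rw [Nat.testBit_xor, hlow, Bool.xor_false, Nat.testBit_or, Nat.testBit_shiftLeft, edgeMask_eq,
    Nat.testBit_or, Nat.testBit_two_pow, Nat.testBit_two_pow]
  simp only [Bool.or_eq_true, Bool.and_eq_true, decide_eq_true_eq]
  constructor
  · rintro ⟨h1, h | ⟨_, h | h⟩⟩
    · exact Or.inl ⟨h1, h⟩
    · right; left; omega
    · right; right; omega
  · rintro (⟨h1, h⟩ | ⟨rfl, rfl⟩ | ⟨rfl, rfl⟩)
    · exact ⟨h1, Or.inl h⟩
    · exact ⟨hj, Or.inr ⟨by omega, Or.inl (by omega)⟩⟩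
    · exact ⟨hw, Or.inr ⟨by omega, Or.inr (by omega)⟩⟩

/-- The set of positions below `12` of the bits of `x`. -/
def bits (x : ℕ) : Finset ℕ := (Finset.range 12).filter fun i => x.testBit i = true

theorem mem_bits {x i : ℕ} : i ∈ bits x ↔ i < 12 ∧ x.testBit i = true := by
  simp [bits]

theorem mem_bits_row {M x y : ℕ} : y ∈ bits (row M x) ↔ Edge M x y := by
  rw [mem_bits]
  exact ⟨fun h => h.2, fun h => ⟨((edge_iff _ _ _).1 h).1, h⟩⟩

theorem popcount_table : ((List.range 4096).all fun x => Nat.beq (popcount x)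
    (Nat.rec 0 (fun i s => Nat.add (cond (hasBit x i) 1 0) s) 12)) = true := by
  decide +kernel

theorem popcount_eq {x : ℕ} (hx : x < 4096) : popcount x = (bits x).card := by
  have h := List.all_eq_true.1 popcount_table x (List.mem_range.2 hx)
  rw [Nat.beq_eq] at h
  rw [h, bits, Finset.card_filter]
  simp only [hasBit_eq, Finset.sum_range_succ, Finset.sum_range_zero]
  simp only [cond_eq_ite]
  change Nat.add _ (Nat.add _ (Nat.add _ (Nat.add _ (Nat.add _ (Nat.add _ (Nat.add _ (Nat.add _ (Nat.add _ (Nat.add _ (Nat.add _ (Nat.add _ 0))))))))))) = _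
  simp only [Nat.add_eq]
  omega

theorem testBit_log2 {x : ℕ} (hx : x ≠ 0) : x.testBit (Nat.log2 x) = true := by
  exact Nat.testBit_log2 hx

theorem testBit_xor_shiftLeft {x k : ℕ} (hk : x.testBit k = true) (i : ℕ) :
    (Nat.xor x (Nat.shiftLeft 1 k)).testBit i = true ↔ x.testBit i = true ∧ i ≠ k := by
  change (x ^^^ (1 <<< k)).testBit i = true ↔ _
  rw [Nat.shiftLeft_eq, one_mul, Nat.testBit_xor, Nat.testBit_two_pow]
  rcases eq_or_ne i k with rfl | h
  · simp [hk]
  · simp [h, h.symm]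

theorem edge_of_testBit_unionRows {M z : ℕ} : ∀ {fuel x : ℕ},
    (unionRows M fuel x).testBit z = true → ∃ y, x.testBit y = true ∧ Edge M y z := by
  intro fuel
  induction fuel with
  | zero => intro x h; simp [unionRows] at h
  | succ fuel ih =>
    intro x h
    change (cond (Nat.beq x 0) 0 (row M (Nat.log2 x) |||
      unionRows M fuel (Nat.xor x (Nat.shiftLeft 1 (Nat.log2 x))))).testBit z = true at h
    cases hx : Nat.beq x 0 with
    | true => simp [hx] at h
    | false =>
      have hx0 : x ≠ 0 := Nat.ne_of_beq_eq_false hx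
      rw [hx, cond_false, Nat.testBit_or, Bool.or_eq_true] at h
      rcases h with h | h
      · exact ⟨_, testBit_log2 hx0, h⟩
      · obtain ⟨y, hy, hyz⟩ := ih h
        exact ⟨y, ((testBit_xor_shiftLeft (testBit_log2 hx0) y).1 hy).1, hyz⟩

theorem xor_shiftLeft_log2_lt {x fuel : ℕ} (hx : x ≠ 0) (h : x < 2 ^ (fuel + 1)) :
    Nat.xor x (Nat.shiftLeft 1 (Nat.log2 x)) < 2 ^ fuel := by
  refine Nat.lt_pow_two_of_testBit _ fun i hi => ?_
  rw [← Bool.not_eq_true, testBit_xor_shiftLeft (testBit_log2 hx)]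
  rintro ⟨h1, h2⟩
  have h3 : i < fuel + 1 := by
    by_contra h4
    rw [Nat.testBit_lt_two_pow (h.trans_le (Nat.pow_le_pow_right (by norm_num) (by omega)))] at h1
    exact absurd h1 (by simp)
  have h5 : x.testBit fuel = true := by
    have : i = fuel := by omega
    rwa [this] at h1
  have h6 : fuel ≤ Nat.log2 x := (Nat.le_log2 hx).2 (Nat.ge_two_pow_of_testBit h5)
  have h7 : Nat.log2 x < fuel + 1 := (Nat.log2_lt hx).2 h
  omega

theorem testBit_unionRows_of_edge {M y z : ℕ} (hyz : Edge M y z) : ∀ {fuel x : ℕ},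
    x < 2 ^ fuel → x.testBit y = true → (unionRows M fuel x).testBit z = true := by
  intro fuel
  induction fuel with
  | zero =>
    intro x hx h
    obtain rfl : x = 0 := by simpa using hx
    simp at h
  | succ fuel ih =>
    intro x hx h
    have hx0 : x ≠ 0 := by rintro rfl; simp at h
    change (cond (Nat.beq x 0) 0 (row M (Nat.log2 x) |||
      unionRows M fuel (Nat.xor x (Nat.shiftLeft 1 (Nat.log2 x))))).testBit z = true
    rw [show Nat.beq x 0 = false from Bool.eq_false_iff.2 fun h => hx0 (Nat.eq_of_beq_eq_true h),
      cond_false, Nat.testBit_or, Bool.or_eq_true]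
    by_cases hk : y = Nat.log2 x
    · left; rw [← hk]; exact hyz
    · right
      exact ih (xor_shiftLeft_log2_lt hx0 hx) ((testBit_xor_shiftLeft (testBit_log2 hx0) y).2 ⟨h, hk⟩)

open Classical in
/-- The number of neighbours below `12` in the relation `P`. -/
noncomputable def deg (P : ℕ → ℕ → Prop) (v : ℕ) : ℕ := ((Finset.range 12).filter (P v)).card

/-- The properties of a labelled graph on `{0, …, 11}` which the search uses; the labels below
`R` are meant to form a cycle. -/
structure Target (R : ℕ) (P : ℕ → ℕ → Prop) : Prop where
  symm : ∀ {a b}, P a b → P b a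
  irrefl : ∀ a, ¬ P a a
  lt : ∀ {a b}, P a b → a < 12
  three_le : ∀ v < 12, 3 ≤ deg P v
  sum_le : ∑ v ∈ Finset.range 12, deg P v ≤ 40
  matching : ∀ {a b c d}, P a b → P c d → a ≠ c → a ≠ d → b ≠ c → b ≠ d →
    ∃ q : ℕ → ℕ, (∀ v < 12, P v (q v)) ∧ (∀ v < 12, q (q v) = v) ∧ q a = b ∧ q c = d
  connected : ∀ S : Set ℕ, (∃ v < 12, v ∈ S) → (∀ v w, v ∈ S → P v w → w ∈ S) → ∀ v < 12, v ∈ S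
  deg_le : ∀ i < R, deg P i ≤ deg P 0
  deg_pred_le : deg P (R - 1) ≤ deg P 1
  triangle_free : 5 ≤ R → ∀ {a b c}, P a b → P b c → ¬ P c a
  pentagon_free : 7 ≤ R → ∀ {a b c d e}, P a b → P b c → P c d → P d e → ¬ P e a

/-- A partial adjacency matrix `M` on the labels below `n` is contained in `P`, where all
neighbours of the vertices in the bit set `C` are already recorded. -/
structure Realizes (R n M B C : ℕ) (P : ℕ → ℕ → Prop) : Prop where
  n_le : n ≤ 12
  le_n : R ≤ n
  lt : ∀ {x y}, Edge M x y → x < n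
  adj : ∀ {x y}, Edge M x y → P x y
  symm : ∀ {x y}, Edge M x y → Edge M y x
  closed_lt : ∀ {x}, C.testBit x = true → x < n
  closed : ∀ {x y}, C.testBit x = true → P x y → Edge M x y
  excess : B ≤ ∑ i ∈ Finset.range 12, max 3 (popcount (row M i))

/-- `P` is isomorphic to the graph `GTwo`. -/
def IsTwo (P : ℕ → ℕ → Prop) : Prop :=
  ∃ e : ℕ → ℕ, (∀ i < 12, e i < 12) ∧ (∀ i < 12, ∀ j < 12, e i = e j → i = j) ∧
    ∀ i < 12, ∀ j < 12, (P i j ↔ Edge twoRows (e i) (e j))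

section

variable {R n M B C : ℕ} {P : ℕ → ℕ → Prop}

theorem Target.lt_right (hP : Target R P) {a b : ℕ} (h : P a b) : b < 12 := hP.lt (hP.symm h)

theorem Realizes.popcount_le (hM : Realizes R n M B C P) (i : ℕ) :
    popcount (row M i) ≤ deg P i := by
  classical
  rw [popcount_eq (row_lt _ _)]
  refine Finset.card_le_card fun j hj => ?_
  rw [mem_bits_row] at hj
  simp only [Finset.mem_filter, Finset.mem_range]
  exact ⟨((edge_iff _ _ _).1 hj).1, hM.adj hj⟩

theorem Realizes.popcount_eq_deg (hM : Realizes R n M B C P) {i : ℕ}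
    (h : ∀ x, P i x → Edge M i x) : popcount (row M i) = deg P i := by
  classical
  refine le_antisymm (hM.popcount_le i) ?_
  rw [popcount_eq (row_lt _ _)]
  refine Finset.card_le_card fun j hj => ?_
  simp only [Finset.mem_filter, Finset.mem_range] at hj
  exact mem_bits_row.2 (h j hj.2)

theorem Realizes.excess_le (hM : Realizes R n M B C P) (hP : Target R P) : B ≤ 40 := by
  refine hM.excess.trans (le_trans (Finset.sum_le_sum fun i hi => ?_) hP.sum_le)
  exact max_le (hP.three_le i (Finset.mem_range.1 hi)) (hM.popcount_le i)

theorem popcount_addEdge_le {w j : ℕ} (hw : w < 12) (hj : j < 12) (i : ℕ) :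
    popcount (row M i) ≤ popcount (row (addEdge M w j) i) := by
  rw [popcount_eq (row_lt _ _), popcount_eq (row_lt _ _)]
  refine Finset.card_le_card fun y hy => ?_
  rw [mem_bits_row] at hy ⊢
  exact (edge_addEdge M hw hj _ _).2 (Or.inl hy)

theorem popcount_addEdge {w j : ℕ} (hw : w < 12) (hj : j < 12) {x y : ℕ}
    (hxy : x = w ∧ y = j ∨ x = j ∧ y = w) (h : ¬ Edge M x y) :
    popcount (row M x) + 1 ≤ popcount (row (addEdge M w j) x) := by
  rw [popcount_eq (row_lt _ _), popcount_eq (row_lt _ _)]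
  refine Finset.card_lt_card (Finset.ssubset_iff_of_subset (fun z hz => ?_) |>.2
    ⟨y, mem_bits_row.2 ((edge_addEdge M hw hj _ _).2 (Or.inr hxy)), fun hz => h (mem_bits_row.1 hz)⟩)
  rw [mem_bits_row] at hz ⊢
  exact (edge_addEdge M hw hj _ _).2 (Or.inl hz)

theorem bump_le {x y : ℕ} (h : popcount x + 1 ≤ popcount y) :
    max 3 (popcount x) + bump x ≤ max 3 (popcount y) := by
  unfold bump
  cases hx : Nat.ble 3 (popcount x) with
  | true => have := Nat.le_of_ble_eq_true hx; simp only [cond_true]; omega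
  | false => simp only [cond_false]; omega

theorem Realizes.add_bump_le (hM : Realizes R n M B C P) {w j : ℕ} (hw : w < 12) (hj : j < 12)
    (hwj : w ≠ j) (h : ¬ Edge M w j) :
    B + (bump (row M w) + bump (row M j)) ≤
      ∑ i ∈ Finset.range 12, max 3 (popcount (row (addEdge M w j) i)) := by
  have h' : ¬ Edge M j w := fun h' => h (hM.symm h')
  have hs : ∑ i ∈ Finset.range 12, ((if i = w then bump (row M w) else 0) +
      (if i = j then bump (row M j) else 0)) = bump (row M w) + bump (row M j) := by
    rw [Finset.sum_add_distrib, Finset.sum_ite_eq' , Finset.sum_ite_eq', if_pos (by simpa using hw),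
      if_pos (by simpa using hj)]
  rw [← hs]
  refine (Nat.add_le_add_right hM.excess _).trans ?_
  rw [← Finset.sum_add_distrib]
  refine Finset.sum_le_sum fun i _ => ?_
  rcases eq_or_ne i w with rfl | hiw
  · have := bump_le (popcount_addEdge hw hj (Or.inl ⟨rfl, rfl⟩) h)
    simpa [hwj] using this
  · rcases eq_or_ne i j with rfl | hij
    · have := bump_le (popcount_addEdge hw hj (Or.inr ⟨rfl, rfl⟩) h')
      simpa [hiw] using this
    · simp only [hiw, hij, if_false, add_zero]
      exact max_le_max le_rfl (popcount_addEdge_le hw hj i)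

theorem Realizes.addEdge (hM : Realizes R n M B C P) (hP : Target R P) {w j n' B' : ℕ}
    (hn : n ≤ n') (hn' : n' ≤ 12) (hw : w < n') (hj : j < n') (h : P w j)
    (hB : B' ≤ ∑ i ∈ Finset.range 12, max 3 (popcount (row (addEdge M w j) i))) :
    Realizes R n' (addEdge M w j) B' C P where
  n_le := hn'
  le_n := hM.le_n.trans hn
  lt := by
    intro x y hxy
    rw [edge_addEdge M (hw.trans_le hn') (hj.trans_le hn')] at hxy
    rcases hxy with hxy | ⟨rfl, _⟩ | ⟨rfl, _⟩
    · exact (hM.lt hxy).trans_le hn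
    · exact hw
    · exact hj
  adj := by
    intro x y hxy
    rw [edge_addEdge M (hw.trans_le hn') (hj.trans_le hn')] at hxy
    rcases hxy with hxy | ⟨rfl, rfl⟩ | ⟨rfl, rfl⟩
    · exact hM.adj hxy
    · exact h
    · exact hP.symm h
  symm := by
    intro x y hxy
    rw [edge_addEdge M (hw.trans_le hn') (hj.trans_le hn')] at hxy ⊢
    rcases hxy with hxy | hxy | hxy
    · exact Or.inl (hM.symm hxy)
    · exact Or.inr (Or.inr hxy.symm)
    · exact Or.inr (Or.inl hxy.symm)
  closed_lt := fun hx => (hM.closed_lt hx).trans_le hn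
  closed := fun hx hxy =>
    (edge_addEdge M (hw.trans_le hn') (hj.trans_le hn') _ _).2 (Or.inl (hM.closed hx hxy))
  excess := hB

end

theorem testBit_shiftLeft_or (a b i : ℕ) :
    (Nat.lor (Nat.shiftLeft 1 a) (Nat.shiftLeft 1 b)).testBit i = true ↔ i = a ∨ i = b := by
  change (1 <<< a ||| 1 <<< b).testBit i = true ↔ _
  rw [Nat.shiftLeft_eq, Nat.shiftLeft_eq, one_mul, one_mul, Nat.testBit_or, Bool.or_eq_true,
    Nat.testBit_two_pow, Nat.testBit_two_pow, decide_eq_true_iff, decide_eq_true_iff,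
    eq_comm (a := a), eq_comm (a := b)]

theorem cond_false_right {b c : Bool} : cond b c false = true ↔ b = true ∧ c = true := by
  cases b <;> simp

theorem cond_true_right {b c : Bool} : cond b c true = true ↔ (b = true → c = true) := by
  cases b <;> simp

theorem Realizes.not_refutes {R n M B C : ℕ} {P : ℕ → ℕ → Prop} (hM : Realizes R n M B C P)
    (hP : Target R P) {a b c d I : ℕ} (hI : I < 4096) : refutes M C a b c d I ≠ true := by
  intro h
  simp only [refutes, force_eq, cond_false_right, hasBit_eq, Nat.beq_eq] at h
  obtain ⟨hab, hcd, hCI, hdisj, hused, hdef⟩ := h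
  have hab' : P a b := hM.adj hab
  have hcd' : P c d := hM.adj hcd
  set m := Nat.lor (Nat.shiftLeft 1 a) (Nat.shiftLeft 1 b) with hm
  set m' := Nat.lor (Nat.shiftLeft 1 c) (Nat.shiftLeft 1 d) with hm'
  have hmm (i : ℕ) : ¬ (m.testBit i = true ∧ m'.testBit i = true) := by
    have : (m &&& m').testBit i = false := by
      rw [show m &&& m' = 0 from hdisj, Nat.zero_testBit]
    rw [Nat.testBit_and] at this
    rintro ⟨h1, h2⟩
    simp [h1, h2] at this
  simp only [hm, hm', testBit_shiftLeft_or] at hmm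
  have hu (i : ℕ) : (Nat.lor m m').testBit i = true ↔ (i = a ∨ i = b) ∨ (i = c ∨ i = d) := by
    change (m ||| m').testBit i = true ↔ _
    rw [Nat.testBit_or, Bool.or_eq_true, hm, hm', testBit_shiftLeft_or, testBit_shiftLeft_or]
  set used := Nat.lor m m' with hused_def
  have hlt : used < 2 ^ 12 := by
    refine Nat.lt_pow_two_of_testBit _ fun i hi => ?_
    rw [← Bool.not_eq_true, hu]
    have := hP.lt hab'; have := hP.lt_right hab'; have := hP.lt hcd'; have := hP.lt_right hcd'
    omega
  obtain ⟨q, hPq, hqq, hqa, hqc⟩ := hP.matching hab' hcd'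
    (fun h => hmm a ⟨Or.inl rfl, Or.inl h⟩) (fun h => hmm a ⟨Or.inl rfl, Or.inr h⟩)
    (fun h => hmm b ⟨Or.inr rfl, Or.inl h⟩) (fun h => hmm b ⟨Or.inr rfl, Or.inr h⟩)
  have hqb : q b = a := by rw [← hqa]; exact hqq a (hP.lt hab')
  have hqd : q d = c := by rw [← hqc]; exact hqq c (hP.lt hcd')
  have hx4095 : Nat.xor 4095 used < 2 ^ 12 := Nat.xor_lt_two_pow (by norm_num) hlt
  have hland : Nat.land (unionRows M 12 I) (Nat.xor 4095 used) < 4096 :=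
    Nat.lt_of_le_of_lt Nat.and_le_right hx4095
  rw [deficient, Nat.blt_eq, popcount_eq hland, popcount_eq hI] at hdef
  refine absurd hdef (not_lt.2 (Finset.card_le_card_of_injOn q (fun x hx => ?_) fun x hx y hy hxy => ?_))
  · rw [Finset.mem_coe, mem_bits] at hx
    have hPx := hPq x hx.1
    have hxC : C.testBit x = true := by
      have : (C &&& I).testBit x = true := by rw [show C &&& I = I from hCI]; exact hx.2
      rw [Nat.testBit_and, Bool.and_eq_true] at this
      exact this.1
    have hxu : ¬ ((x = a ∨ x = b) ∨ (x = c ∨ x = d)) := by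
      rw [← hu]
      intro h
      have : (used &&& I).testBit x = true := by rw [Nat.testBit_and, h, hx.2]; rfl
      rw [show used &&& I = 0 from hused, Nat.zero_testBit] at this
      exact absurd this (by simp)
    have hqu : ¬ ((q x = a ∨ q x = b) ∨ (q x = c ∨ q x = d)) := by
      rintro ((h | h) | (h | h)) <;> have h2 := hqq x hx.1 <;> rw [h] at h2
      · exact hxu (Or.inl (Or.inr (h2.symm.trans hqa)))
      · exact hxu (Or.inl (Or.inl (h2.symm.trans hqb)))
      · exact hxu (Or.inr (Or.inr (h2.symm.trans hqc)))
      · exact hxu (Or.inr (Or.inl (h2.symm.trans hqd)))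
    rw [Finset.mem_coe, mem_bits]
    refine ⟨hP.lt_right hPx, ?_⟩
    change (_ &&& (4095 ^^^ used)).testBit (q x) = true
    rw [Nat.testBit_and, testBit_unionRows_of_edge (hM.closed hxC hPx) hI hx.2, Nat.testBit_xor,
      Bool.eq_false_iff.2 (mt (hu _).1 hqu), show 4095 = 2 ^ 12 - 1 by norm_num,
      Nat.testBit_two_pow_sub_one]
    simpa using hP.lt_right hPx
  · rw [Finset.mem_coe, mem_bits] at hx hy
    rw [← hqq x hx.1, ← hqq y hy.1, hxy]

theorem Realizes.not_kills {R n M B C : ℕ} {P : ℕ → ℕ → Prop} (hM : Realizes R n M B C P)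
    (hP : Target R P) : ∀ fuel t, kills M C fuel t = false := by
  intro fuel
  induction fuel with
  | zero => intro t; rfl
  | succ fuel ih =>
    intro t
    change cond (Nat.beq t 0) false (cond (refutes M C _ _ _ _ _) true
      (force _ (kills M C fuel))) = false
    have hland : Nat.land (Nat.shiftRight t 16) 4095 < 4096 :=
      Nat.lt_of_le_of_lt Nat.and_le_right (by norm_num)
    rw [Bool.eq_false_iff.2 (hM.not_refutes hP hland),
      force_eq, ih]
    cases Nat.beq t 0 <;> rfl

theorem Realizes.girthOK {R n M B C : ℕ} {P : ℕ → ℕ → Prop} (hM : Realizes R n M B C P)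
    (hP : Target R P) {w j : ℕ} (h : P w j) : girthOK R M w j = true := by
  have hzero {x y : ℕ} (h : ∀ i, x.testBit i = true → y.testBit i = true → False) :
      Nat.land x y = 0 := by
    refine Nat.eq_of_testBit_eq fun i => ?_
    change (x &&& y).testBit i = _
    rw [Nat.testBit_and, Nat.zero_testBit, ← Bool.not_eq_true, Bool.and_eq_true]
    exact fun h' => h i h'.1 h'.2
  simp only [_root_.girthOK, cond_false_right, cond_true_right, Nat.beq_eq, Nat.ble_eq]
  refine fun h5 => ⟨hzero fun z h1 h2 => ?_, fun h7 => hzero fun z h1 h2 => ?_⟩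
  · exact hP.triangle_free h5 h (hM.adj h2) (hP.symm (hM.adj h1))
  · obtain ⟨x, hx, hxz⟩ := edge_of_testBit_unionRows h1
    obtain ⟨y, hy, hyz⟩ := edge_of_testBit_unionRows h2
    exact hP.pentagon_free h7 h (hM.adj hy) (hM.adj hyz) (hP.symm (hM.adj hxz))
      (hP.symm (hM.adj hx))

theorem rowsBelow_eq_true {M d : ℕ} : ∀ {i : ℕ}, (∀ k < i, popcount (row M k) ≤ d) →
    rowsBelow M d i = true := by
  intro i
  induction i with
  | zero => intro _; rfl
  | succ i ih =>
    intro h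
    change cond (Nat.ble (popcount (row M i)) d) (rowsBelow M d i) false = true
    rw [cond_false_right, Nat.ble_eq]
    exact ⟨h i (by omega), ih fun k hk => h k (by omega)⟩

theorem Realizes.capOK {R n M B C : ℕ} {P : ℕ → ℕ → Prop} (hM : Realizes R n M B C P)
    (hP : Target R P) : capOK R M C = true := by
  simp only [_root_.capOK, cond_false_right, cond_true_right, force_eq, hasBit_eq, Nat.ble_eq]
  refine ⟨fun h => rowsBelow_eq_true fun k hk => ?_, fun h => ?_⟩
  · rw [hM.popcount_eq_deg fun x hx => hM.closed h hx]
    exact (hM.popcount_le k).trans (hP.deg_le k hk)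
  · rw [hM.popcount_eq_deg fun x hx => hM.closed h hx]
    exact (hM.popcount_le _).trans hP.deg_pred_le

/-- A successful run of `next` establishes that its state is only realized by `GTwo`. -/
def Sound (R : ℕ) (next : Continuation) : Prop :=
  ∀ n M B C s s', next n M B C s = some s' →
    ∀ P, Target R P → Realizes R n M B C P → IsTwo P

theorem chain_eq_some {o : Option (List ℕ)} {k : List ℕ → Option (List ℕ)} {s : List ℕ} :
    chain o k = some s ↔ ∃ s', o = some s' ∧ k s' = some s := by
  cases o <;> simp [chain]

theorem closeVertex_sound {R w t n M B C : ℕ} {next : Continuation} {s s' : List ℕ}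
    {P : ℕ → ℕ → Prop} (hnext : Sound R next)
    (h : closeVertex R w t next n M B C s = some s') (hP : Target R P)
    (hM : Realizes R n M B C P) (hw : w < n) (hwn : ∀ x, P w x → Edge M w x) : IsTwo P := by
  have hM' : Realizes R n M B (Nat.lor C (Nat.shiftLeft 1 w)) P :=
    { hM with
      closed_lt := by
        intro x hx
        change (C ||| 1 <<< w).testBit x = true at hx
        rw [Nat.shiftLeft_eq, one_mul, Nat.testBit_or, Bool.or_eq_true, Nat.testBit_two_pow,
          decide_eq_true_iff] at hx
        rcases hx with hx | rfl
        · exact hM.closed_lt hx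
        · exact hw
      closed := by
        intro x y hx hxy
        change (C ||| 1 <<< w).testBit x = true at hx
        rw [Nat.shiftLeft_eq, one_mul, Nat.testBit_or, Bool.or_eq_true, Nat.testBit_two_pow,
          decide_eq_true_iff] at hx
        rcases hx with hx | rfl
        · exact hM.closed hx hxy
        · exact hwn y hxy }
  have hdeg : Nat.ble 3 (popcount (row M w)) = true := by
    rw [Nat.ble_eq, hM.popcount_eq_deg hwn]
    exact hP.three_le w (hw.trans_le hM.n_le)
  rw [closeVertex, hdeg, cond_true, force_eq, hM'.capOK hP, hM'.not_kills hP, cond_true,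
    cond_false] at h
  exact hnext _ _ _ _ _ _ h P hP hM'

open Classical in
theorem deg_comp_swap (P : ℕ → ℕ → Prop) {n m : ℕ} (hn : n < 12) (hm : m < 12) (v : ℕ) :
    deg (fun x y => P (Equiv.swap n m x) (Equiv.swap n m y)) v = deg P (Equiv.swap n m v) := by
  have hlt {x : ℕ} (hx : x < 12) : Equiv.swap n m x < 12 := by
    rw [Equiv.swap_apply_def]; split_ifs <;> assumption
  refine Finset.card_bij' (fun x _ => Equiv.swap n m x) (fun x _ => Equiv.swap n m x) ?_ ?_ ?_ ?_
  · intro x hx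
    simp only [Finset.mem_filter, Finset.mem_range] at hx ⊢
    exact ⟨hlt hx.1, hx.2⟩
  · intro x hx
    simp only [Finset.mem_filter, Finset.mem_range, Equiv.swap_apply_self] at hx ⊢
    exact ⟨hlt hx.1, hx.2⟩
  · intro x _; simp
  · intro x _; simp

theorem Target.comp_swap {R n m : ℕ} {P : ℕ → ℕ → Prop} (hP : Target R P) (hR : 2 ≤ R)
    (hn : n < 12) (hm : m < 12) (hRn : R ≤ n) (hRm : R ≤ m) :
    Target R fun x y => P (Equiv.swap n m x) (Equiv.swap n m y) := by
  have hlt {x : ℕ} (hx : x < 12) : Equiv.swap n m x < 12 := by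
    rw [Equiv.swap_apply_def]; split_ifs <;> assumption
  have hfix {x : ℕ} (hx : x < R) : Equiv.swap n m x = x :=
    Equiv.swap_apply_of_ne_of_ne (by omega) (by omega)
  have hlt' {x : ℕ} (hx : Equiv.swap n m x < 12) : x < 12 := by
    have := hlt hx; rwa [Equiv.swap_apply_self] at this
  exact
  { symm := fun h => hP.symm h
    irrefl := fun a => hP.irrefl _
    lt := fun h => hlt' (hP.lt h)
    three_le := fun v hv => by rw [deg_comp_swap P hn hm]; exact hP.three_le _ (hlt hv)
    sum_le := by
      simp only [deg_comp_swap P hn hm]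
      refine le_of_eq_of_le ?_ hP.sum_le
      refine Finset.sum_bij' (fun x _ => Equiv.swap n m x) (fun x _ => Equiv.swap n m x) ?_ ?_ ?_ ?_ ?_
      · intro x hx; exact Finset.mem_range.2 (hlt (Finset.mem_range.1 hx))
      · intro x hx; exact Finset.mem_range.2 (hlt (Finset.mem_range.1 hx))
      · intro x _; simp
      · intro x _; simp
      · intro x _; simp
    matching := by
      intro a b c d hab hcd h1 h2 h3 h4
      have hne {x y : ℕ} (h : x ≠ y) : Equiv.swap n m x ≠ Equiv.swap n m y :=
        fun h' => h ((Equiv.swap n m).injective h')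
      obtain ⟨q, hq1, hq2, hq3, hq4⟩ := hP.matching hab hcd (hne h1) (hne h2) (hne h3) (hne h4)
      refine ⟨fun v => Equiv.swap n m (q (Equiv.swap n m v)), fun v hv => ?_, fun v hv => ?_, ?_, ?_⟩
      · simpa using hq1 _ (hlt hv)
      · simp [hq2 _ (hlt hv)]
      · simp [hq3]
      · simp [hq4]
    connected := by
      rintro S ⟨v, hv, hvS⟩ hS u hu
      have := hP.connected ((Equiv.swap n m) ⁻¹' S) ⟨Equiv.swap n m v, hlt hv, by simpa using hvS⟩
        (fun x y hx hxy => hS (Equiv.swap n m x) _ hx (by simpa using hxy))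
        (Equiv.swap n m u) (hlt hu)
      simpa using this
    deg_le := fun i hi => by
      rw [deg_comp_swap P hn hm, deg_comp_swap P hn hm, hfix hi, hfix (by omega)]
      exact hP.deg_le i hi
    deg_pred_le := by
      rw [deg_comp_swap P hn hm, deg_comp_swap P hn hm, hfix (by omega), hfix (by omega)]
      exact hP.deg_pred_le
    triangle_free := fun h5 _ _ _ h1 h2 => hP.triangle_free h5 h1 h2
    pentagon_free := fun h7 _ _ _ _ _ h1 h2 h3 h4 => hP.pentagon_free h7 h1 h2 h3 h4 }

theorem Realizes.comp_swap {R n m M B C : ℕ} {P : ℕ → ℕ → Prop} (hM : Realizes R n M B C P)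
    (hm : n ≤ m) :
    Realizes R n M B C fun x y => P (Equiv.swap n m x) (Equiv.swap n m y) := by
  have hfix {x : ℕ} (hx : x < n) : Equiv.swap n m x = x :=
    Equiv.swap_apply_of_ne_of_ne (by omega) (by omega)
  exact
  { hM with
    adj := fun h => by
      rw [hfix (hM.lt h), hfix (hM.lt (hM.symm h))]
      exact hM.adj h
    closed := by
      intro x y hx hxy
      rw [hfix (hM.closed_lt hx)] at hxy
      have h := hM.closed hx hxy
      have h' := hfix (hM.lt (hM.symm h))
      rw [Equiv.swap_apply_self] at h'
      rwa [← h'] at h }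

theorem IsTwo.of_comp_swap {P : ℕ → ℕ → Prop} {n m : ℕ} (hn : n < 12) (hm : m < 12)
    (h : IsTwo fun x y => P (Equiv.swap n m x) (Equiv.swap n m y)) : IsTwo P := by
  have hlt {x : ℕ} (hx : x < 12) : Equiv.swap n m x < 12 := by
    rw [Equiv.swap_apply_def]; split_ifs <;> assumption
  obtain ⟨e, h1, h2, h3⟩ := h
  refine ⟨fun x => e (Equiv.swap n m x), fun i hi => h1 _ (hlt hi), fun i hi j hj hij => ?_,
    fun i hi j hj => ?_⟩
  · exact (Equiv.swap n m).injective (h2 _ (hlt hi) _ (hlt hj) hij)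
  · rw [← h3 _ (hlt hi) _ (hlt hj)]; simp

theorem addFresh_sound {R w t C : ℕ} {next : Continuation} (hnext : Sound R next) (hR : 2 ≤ R) :
    ∀ {fuel n M B : ℕ} {s s' : List ℕ} {P : ℕ → ℕ → Prop},
    addFresh R w t next C fuel n M B s = some s' → Target R P → Realizes R n M B C P → w < n →
    (∀ x < n, P w x → Edge M w x) → IsTwo P := by
  intro fuel
  induction fuel with
  | zero => intro n M B s s' P h; exact absurd h (by simp [addFresh])
  | succ fuel ih =>
    intro n M B s s' P h hP hM hw hwn
    change chain (closeVertex R w t next n M B C s) (fun s' => cond (Nat.ble 12 n) (some s')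
      (force (B + bump (row M w)) fun B' => cond (Nat.ble B' 40)
        (force (addEdge M w n) fun M' => force (n + 1) fun n' =>
          addFresh R w t next C fuel n' M' B' s') (some s'))) = some s' at h
    rw [chain_eq_some] at h
    obtain ⟨s'', h1, h2⟩ := h
    by_cases hall : ∀ x, P w x → x < n
    · exact closeVertex_sound hnext h1 hP hM hw fun x hx => hwn x (hall x hx) hx
    push Not at hall
    obtain ⟨m, hm, hnm⟩ := hall
    have hm12 := hP.lt_right hm
    have hn12 : n < 12 := by omega
    refine IsTwo.of_comp_swap hn12 hm12 ?_
    have hP' := hP.comp_swap hR hn12 hm12 hM.le_n (hM.le_n.trans hnm)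
    have hM' := hM.comp_swap hnm
    have hfix {x : ℕ} (hx : x < n) : Equiv.swap n m x = x :=
      Equiv.swap_apply_of_ne_of_ne (by omega) (by omega)
    have hwn' : P (Equiv.swap n m w) (Equiv.swap n m n) := by
      rw [hfix hw, Equiv.swap_apply_left]; exact hm
    have hnew : ¬ Edge M w n := fun h => lt_irrefl _ (hM.lt (hM.symm h))
    have hB := (Nat.add_le_add_left (Nat.le_add_right _ _) B).trans
      (hM'.add_bump_le (hw.trans hn12) hn12 hw.ne hnew)
    have hM'' := hM'.addEdge hP' (Nat.le_succ n) hn12 (hw.trans (Nat.lt_succ_self n))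
      (Nat.lt_succ_self n) hwn' hB
    have h40 : Nat.ble (B + bump (row M w)) 40 = true := by
      rw [Nat.ble_eq]; exact hM''.excess_le hP'
    have h12 : Nat.ble 12 n = false := by
      rw [← Bool.not_eq_true, Nat.ble_eq]; omega
    rw [h12, cond_false, force_eq, h40, cond_true, force_eq, force_eq] at h2
    refine ih h2 hP' hM'' (hw.trans (Nat.lt_succ_self n)) fun x hx hwx => ?_
    rw [edge_addEdge M (hw.trans hn12) hn12]
    rcases Nat.lt_succ_iff_lt_or_eq.1 hx with hx | rfl
    · rw [hfix hw, hfix hx] at hwx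
      exact Or.inl (hwn x hx hwx)
    · exact Or.inr (Or.inl ⟨rfl, rfl⟩)

theorem expand_sound {R w t C n : ℕ} {next : Continuation} (hnext : Sound R next) (hR : 2 ≤ R)
    {P : ℕ → ℕ → Prop} (hP : Target R P) (hw : w < n) :
    ∀ {fuel X M B : ℕ} {s s' : List ℕ}, expand R w t next n C fuel X M B s = some s' →
    Realizes R n M B C P → (∀ j, X.testBit j = true → j < n ∧ j ≠ w ∧ ¬ Edge M w j) →
    (∀ x < n, P w x → Edge M w x ∨ X.testBit x = true) → IsTwo P := by
  intro fuel
  induction fuel with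
  | zero => intro X M B s s' h; exact absurd h (by simp [expand])
  | succ fuel ih =>
    intro X M B s s' h hM hX hwX
    change cond (Nat.beq X 0) (addFresh R w t next C 13 n M B s)
      (force (Nat.log2 X) fun j => force (Nat.xor X (Nat.shiftLeft 1 j)) fun X' =>
        chain (force (B + (bump (row M w) + bump (row M j))) fun B' =>
          cond (Nat.ble B' 40) (cond (girthOK R M w j)
            (force (addEdge M w j) fun M' => expand R w t next n C fuel X' M' B' s)
            (some s)) (some s)) fun s' => expand R w t next n C fuel X' M B s') = some s' at h
    cases hX0 : Nat.beq X 0 with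
    | true =>
      rw [hX0, cond_true] at h
      obtain rfl := Nat.eq_of_beq_eq_true hX0
      exact addFresh_sound hnext hR h hP hM hw fun x hx hwx => by simpa using hwX x hx hwx
    | false =>
      have hlog := testBit_log2 (Nat.ne_of_beq_eq_false hX0)
      rw [hX0, cond_false, force_eq, force_eq, chain_eq_some] at h
      obtain ⟨s'', h1, h2⟩ := h
      generalize Nat.log2 X = j at *
      have hX' := testBit_xor_shiftLeft hlog
      obtain ⟨hjn, hjw, hj⟩ := hX j hlog
      have hw12 := hw.trans_le hM.n_le
      have hj12 := hjn.trans_le hM.n_le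
      by_cases hwj : P w j
      · have hM' := hM.addEdge hP le_rfl hM.n_le hw hjn hwj (hM.add_bump_le hw12 hj12 hjw.symm hj)
        have h40 : Nat.ble (B + (bump (row M w) + bump (row M j))) 40 = true := by
          rw [Nat.ble_eq]; exact hM'.excess_le hP
        rw [force_eq, h40, cond_true, hM.girthOK hP hwj, cond_true, force_eq] at h1
        refine ih h1 hM' (fun i hi => ?_) fun x hx hwx => ?_
        · rw [hX'] at hi
          obtain ⟨h3, h4, h5⟩ := hX i hi.1
          refine ⟨h3, h4, ?_⟩
          rw [edge_addEdge M hw12 hj12]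
          rintro (h6 | ⟨_, h6⟩ | ⟨h6, _⟩)
          · exact h5 h6
          · exact hi.2 h6
          · exact hjw h6.symm
        · rw [edge_addEdge M hw12 hj12, hX']
          rcases hwX x hx hwx with h3 | h3
          · exact Or.inl (Or.inl h3)
          · rcases eq_or_ne x j with rfl | h4
            · exact Or.inl (Or.inr (Or.inl ⟨rfl, rfl⟩))
            · exact Or.inr ⟨h3, h4⟩
      · refine ih h2 hM (fun i hi => hX i ((hX' i).1 hi).1) fun x hx hwx => ?_
        rw [hX']
        refine (hwX x hx hwx).imp_right fun h3 => ⟨h3, ?_⟩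
        rintro rfl
        exact hwj hwx

theorem testBit_candidates {n M C w j : ℕ} (hn : n ≤ 12) : (candidates n M C w).testBit j = true ↔
    j < n ∧ C.testBit j = false ∧ ¬ Edge M w j ∧ j ≠ w := by
  change ((1 <<< n - 1) &&& (4095 ^^^ (C ||| (row M w ||| 1 <<< w)))).testBit j = true ↔ _
  rw [Nat.testBit_and, Nat.testBit_xor, Nat.testBit_or, Nat.testBit_or, Nat.shiftLeft_eq,
    Nat.shiftLeft_eq, one_mul, one_mul, Nat.testBit_two_pow_sub_one,
    show 4095 = 2 ^ 12 - 1 by norm_num, Nat.testBit_two_pow_sub_one, Nat.testBit_two_pow, Edge,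
    Bool.and_eq_true, decide_eq_true_iff]
  refine and_congr_right fun hj => ?_
  rw [decide_eq_true (hj.trans_le hn)]
  cases C.testBit j <;> cases (row M w).testBit j <;> simp [@eq_comm _ j w]

theorem isTwo_of_relabels {M t : ℕ} {P : ℕ → ℕ → Prop} (h : relabels M t = true)
    (hP : ∀ i < 12, ∀ j < 12, (P i j ↔ Edge M i j)) : IsTwo P := by
  simp only [relabels, List.all_eq_true, List.mem_range, Bool.and_eq_true, Nat.blt_eq, hasBit_eq,
    Bool.or_eq_true, beq_iff_eq, Bool.not_eq_true', beq_eq_false_iff_ne] at h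
  refine ⟨fun i => t / 16 ^ i % 16, fun i hi => (h i hi).1, fun i hi j hj hij => ?_,
    fun i hi j hj => ?_⟩
  · exact (((h i hi).2 j hj).2).resolve_right fun h' => h' hij
  · rw [hP i hi j hj, Edge, Edge, ((h i hi).2 j hj).1]

theorem pop_eq_some {s s' : List ℕ} {k : ℕ → List ℕ → Option (List ℕ)} (h : pop s k = some s') :
    ∃ t s'', k t s'' = some s' := by
  cases s with
  | nil => exact absurd h (by simp [pop])
  | cons t s =>
    refine ⟨t, s, ?_⟩
    change force t (fun t => k t s) = some s' at h
    rwa [force_eq] at h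

theorem search_sound {R : ℕ} (hR : 2 ≤ R) : ∀ fuel, Sound R (search R fuel) := by
  intro fuel
  induction fuel with
  | zero => intro n M B C s s' h; exact absurd h (by simp [search])
  | succ fuel ih =>
    intro n M B C s s' h P hP hM
    change cond (Nat.beq (C + 1) (1 <<< n)) (cond (Nat.blt n 12) (some s)
        (pop s fun t s' => cond (relabels M t) (some s') none))
      (pop s fun t s' => force (Nat.mod t 16) fun w => force (Nat.div t 16) fun t' =>
        cond (Nat.blt w n) (force (candidates n M C w) fun X =>
          expand R w t' (search R fuel) n C 14 X M B s') none) = some s' at h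
    have hn := hM.n_le
    cases hC : Nat.beq (C + 1) (1 <<< n) with
    | true =>
      have hC' : C = 2 ^ n - 1 := by
        have := Nat.eq_of_beq_eq_true hC
        rw [Nat.shiftLeft_eq, one_mul] at this
        omega
      have hclosed {x : ℕ} (hx : x < n) : C.testBit x = true := by
        rw [hC', Nat.testBit_two_pow_sub_one]; simpa using hx
      cases hn12 : Nat.blt n 12 with
      | true =>
        rw [Nat.blt_eq] at hn12
        refine absurd (hP.connected {x | x < n} ⟨0, by omega, ?_⟩ (fun v w hv hvw => ?_) n hn12)
          (lt_irrefl n)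
        · exact (Nat.lt_of_lt_of_le (by omega) hM.le_n : 0 < n)
        · exact hM.lt (hM.symm (hM.closed (hclosed hv) hvw))
      | false =>
        rw [hC, hn12, cond_true, cond_false] at h
        obtain ⟨t, s'', h⟩ := pop_eq_some h
        obtain rfl : n = 12 := by
          rw [← Bool.not_eq_true, Nat.blt_eq] at hn12; omega
        cases ht : relabels M t with
        | false => rw [ht] at h; exact absurd h (by simp)
        | true => exact isTwo_of_relabels ht fun i hi j _ => ⟨hM.closed (hclosed hi), hM.adj⟩
    | false =>
      rw [hC, cond_false] at h
      obtain ⟨t, s'', h⟩ := pop_eq_some h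
      rw [force_eq, force_eq] at h
      generalize Nat.mod t 16 = w at h
      cases hw : Nat.blt w n with
      | false => rw [hw] at h; exact absurd h (by simp)
      | true =>
        rw [hw, cond_true, force_eq] at h
        rw [Nat.blt_eq] at hw
        refine expand_sound ih hR hP hw h hM (fun j hj => ?_) fun x hx hwx => ?_
        · rw [testBit_candidates hn] at hj
          exact ⟨hj.1, hj.2.2.2, hj.2.2.1⟩
        · rw [testBit_candidates hn]
          by_cases hedge : Edge M w x
          · exact Or.inl hedge
          · refine Or.inr ⟨hx, Bool.eq_false_iff.2 fun hxC => ?_, hedge, ?_⟩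
            · exact hedge (hM.symm (hM.closed hxC (hP.symm hwx)))
            · rintro rfl
              exact hP.irrefl _ hwx

theorem verifies_sound {R M : ℕ} {s : List ℕ} {P : ℕ → ℕ → Prop} (hR : 2 ≤ R) (hR' : R ≤ 12)
    (h : verifies R M s = true) (hP : Target R P) (hlt : ∀ {x y}, Edge M x y → x < R)
    (hsymm : ∀ {x y}, Edge M x y → Edge M y x) (hMP : ∀ {x y}, Edge M x y → P x y) : IsTwo P := by
  rw [verifies] at h
  cases hs : search R 14 R M 36 0 s with
  | none => rw [hs] at h; exact absurd h (by simp)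
  | some s' =>
    refine search_sound hR _ _ _ _ _ _ _ hs P hP
      ⟨hR', le_rfl, hlt, hMP, hsymm, by simp, by simp, ?_⟩
    refine le_trans ?_ (Finset.sum_le_sum fun i _ => le_max_left 3 _)
    simp

section

variable {V : Type} {G : SimpleGraph V}

theorem IsExtendable.exists_matching (h : IsExtendable G 2) :
    ∃ q : V → V, (∀ v, G.Adj v (q v)) ∧ ∀ v, q (q v) = v := by
  obtain ⟨_, ⟨M, hM, hM2⟩, hext⟩ := h
  obtain ⟨P, hP, _⟩ := hext M hM hM2
  rw [Subgraph.isPerfectMatching_iff] at hP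
  choose q hq hq' using hP
  exact ⟨q, fun v => (hq v).adj_sub, fun v => (hq' _ _ (hq v).symm).symm⟩

theorem IsExtendable.exists_matching_of_adj_adj (h : IsExtendable G 2) {a b c d : V}
    (hab : G.Adj a b) (hcd : G.Adj c d) (hac : a ≠ c) (had : a ≠ d) (hbc : b ≠ c) (hbd : b ≠ d) :
    ∃ q : V → V, (∀ v, G.Adj v (q v)) ∧ (∀ v, q (q v) = v) ∧ q a = b ∧ q c = d := by
  obtain ⟨_, _, hext⟩ := h
  obtain ⟨P, hP, hle⟩ := hext (G.subgraphOfAdj hab ⊔ G.subgraphOfAdj hcd)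
    ((Subgraph.IsMatching.subgraphOfAdj hab).sup (Subgraph.IsMatching.subgraphOfAdj hcd) (by
      rw [support_subgraphOfAdj, support_subgraphOfAdj]
      simp [hac.symm, had.symm, hbc.symm, hbd.symm])) (by
      rw [Subgraph.edgeSet_sup, edgeSet_subgraphOfAdj, edgeSet_subgraphOfAdj,
        Set.singleton_union, Set.ncard_pair]
      simp [hac, had])
  rw [Subgraph.isPerfectMatching_iff] at hP
  choose q hq hq' using hP
  refine ⟨q, fun v => (hq v).adj_sub, fun v => (hq' _ _ (hq v).symm).symm, ?_, ?_⟩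
  · exact (hq' _ _ (hle.2 (Or.inl (subgraphOfAdj_adj_self hab)))).symm
  · exact (hq' _ _ (hle.2 (Or.inr (subgraphOfAdj_adj_self hcd)))).symm

theorem IsExtendable.exists_matching_of_adj [Fintype V] (hV : 4 < Fintype.card V)
    (h : IsExtendable G 2) {a b : V} (hab : G.Adj a b) :
    ∃ q : V → V, (∀ v, G.Adj v (q v)) ∧ (∀ v, q (q v) = v) ∧ q a = b := by
  classical
  obtain ⟨q, hq, hqq⟩ := h.exists_matching
  obtain ⟨c, hc⟩ : ∃ c, c ∉ ({a, b, q a, q b} : Finset V) := by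
    by_contra! hall
    have := Finset.card_le_card (Finset.subset_univ ({a, b, q a, q b} : Finset V) |>.antisymm
      fun x _ => hall x).ge
    have := Finset.card_le_four (a := a) (b := b) (c := q a) (d := q b)
    simp only [Finset.card_univ] at *
    omega
  simp only [Finset.mem_insert, Finset.mem_singleton, not_or] at hc
  obtain ⟨q', h1, h2, h3, _⟩ := h.exists_matching_of_adj_adj hab (hq c) (Ne.symm hc.1)
    (fun h' => hc.2.2.1 (by rw [h', hqq])) (Ne.symm hc.2.1)
    (fun h' => hc.2.2.2 (by rw [h', hqq]))
  exact ⟨q', h1, h2, h3⟩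

theorem SimpleGraph.Connected.mem_of_closed (h : G.Connected) {S : Set V} {u : V} (hu : u ∈ S)
    (hS : ∀ v w, v ∈ S → G.Adj v w → w ∈ S) (v : V) : v ∈ S := by
  obtain ⟨p⟩ := h.preconnected u v
  induction p with
  | nil => exact hu
  | cons hadj _ ih => exact ih (hS _ _ hu hadj)

theorem SimpleGraph.Connected.exists_adj_notMem [Fintype V] (h : G.Connected) (S : Finset V)
    (hS : S.Nonempty) (hcard : S.card < Fintype.card V) : ∃ x ∈ S, ∃ y, G.Adj x y ∧ y ∉ S := by
  by_contra! hall
  obtain ⟨u, hu⟩ := hS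
  have := h.mem_of_closed (S := (S : Set V)) hu fun v w hv hvw => hall v hv w hvw
  have : S = Finset.univ := Finset.eq_univ_of_forall this
  rw [this, Finset.card_univ] at hcard
  exact lt_irrefl _ hcard

theorem IsExtendable.three_le_degree [Fintype V] [DecidableRel G.Adj] (hV : 4 < Fintype.card V)
    (h : IsExtendable G 2) (v : V) : 3 ≤ G.degree v := by
  classical
  by_contra! hlt
  obtain ⟨q₀, hq₀, -⟩ := h.exists_matching
  have hmem (x : V) : G.Adj v x ↔ x ∈ G.neighborFinset v := by simp
  rw [← G.card_neighborFinset_eq_degree] at hlt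
  obtain h0 | h1 | h2 : (G.neighborFinset v).card = 0 ∨ (G.neighborFinset v).card = 1 ∨
      (G.neighborFinset v).card = 2 := by omega
  · rw [Finset.card_eq_zero] at h0
    have := (hmem _).1 (hq₀ v)
    simp [h0] at this
  · obtain ⟨a, ha⟩ := Finset.card_eq_one.1 h1
    rw [ha] at hmem
    simp only [Finset.mem_singleton] at hmem
    obtain ⟨x, hx, y, hxy, hy⟩ := h.1.exists_adj_notMem {v, a} (by simp)
      (Finset.card_le_two.trans_lt (by omega))
    simp only [Finset.mem_insert, Finset.mem_singleton, not_or] at hx hy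
    rcases hx with rfl | rfl
    · exact hy.2 ((hmem y).1 hxy)
    · obtain ⟨q, hq, hqq, hqx⟩ := h.exists_matching_of_adj hV hxy
      have := (hmem _).1 (hq v)
      rw [← this, hqq] at hqx
      exact hy.1 hqx.symm
  · obtain ⟨a, b, hab, hN⟩ := Finset.card_eq_two.1 h2
    rw [hN] at hmem
    simp only [Finset.mem_insert, Finset.mem_singleton] at hmem
    have hva : G.Adj v a := (hmem a).2 (Or.inl rfl)
    have hvb : G.Adj v b := (hmem b).2 (Or.inr rfl)
    have hnab : ¬ G.Adj a b := fun hadj => by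
      obtain ⟨q, hq, hqq, hqa⟩ := h.exists_matching_of_adj hV hadj
      have h3 := hqq v
      rcases (hmem _).1 (hq v) with h4 | h4 <;> rw [h4] at h3
      · exact hvb.ne (h3.symm.trans hqa)
      · rw [← hqa, hqq] at h3
        exact hva.ne h3.symm
    have heq {a' b' : V} (ha' : G.Adj a a') (hb' : G.Adj b b') (ha'v : a' ≠ v) (hb'v : b' ≠ v) :
        a' = b' := by
      by_contra hne
      obtain ⟨q, hq, hqq, hqa, hqb⟩ := h.exists_matching_of_adj_adj ha' hb' hab
        (by rintro rfl; exact hnab hb'.symm) (by rintro rfl; exact hnab ha') hne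
      have h3 := hqq v
      rcases (hmem _).1 (hq v) with h4 | h4 <;> rw [h4] at h3
      · exact ha'v (hqa.symm.trans h3)
      · exact hb'v (hqb.symm.trans h3)
    obtain ⟨q₁, hq₁, hqq₁, hqv₁⟩ := h.exists_matching_of_adj hV hvb
    obtain ⟨q₂, hq₂, hqq₂, hqv₂⟩ := h.exists_matching_of_adj hV hva
    have hxv : q₁ a ≠ v := fun h' => hab (by rw [← hqv₁, ← h', hqq₁])
    have hyv : q₂ b ≠ v := fun h' => hab (by rw [← hqv₂, ← h', hqq₂])
    have hxy := heq (hq₁ a) (hq₂ b) hxv hyv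
    have hax := hq₁ a
    have hbx := hq₂ b
    rw [← hxy] at hbx
    generalize q₁ a = x at hax hbx hxv
    have hNa {y : V} (hy : G.Adj a y) : y = v ∨ y = x :=
      or_iff_not_imp_left.2 fun hne => heq hy hbx hne hxv
    have hNb {y : V} (hy : G.Adj b y) : y = v ∨ y = x :=
      or_iff_not_imp_left.2 fun hne => (heq hax hy hxv hne).symm
    obtain ⟨z, hz, y, hzy, hy⟩ := h.1.exists_adj_notMem {v, a, b, x} (by simp)
      (Finset.card_le_four.trans_lt hV)
    simp only [Finset.mem_insert, Finset.mem_singleton, not_or] at hz hy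
    rcases hz with rfl | rfl | rfl | rfl
    · rcases (hmem y).1 hzy with h' | h'
      · exact hy.2.1 h'
      · exact hy.2.2.1 h'
    · rcases hNa hzy with h' | h'
      · exact hy.1 h'
      · exact hy.2.2.2 h'
    · rcases hNb hzy with h' | h'
      · exact hy.1 h'
      · exact hy.2.2.2 h'
    · obtain ⟨q, hq, hqq, hqz⟩ := h.exists_matching_of_adj hV hzy
      rcases (hmem _).1 (hq v) with h4 | h4
      · rcases hNb (hq b) with h5 | h5
        · rw [← h5, hqq] at h4
          exact hab h4.symm
        · rw [← h5, hqq] at hqz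
          exact hy.2.2.1 hqz.symm
      · rcases hNa (hq a) with h5 | h5
        · rw [← h5, hqq] at h4
          exact hab h4
        · rw [← h5, hqq] at hqz
          exact hy.2.1 hqz.symm

/-- `w` runs periodically around a closed walk of length `n`. -/
def IsClosedWalk (G : SimpleGraph V) (n : ℕ) (w : ℕ → V) : Prop :=
  (∀ i, w (i + n) = w i) ∧ ∀ i, G.Adj (w i) (w (i + 1))

theorem IsClosedWalk.of_eq {n : ℕ} {w : ℕ → V} (hn : 0 < n) (h0 : w n = w 0)
    (h : ∀ i < n, G.Adj (w i) (w (i + 1))) : IsClosedWalk G n fun i => w (i % n) := by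
  refine ⟨fun i => by simp, fun i => ?_⟩
  have hi := Nat.mod_lt i hn
  have h1 := h (i % n) hi
  change G.Adj (w (i % n)) (w ((i + 1) % n))
  rcases (Nat.succ_le_of_lt hi).lt_or_eq with h2 | h2
  · rwa [Nat.add_mod_eq_ite, Nat.mod_eq_of_lt (a := 1) (by omega), if_neg (by omega)]
  · rw [show (i + 1) % n = 0 by
      rw [← Nat.mod_add_mod, show i % n + 1 = n from h2, Nat.mod_self], ← h0]
    rwa [show i % n + 1 = n from h2] at h1

theorem exists_odd_isClosedWalk (h : ¬ G.Colorable 2) : ∃ n, Odd n ∧ ∃ w, IsClosedWalk G n w := by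
  rw [two_colorable_iff_forall_loop_even] at h
  push Not at h
  obtain ⟨u, p, hp⟩ := h
  rw [Nat.not_even_iff_odd] at hp
  exact ⟨p.length, hp, _, .of_eq (w := p.getVert) hp.pos (by simp) fun i hi => p.adj_getVert_succ hi⟩

/-- The vertices of a shortest odd closed walk are distinct. -/
theorem IsClosedWalk.injOn {n : ℕ} {w : ℕ → V} (hw : IsClosedWalk G n w) (hn : Odd n)
    (hmin : ∀ m < n, Odd m → ∀ w, ¬ IsClosedWalk G m w) {i j : ℕ} (hij : i < j) (hj : j < n) :
    w i ≠ w j := by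
  intro heq
  have h1 := IsClosedWalk.of_eq (G := G) (w := fun k => w (i + k)) (n := j - i) (by omega)
    (by simp only [add_zero]; rw [show i + (j - i) = j by omega, heq]) fun k _ => hw.2 (i + k)
  have h2 := IsClosedWalk.of_eq (G := G) (w := fun k => w (j + k)) (n := n - (j - i)) (by omega)
    (by
      simp only [add_zero]
      rw [show j + (n - (j - i)) = i + n by omega, hw.1, heq]) fun k _ => hw.2 (j + k)
  rcases Nat.even_or_odd (j - i) with h | h
  · exact hmin _ (by omega) (Nat.Odd.sub_even (by omega) hn h) _ h2
  · exact hmin _ (by omega) h _ h1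

theorem IsClosedWalk.rotate {n : ℕ} {w : ℕ → V} (hw : IsClosedWalk G n w) (k : ℕ) :
    IsClosedWalk G n fun i => w (k + i) :=
  ⟨fun i => by simp only [← add_assoc, hw.1], fun i => hw.2 (k + i)⟩

theorem IsClosedWalk.add_mul {n : ℕ} {w : ℕ → V} (hw : IsClosedWalk G n w) (i k : ℕ) :
    w (i + n * k) = w i := by
  induction k with
  | zero => simp
  | succ k ih => rw [Nat.mul_succ, ← add_assoc, hw.1, ih]

theorem IsClosedWalk.mod {n : ℕ} {w : ℕ → V} (hw : IsClosedWalk G n w) (i : ℕ) :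
    w (i % n) = w i := by
  conv_rhs => rw [← Nat.mod_add_div i n, hw.add_mul]

theorem IsClosedWalk.reverse {n : ℕ} {w : ℕ → V} (hw : IsClosedWalk G (n + 1) w) :
    IsClosedWalk G (n + 1) fun i => w (n * i) := by
  refine ⟨fun i => ?_, fun i => ?_⟩
  · change w (n * (i + (n + 1))) = _
    rw [mul_add, mul_comm n (n + 1), hw.add_mul]
  · have := hw.2 (n * i + n)
    rw [add_assoc, hw.1] at this
    exact this.symm

end

section

variable {V : Type} [Fintype V] {G : SimpleGraph V} {g : ℕ → V} {l : V → ℕ}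

/-- The adjacency of `G` read through a labelling of its vertices by `0, …, 11`. -/
def labelled (G : SimpleGraph V) (g : ℕ → V) (x y : ℕ) : Prop :=
  x < 12 ∧ y < 12 ∧ G.Adj (g x) (g y)

theorem deg_labelled [DecidableRel G.Adj] (hl : ∀ v, l v < 12) (hgl : ∀ v, g (l v) = v)
    (hlg : ∀ i < 12, l (g i) = i) {i : ℕ} (hi : i < 12) :
    deg (labelled G g) i = G.degree (g i) := by
  classical
  rw [← G.card_neighborFinset_eq_degree]
  refine Finset.card_bij' (fun x _ => g x) (fun v _ => l v) ?_ ?_ ?_ ?_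
  · intro x hx
    simp only [Finset.mem_filter] at hx
    simpa using hx.2.2.2
  · intro v hv
    simp only [mem_neighborFinset] at hv
    simp only [Finset.mem_filter, Finset.mem_range]
    exact ⟨hl v, hi, hl v, by rwa [hgl]⟩
  · intro x hx
    simp only [Finset.mem_filter, Finset.mem_range] at hx
    exact hlg x hx.1
  · intro v _
    exact hgl v

theorem target_labelled [DecidableRel G.Adj] (hcard : Fintype.card V = 12)
    (hext : IsExtendable G 2) (hsize : G.edgeSet.ncard ≤ 20) (hl : ∀ v, l v < 12)
    (hgl : ∀ v, g (l v) = v) (hlg : ∀ i < 12, l (g i) = i) {R : ℕ} (hR : 2 ≤ R) (hR' : R ≤ 12)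
    (hdeg : ∀ i < R, G.degree (g i) ≤ G.degree (g 0))
    (hdeg' : G.degree (g (R - 1)) ≤ G.degree (g 1))
    (h3 : 5 ≤ R → ∀ {a b c}, G.Adj a b → G.Adj b c → ¬ G.Adj c a)
    (h5 : 7 ≤ R → ∀ {a b c d e}, G.Adj a b → G.Adj b c → G.Adj c d → G.Adj d e → ¬ G.Adj e a) :
    Target R (labelled G g) where
  symm h := ⟨h.2.1, h.1, h.2.2.symm⟩
  irrefl a h := G.irrefl h.2.2
  lt h := h.1
  three_le v hv := by
    rw [deg_labelled hl hgl hlg hv]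
    exact hext.three_le_degree (by omega) _
  sum_le := by
    rw [Finset.sum_congr rfl fun v hv => deg_labelled hl hgl hlg (Finset.mem_range.1 hv)]
    have hsum : ∑ i ∈ Finset.range 12, G.degree (g i) = ∑ v, G.degree v := by
      refine Finset.sum_bij' (fun i _ => g i) (fun v _ => l v) ?_ ?_ ?_ ?_ ?_
      · intro i _; exact Finset.mem_univ _
      · intro v _; exact Finset.mem_range.2 (hl v)
      · intro i hi; exact hlg i (Finset.mem_range.1 hi)
      · intro v _; exact hgl v
      · intro i _; rfl
    classical
    rw [hsum, G.sum_degrees_eq_twice_card_edges, ← G.coe_edgeFinset, Set.ncard_coe_finset] at *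
    omega
  matching := by
    rintro a b c d ⟨ha, hb, hab⟩ ⟨hc, hd, hcd⟩ hac had hbc hbd
    have hne {x y : ℕ} (hx : x < 12) (hy : y < 12) (hxy : x ≠ y) : g x ≠ g y :=
      fun h => hxy (by rw [← hlg x hx, ← hlg y hy, h])
    obtain ⟨q, hq, hqq, hqa, hqc⟩ := hext.exists_matching_of_adj_adj hab hcd (hne ha hc hac)
      (hne ha hd had) (hne hb hc hbc) (hne hb hd hbd)
    refine ⟨fun x => l (q (g x)), fun v hv => ⟨hv, hl _, ?_⟩, fun v hv => ?_, ?_, ?_⟩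
    · rw [hgl]; exact hq _
    · simp only [hgl, hqq, hlg v hv]
    · simp only [hqa, hlg b hb]
    · simp only [hqc, hlg d hd]
  connected := by
    rintro S ⟨u, hu, huS⟩ hS v hv
    have := hext.1.mem_of_closed (S := {x | l x ∈ S}) (u := g u) (by simpa [hlg u hu] using huS)
      (fun x y hx hxy => hS _ _ hx ⟨hl x, hl y, by rwa [hgl, hgl]⟩) (g v)
    simpa [hlg v hv] using this
  deg_le i hi := by
    rw [deg_labelled hl hgl hlg (hi.trans_le hR'), deg_labelled hl hgl hlg (by norm_num)]
    exact hdeg i hi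
  deg_pred_le := by
    rw [deg_labelled hl hgl hlg (by omega), deg_labelled hl hgl hlg (by norm_num)]
    exact hdeg'
  triangle_free hR _ _ _ hab hbc hca := h3 hR hab.2.2 hbc.2.2 hca.2.2
  pentagon_free hR _ _ _ _ _ h1 h2 h3 h4 h := h5 hR h1.2.2 h2.2.2 h3.2.2 h4.2.2 h.2.2

theorem gTwo_adj (i j : Fin 12) : GTwo.Adj i j ↔ Edge twoRows i j := by
  rw [GTwo, SimpleGraph.fromRel_adj, Edge]
  revert i j
  decide +kernel

theorem IsTwo.nonempty_iso (hcard : Fintype.card V = 12) (hl : ∀ v, l v < 12)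
    (hgl : ∀ v, g (l v) = v) (h : IsTwo (labelled G g)) : Nonempty (G ≃g GTwo) := by
  obtain ⟨e, he, hinj, hadj⟩ := h
  have hbij : Function.Bijective fun v => (⟨e (l v), he _ (hl v)⟩ : Fin 12) := by
    rw [Fintype.bijective_iff_injective_and_card]
    refine ⟨fun v w hvw => ?_, by simpa using hcard⟩
    rw [← hgl v, ← hgl w, hinj _ (hl v) _ (hl w) (Fin.mk.inj hvw)]
  refine ⟨⟨Equiv.ofBijective _ hbij, fun {v w} => ?_⟩⟩
  rw [Equiv.ofBijective_apply, Equiv.ofBijective_apply, gTwo_adj]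
  change Edge twoRows (e (l v)) (e (l w)) ↔ _
  rw [← hadj _ (hl v) _ (hl w), labelled, hgl, hgl]
  exact ⟨fun h => h.2.2, fun h => ⟨hl v, hl w, h⟩⟩

/-- `M` is the matrix of the cycle on the labels below `R`. -/
def IsCycleMatrix (R M : ℕ) : Prop :=
  M < 2 ^ 208 ∧ ∀ x < 12, ∀ y < 12, (row M x).testBit y = true →
    x < R ∧ (row M y).testBit x = true ∧ (y = (x + 1) % R ∨ x = (y + 1) % R)

instance (R M : ℕ) : Decidable (IsCycleMatrix R M) := inferInstanceAs (Decidable (_ ∧ _))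

theorem IsCycleMatrix.of_edge {R M x y : ℕ} (h : IsCycleMatrix R M) (hxy : Edge M x y) :
    x < 12 ∧ x < R ∧ Edge M y x ∧ (y = (x + 1) % R ∨ x = (y + 1) % R) := by
  obtain ⟨hy, hbit⟩ := (edge_iff M x y).1 hxy
  have hx : x < 12 := by
    by_contra hx
    have := Nat.testBit_lt_two_pow (h.1.trans_le (Nat.pow_le_pow_right (n := 2) (by norm_num)
      (show 208 ≤ 12 * x + 64 + y by omega)))
    rw [this] at hbit
    exact absurd hbit (by simp)
  exact ⟨hx, h.2 x hx y hy hxy⟩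

theorem exists_isClosedWalk_degree_le [DecidableRel G.Adj] {n : ℕ} {w : ℕ → V} (hn : 0 < n)
    (hw : IsClosedWalk G n w) : ∃ w, IsClosedWalk G n w ∧
      (∀ i, G.degree (w i) ≤ G.degree (w 0)) ∧ G.degree (w (n - 1)) ≤ G.degree (w 1) := by
  have hV (v : V) := G.degree_lt_card_verts v
  generalize Fintype.card V = N at hV
  let s : Set ℕ := {k | ∃ w, IsClosedWalk G n w ∧ N * G.degree (w 0) + G.degree (w 1) = k}
  have hs : BddAbove s := by
    refine ⟨N * N + N, ?_⟩
    rintro k ⟨w, -, rfl⟩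
    exact add_le_add (Nat.mul_le_mul_left N (hV _).le) (hV _).le
  obtain ⟨w, hw, hmax⟩ := Nat.sSup_mem (s := s) ⟨_, w, hw, rfl⟩ hs
  have hle {w' : ℕ → V} (hw' : IsClosedWalk G n w') :
      N * G.degree (w' 0) + G.degree (w' 1) ≤ N * G.degree (w 0) + G.degree (w 1) := by
    rw [hmax]
    exact le_csSup hs ⟨w', hw', rfl⟩
  refine ⟨w, hw, fun i => ?_, ?_⟩
  · have h1 := hle (hw.rotate i)
    have h2 := hV (w 1)
    rw [add_zero] at h1
    by_contra! h3
    have h4 : N * (G.degree (w 0) + 1) ≤ N * G.degree (w i) := Nat.mul_le_mul_left N h3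
    rw [mul_add, mul_one] at h4
    omega
  · obtain ⟨m, rfl⟩ : ∃ m, n = m + 1 := ⟨n - 1, by omega⟩
    have h1 := hle hw.reverse
    rw [mul_zero, mul_one] at h1
    simpa using h1

theorem nonempty_iso_of_isClosedWalk (hcard : Fintype.card V = 12) (hext : IsExtendable G 2)
    (hsize : G.edgeSet.ncard ≤ 20) {R M : ℕ} {s : List ℕ} (hM : IsCycleMatrix R M)
    (hverifies : verifies R M s = true) (hR : 2 ≤ R) (hR' : R ≤ 12) (hodd : Odd R)
    (hmin : ∀ m < R, Odd m → ∀ w, ¬ IsClosedWalk G m w) {w : ℕ → V} (hw : IsClosedWalk G R w) :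
    Nonempty (G ≃g GTwo) := by
  classical
  obtain ⟨w, hw, hdeg, hdeg'⟩ := exists_isClosedWalk_degree_le (by omega) hw
  have hinj : Set.InjOn (fun i : Fin 12 => w i) {i | (i : ℕ) < R} := by
    intro i hi j hj hij
    rcases lt_trichotomy (i : ℕ) j with h | h | h
    · exact absurd hij (hw.injOn hodd hmin h hj)
    · exact Fin.ext h
    · exact absurd hij.symm (hw.injOn hodd hmin h hi)
  obtain ⟨f, hf⟩ := Set.MapsTo.exists_equiv_extend_of_card_eq (t := (Finset.univ : Finset V))
    (by simpa using hcard.symm) (fun _ _ => by simp) hinj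
  let g : ℕ → V := fun i => f (Fin.ofNat 12 i)
  let l : V → ℕ := fun v => f.symm ⟨v, Finset.mem_univ v⟩
  have hl (v : V) : l v < 12 := Fin.is_lt _
  have hgl (v : V) : g (l v) = v := by simp [g, l]
  have hlg (i : ℕ) (hi : i < 12) : l (g i) = i := by simp [g, l, Nat.mod_eq_of_lt hi]
  have hgw (i : ℕ) (hi : i < R) : g i = w i := by
    have hi' : (Fin.ofNat 12 i : ℕ) = i := Nat.mod_eq_of_lt (hi.trans_le hR')
    exact (hf (Fin.ofNat 12 i) (hi'.trans_lt hi)).trans (congrArg w hi')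
  have hP : Target R (labelled G g) := by
    refine target_labelled hcard hext hsize hl hgl hlg hR hR' (fun i hi => ?_) ?_
      (fun h5 a b c hab hbc hca => ?_) fun h7 a b c d e hab hbc hcd hde hea => ?_
    · rw [hgw i hi, hgw 0 (by omega)]; exact hdeg i
    · rw [hgw _ (by omega), hgw 1 (by omega)]; exact hdeg'
    · refine hmin 3 (by omega) (by decide) _ (.of_eq (w := fun i => [a, b, c].getD i a) (by omega)
        rfl fun i hi => ?_)
      interval_cases i <;> assumption
    · refine hmin 5 (by omega) (by decide) _ (.of_eq (w := fun i => [a, b, c, d, e].getD i a)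
        (by omega) rfl fun i hi => ?_)
      interval_cases i <;> assumption
  refine IsTwo.nonempty_iso hcard hl hgl (verifies_sound hR hR' hverifies hP
    (fun h => (hM.of_edge h).2.1) (fun h => (hM.of_edge h).2.2.1) fun {x y} h => ?_)
  obtain ⟨hx, hxR, hyx, hxy⟩ := hM.of_edge h
  obtain ⟨hy, hyR, -, -⟩ := hM.of_edge hyx
  refine ⟨hx, hy, ?_⟩
  rw [hgw x hxR, hgw y hyR]
  rcases hxy with rfl | rfl
  · rw [hw.mod]; exact hw.2 x
  · rw [hw.mod]; exact (hw.2 y).symm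

end

/-- The certificate for the graphs whose shortest odd cycle is a triangle. -/
def triangleCertificate : List ℕ := [
  1, 2372099, 8524800, 2, 2, 1197574325547267, 2288427303588373, 1238183513232037961208836, 0, 0,
  0, 1243496175470630046036503, 0, 0, 1197574325540096, 1233146395220164491952388,
  1218776382147701837669120, 926008112548310168183043, 9988174086737184107802887,
  4241109426324246299685381, 147564837122773513, 237515270, 8, 269198106,
  44447337675640314371216422, 109266441945645576, 110719510, 9, 537634570,
  34166690502200875612341286, 5761711439437908897587718, 127280840874070536, 269198106, 805984057,
  34316810, 436900360, 27206599387395078, 101356582, 112644004294394920, 101352486, 469963784,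
  101422121, 5006427914055147971961094, 7424279549889320606851605, 150960816224113161, 237515271,
  8, 269198106, 13946937745078825519911431, 91252043436163592, 193552647, 9, 1074500906,
  34166690490399748659053063, 14823877367483715784691975, 99715191033500680, 269198106, 805983801,
  34316810, 369792040, 45220851809345799, 168464903, 90707991473127944, 168460807, 469963784,
  168530441, 2588576269196252649378053, 7424279555554004546704406, 150960816257668105, 237515271,
  8, 269198106, 15457799871691932669023239, 85622406496551944, 214520071, 9, 537634090,
  32655496328021714827707399, 13312683199477281897210119, 99715191012528648, 269198106, 805987641,
  67871754, 369792040, 54228188503036167, 202019847, 81700792251941896, 202015751, 436408840,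
  202085385, 9011464, 76051478, 11406475410937605, 214585607, 143364361, 54187506572747015,
  54224889968152837, 76190745, 7973458768587387008737541, 42496533, 11424067618084614, 193618183,
  143364361, 45180169879048455, 45218652786090246, 42635801, 7973458768587387029704966, 143294727,
  24349241027907013246017798, 26767092699915599336866325, 21931389383013070990299397,
  26767092705543999393006614, 143364361, 67802118, 1216962826, 168460805, 57619976160481797,
  34247173, 1216958730, 202015750, 57584791809364998, 11443858949366021, 42492437,
  20412712643471110, 54189705595998471, 76190745, 27165917331346454, 45183468413935879, 42635801,
  17114778523062078938829063, 76186646, 30237644669635665336803591, 32655496322375722459628053,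
  22984089724926365437925125, 32655496328056899141009671, 76256281, 134910215, 1216897290,
  168464901, 57619976145872645, 34247173, 1116234266, 168464903, 57584791876473863,
  11443858866532885, 42631701, 29330987198411741363249415, 34166690496010556403254294,
  24495283892950391532558086, 34166690496010556470362375, 42701337, 134910215, 1216893194,
  202019846, 51991576156841734, 67802118, 1116299802, 168460807, 51956391866470919,
  20451195560227350, 3076659821443084688955141, 99715190929044518, 36193792935793159,
  5489826005991086805493510, 10325472883189756610707719, 5494548372456364264662790,
  10330195249672626255855879, 304029740036760346, 304029740036760346, 0, 1238183513177332975624726,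
  1197711762400000, 1324071567749258125197574, 9852074005639661688866823, 36753512759644425,
  40019142564451510578151686, 29194887191531322790811208, 10906242162696895127999263569293827,
  14708142507645818611865606, 10906083706371866599286074409431555,
  1686952543661377465858507702836036514071705669052170, 343602949975990806,
  5021093075667208244774918, 18739114183053577, 40019437712356689930977543,
  24363906261558869346654024, 10906242157861191849558338989404675, 14708142507645818611865607,
  10906162929698677585165151254557187, 1593416438523750534069624318091239195100014581622282,
  343602949975994903, 360753808668420207281567545246124364751382, 19523480598585492239900936,
  36664864701421831, 38866293855482514755698953, 10597433328025522527420675,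
  38866293855408847476637961, 9842168104034147179852039, 10597451774787188154581251,
  3497509904098070207394258952968029086653063, 325439499709161738, 38866293784477153341630473,
  9842168120922645115181319, 19528203108130217825616136, 5761748496309979758149891,
  2102999532455436432033439577957943021894248, 361523890180827402,
  2694566771485643689090722291019434915423217645483286654336643842307, 24500098700336731966095624,
  48688797533249517587273735, 19523480598585492239968520, 9842149674178502686152711,
  38871016221964284889350409, 5761730049565906317033731,
  3496794783327896519581014292348320472595049, 433581484218755082,
  2687984753256262709806379139503143408638213978380236905284568039683, 43842893367426725320278281,
  29345984419414351280347399, 25580051, 11650567000692997, 1928829620451281826574871,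
  11650567000692741, 1933551986934151471723031, 11369092015862293, 3742218343117826172744215,
  3746940709600695817892375, 13712151269765655, 324895240690049562, 9680237860905493,
  144205898393796873, 15799501098476051, 15963951109534231, 4355830996625845964456195,
  72148372806910216, 15799432378999315, 15963951109599767, 4355830924568320377569539,
  1068519866812183134974398683190524837065239, 127425769798992408, 3071347195385361706784771,
  3487719628628499, 144169614507983369, 15799501098476053, 15963951084368407,
  4355831002819394986787333, 72112088921096712, 15799432378999317, 15963951084433943,
  4355830930761869399900677, 1057652098678160071903568660263871491830295, 127423570775736856,
  3071347195385361729857541, 134541882854047270777196676811938375090435,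
  395604920655920343431359029214441584173322, 197129901020114020988364202973448, 37226715147830295,
  197209148525441471217550129109001, 37226783867311127, 694875553680107226458620869424165,
  195862250419885791586867499768072, 37226715147895831, 195941497925213241816053425903625,
  37226783867376663, 694875553680107226458620869358629, 52916649784809468917441726556170258821384,
  16244326583132693, 36664864731116583, 16244326583132693, 36664933450527783, 0, 1197574325474560,
  628683485412849904595203, 614313472322795064206336, 1525748655872755110322436,
  9992878004241772415828231, 4241109424090038672048645, 149799044750414345, 237519366, 8,
  269198362, 45047078218965858824983334, 109283965412213256, 119108118, 9, 537634570,
  34171394421940771059630886, 6361451982779877306294790, 127298364332315144, 269198362, 805984073,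
  34316810, 436900360, 27206530667922182, 101356326, 110409796666753832, 101352230, 470029064,
  101421865, 5001705547589801801703686, 7419557183406450970026517, 150960816224113161, 237519367,
  8, 269198362, 13946937745078825519911431, 91269566902731272, 193552647, 9, 1074500906,
  34171394410138544594715143, 14828581287222511720354055, 99697598847521544, 269198362, 805983817,
  34316810, 369791784, 45220851817734407, 168464903, 90690399287083528, 168460807, 470029064,
  168530441, 2583853900479175384912133, 7419557191305342537519894, 150960816257667849, 237519367,
  8, 269198362, 16062262781499247256376071, 83388198868910856, 222908679, 9, 537634090,
  32055755786949069699252999, 12712942656152836955070727, 99697598818161160, 269198362, 805987657,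
  67871498, 369791784, 54228119791948039, 202019591, 81683200065897224, 202015495, 436474376,
  202085129, 17400072, 84439830, 13658275216234245, 222974215, 151752969, 54188537373286663,
  54224821257064709, 84579097, 8577921678395801107718405, 50885141, 13675867431704326, 193618183,
  151752969, 45181269399064839, 45218652794478854, 51024409, 8577921678395801137074438, 151683335,
  24344518661406551423148294, 26762370333432729700041237, 21926667014278401539789061,
  26762370341312929569866518, 151752969, 67801862, 1225351434, 168460805, 59871775965843973,
  34247173, 1225347338, 202015494, 59836591623115526, 13695658763051269, 50881045,
  22664443737614086, 54189636884910343, 84579097, 27166948131885846, 45183468422324487, 51024409,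
  17115073670967258300043527, 84574998, 29637904128563020199960839, 32055755779051277525877269,
  22384349183853720301082373, 32055755786984254020944135, 84644633, 134910215, 1225285898,
  168464901, 59871775959492357, 34247173, 1124622874, 168464903, 59836591690224391,
  13695658688606741, 51020309, 29335691120402337104208135, 34171394418001152160989974,
  24499987814940987281839878, 34171394418001152228098311, 51089945, 134910215, 1225281802,
  202019590, 51991576156776198, 67801862, 1124688410, 168460807, 51956391858147847,
  22702926662824470, 3681122733502199081604869, 99697598743003942, 36193792927470087,
  6094270471306127496914694, 10929935790762863570419975, 6098992837771404956083974,
  10934658157245733215568135, 304029740036760602, 304029740036760602, 0, 634015749023397919023638,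
  1180119576290304, 719608657940844026212614, 9851778857733382824409095, 36754612271272201,
  39414679654644195990798598, 29194592043625043926357560, 10906242163301358040057278458708484,
  14708142507645818611865606, 10906083706976329511327596624429572,
  1686861199808704002059119805907718959531672996652810, 343602949967602198,
  5020797927760929380317190, 18740213694681353, 39414974802549375343624455,
  24363611113652590482200376, 10906242158465654761616353878819332, 14708142507645818611865607,
  10906162930303140497206673469555204, 1593325094671077070270236421162921640559981909222922,
  343602949967606295, 360413526300231618213153574736734053687830, 19523185450679213375447304,
  36647272515311879, 38865998707577335402869001, 11197173873601767291629828,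
  38865998707502568612180233, 9837445737533685348593927, 11197192320363432918790404,
  3497488636450058420577483079811192192735879, 325439499709161738, 38865998636570874477176841,
  9837445754422183283857671, 19527907960225038472786184, 6361489041886224522359044,
  2102659250087247842965025607448552719219304, 361522790669199626,
  2694566774599674639816512602636138546578015347501526054826748096772, 24495376336105662142951688,
  48688502387596069336979463, 19523185450679213375514888, 9837427307678040854829063,
  38870721074059105536520457, 6361470595142151081242884,
  3496454500959707930512600321838930169920105, 433580384707127306,
  2687984756370293660532169451119847039793011680398476305774672294148, 43838171003195655497134345,
  29345689273760903030053127, 25580052, 13901267302750469, 1928829618199482012889623,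
  13901267302750213, 1933551984682351658037783, 11369092015862293, 3137755433310511577002519,
  3142477799793381222150679, 11460351456080407, 324877648512393754, 9679138340889109,
  144205898393792777, 15799501106864660, 15963951101145623, 4355830998860053600481540,
  72148372806906120, 15799432387387924, 15963951101211159, 4355830926802528013594884,
  1068179584443994545905984712681134526001687, 127425769798992408, 3675810107443376604518404,
  5738419930685972, 144187206694023689, 15799501106864661, 15963951084368407,
  4355831002801802800738821, 72129681107137032, 15799432387387925, 15963951084433943,
  4355830930744277213852165, 1057311816309971482835154689754481189155351, 113824810963403288,
  3675810107443376619202565, 134541882854047271376937222370590953255172,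
  439159734556059007512298762344098029084938, 359389177849032236473663357131016, 37209122970174231,
  359468425354359686702849283266569, 37209191689655063, 693607903075156630573155009381157,
  358121527248804007072166653925640, 37209122970239767, 358200774754131457301352580061193,
  37209191689720599, 693607903075156630573155009315621, 96472792912948869674429949505229675905288,
  16244326583132693, 36647272545076007, 16244326583132693, 36647341264487207, 0,
  327042326900024736633093, 633405853600993362850307, 9679138311328005, 0, 9679138311328005,
  332059843577256975151621, 0, 0, 3507510915314182, 0, 0, 0, 1242886294194542118191620, 0,
  7363092859845025709109776, 14682759737431839583388167, 144223696696398089, 72148510204059912,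
  136655367, 0, 339259944905061302119054621438218, 0, 315941505163043082, 0, 0, 0,
  99816485512407539921424, 4593828325892356, 1248494090302639573664008, 4945241216393638429799718,
  18463141057348105, 39641038591116964063031813, 14632585796278527661348135,
  10967004897642274553291701899444740, 7363092864630096067729205,
  10966846441317246024652729875120644, 1592044518964604065155089289836189564114294891324970,
  316018470972510469, 0, 5020797910875729249587462, 0, 18722621466632452, 0, 0, 0,
  2457438357804834546471173, 0, 3741923199961437516096016, 20883208487200309289570568,
  144187412886008329, 273035528, 36083429240553991, 0, 663783451532589441285681486393866, 0,
  296259078811525642, 0, 0, 389506299093520, 9154671287939589, 2462455875569552494072329,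
  2699442793173255, 14706666767533950697496836, 20072161709560880851219480,
  4598412458995416605705287104155909, 1928534466880246041442404,
  4598095546345359548394357656342789, 1510292127633840943111016539085797388607772278104858,
  296312954916717060, 0, 8028702695244292, 0, 941245124406225274352133, 0, 0, 8047394560754183, 0,
  0, 0, 80140172836635144, 0, 0, 99834932292765133259280, 73292414609400072,
  2159615742306380432232709, 3506411504484871, 292860489422627082, 291807156226314501,
  92073197097931293512458506, 0, 2457438360056634360156421, 463036130808336, 293142036361150986,
  640102921, 237584903, 136720903, 156906843549705735860936971, 0, 4669694840226311, 281493768, 0,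
  63815792613544200, 0, 75636573404287240, 27429658330624528, 80140172767429128, 80137974008402184,
  0, 663783451532589441285681486393866, 296259078811525642, 296259078811525642,
  14706666767533950680649991, 0, 0, 0, 0, 0, 63793802320101893, 0, 0, 0, 87928013796901384, 0,
  709020208582949365694992, 74417215000424712, 2160206039244838067982599, 27711129029001749,
  296259078812574234, 0, 43706424144209646270894345, 467434194174480, 640102917, 45707936057868807,
  9451544326386181, 0, 3506411940557317, 289812744, 0, 171902183670436104, 0, 144300185500733704,
  144300185500733704, 80137974247490584, 80142372054929672, 0, 79526441049887319358341642,
  153327034572419589, 296310755926946309, 288430006871732741, 6144445583662519244460560,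
  77426009605535144641008154, 296259079314842650, 7453111822824577868189957, 0, 0, 0, 0, 0,
  38734163241970771020952073, 0, 0, 0, 0, 43706424140829747527192841,
  190326162984736258639516998910480, 73292414592622856, 20897965946333132640178437,
  20902688312798410099347717, 73382574281937157, 49593609687363847,
  537053306048374515064957703611965325660421, 171826317087117577, 155386536694557921348296971, 0,
  7453111822824577868189957, 0, 3676400367001737506672904, 0, 0, 67608008201040135, 0,
  18386243911504400, 54097209221911047, 85676213981118984, 155386536694557921348296971, 0,
  265274115181153955666810148042367379869961, 155688767555137063061525019, 0, 75634374381031688,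
  1074287642, 0, 4935519764043492023226896, 45779403777065479, 43706424149876602214977801, 0,
  75634374380966152, 0, 537416729, 4935519764043492023161360, 54786602998252039,
  82392050377545835317203210, 171826317087117577, 171826317087117577, 171826317087117577,
  2001947121383857388180445598273797, 0, 0, 0, 43706424149876602248532505, 0, 0,
  82392050377545835350757914, 0, 0, 159763302832882102532018715, 190326163609232334729694623900688,
  19523185451804013774856456, 10433012066903281038582071247118601,
  41687410319069191906061623549209010466197040668932, 2462160727648979980333573,
  662436572769551799640312374772234, 6920394926219524, 337913066142023660473685509820682,
  10433012066903280968776277014637065, 139305846370141350452281479960902247145732,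
  13995825256943877, 2164928477802893937168647, 2462160727648979980333573,
  662436572769551799640312374772234, 6920394926219524, 337913066142023660473685509820682,
  5240715189025640154354119583820296, 138965558810923553453695256877792945070340,
  13994725745316101, 2164928405745299899240711, 2462160727648979980333573,
  662436572769551799640312374772234, 9851778857733382824204807, 39405235014545339425776665,
  4598491687137602560364897783992581, 20067144195154140155438104,
  4598412458975088296044896157651205,
  7502281559527264743779548503702290597348162450376303419029689268433049971208, 77852089172836868,
  651701156743556319566874936816133, 663704223374502395542270909301259, 1218850174846679839695108,
  339180716746974256375644044349707, 20818873473878306281159031414039066,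
  682719291933772302372204588773893, 294007278993625348, 155084305499848336027890187,
  155089027866313613487059467, 19387288577533675959836936, 0, 5025520293680917728612614, 0, 0, 0,
  0, 0, 1324868503278973081742646778864656, 1247608646567310310072580,
  337913066142023660473685509820682, 38865998636570874476898825, 24288054402285299531461928,
  10967084125779129414673379265036804, 14621370175839930811954471,
  10967004897616615150353377772913156,
  5465099984305376153768104373330427028923222122676512068951851835887360424455, 45743120231125253,
  14521609013481103237329415, 5240715193544373063172181778116872, 19547092394478530758001156,
  27165771262538245, 662436572769551799640312374772234, 1247608646567310310072580,
  337913066142023660473685509820682, 5240715193544373028269284661869064,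
  530907044016503251870407704920379238068741, 13994725802066436, 33864422153809071236854279,
  27165771262538245, 662436572769551799640312374772234, 1247608646567310310072580,
  337913066142023660473685509820682, 2644566754605552621058205946493447,
  530566759053433884139235332131315119567365, 13993626290438660, 33864422189820276069773832,
  2427776014706685350720005, 663704223374502395542270909301259, 327182601870577511702049245978884,
  339180716746974256375644044349707, 20862206331087987025225466569794074,
  358121508903610358965448745771268, 2607668640450409690247685, 154927600424121004366323979,
  154932322790586281825493259, 9710274189607778201907719, 0, 0, 104538851995277185069584,
  4611420511871236, 1248494090302639573664008, 2527389568157180792092197, 9455941769052681,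
  39641333739023242927485446, 12214734148042070023640615, 10967004895224422914080035702522372,
  7363092864630096067729206, 10966925667061908649761065069658628,
  1545367810248123780693669153063588603767763998844202, 316018470972514566, 0,
  2602946271645371388547333, 0, 9715422211887364, 0, 0, 0, 4874994849130013054689542, 0,
  6159479700291616255791632, 20878486129724638899101960, 144187412886008329, 272969992,
  36083429240553991, 0, 1312820561267294543088451165254154, 0, 296257979333452298, 0, 0,
  371914113045008, 18160771064607238, 4880307523806010131780105, 2699442793177351,
  12288815119297493093339396, 20072161709560880851219480, 4598412461413268253924152522268934,
  1928239318973967176988756, 4598095548763211196629715748872454,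
  1510200783781486494030691298369333870578700835857178, 296312954883162628, 0, 8027603150062084, 0,
  941540272312504138805766, 0, 0, 8047394560754183, 0, 0, 0, 80140172836635144, 0, 0,
  104557298775634778472976, 73274822423290120, 2159910890212659296690438, 3507510982558215,
  292860489422622986, 291808255737946374, 89655345458702035163042058, 0, 4874994851381812868374790,
  464135642440208, 293142036394705418, 640102921, 237584903, 136655367,
  156907138697610915213758731, 0, 4669694840226311, 281493768, 0, 63815792613548296, 0,
  75636573404291336, 27429658330624528, 80140172800983560, 80139073520034056, 0,
  1312820561267294543088451165254154, 296257979333452298, 296257979333452298,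
  12288815119297493076500743, 0, 0, 0, 0, 0, 63793802320101894, 0, 0, 0, 96917620832043528, 0,
  704297842100079720546832, 74399622814314760, 2160206039244838067986695, 27711129062556182,
  296257979334500890, 0, 41288572504980387921486089, 467434194174480, 640102918, 54697543093076487,
  18458743581127174, 0, 3507511452185094, 289747208, 0, 171902183670440200, 0, 144300185500737800,
  144300185500737800, 80139073759118360, 80142372054929672, 0, 79526145901982139971961354,
  162334233827160582, 296311855438574086, 288431106383360518, 3731316310916130540261904,
  77426008452612540522533402, 296257979803214874, 7453111822824577868194054, 0, 0, 0, 0, 0,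
  38734163241970771020952073, 0, 0, 0, 0, 41288572501601588689408265,
  189058512389230395720889940918800, 73274822406512904, 20898261094239411504636166,
  20902983460704688963805446, 73383673793569030, 58600808942104839,
  537053306048374517482809351848422929817862, 171826317087117577, 155386241546652742028960011, 0,
  7453111822824577868194054, 0, 6094252015238195110830344, 0, 0, 67608008201040135, 0,
  9396636842811920, 45090010000724487, 94665821016261128, 155386241546652742028960011, 0,
  439498687693711558694763048850202349441289, 155688472416239082996994587, 0, 75635473892663560,
  1074291738, 0, 2522390491298202830660112, 54786602998252039, 41288572519654543120306441, 0,
  75635473892598024, 0, 537420825, 2522390491298202830594576, 14701944383054274869412359,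
  79974198747323776222531850, 171826317087117577, 171826317087117577, 171826317087117577,
  2001947121383857388180445598277894, 0, 0, 0, 41288572519654543187415577, 0, 0,
  79974198747323776289640986, 0, 0, 157345451202660043470901787, 189058513008708957421919056307216,
  19518463085303551943594248, 10431744416298330442680112712589577,
  41681701327958085698348801336917241976261206941956, 4879717227979158753587718,
  1311473682504256901443082053632522, 6919295414587652, 337913066142023660473685509824778,
  10431744416298330372874318480169481, 139284578720941141198086789645341546795268,
  23003024511688966, 2164928477802893937172743, 4879717227979158753587718,
  1311473682504256901443082053632522, 6919295414587652, 337913066142023660473685509824778,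
  5239447538420689558452161049352712, 138944291161723344199500566562232244719876,
  23001925000061190, 2164928405745299899244807, 4879717227979158753587718,
  1311473682504256901443082053632522, 9847056491232920992946695, 39404939866639060561318937,
  4598491689550731842117386231308550, 20066849047247861290980376,
  4598412461388217577797384604967174,
  7500514712462486359425445277547693456758319047123774904383770721571171817992, 77850989661209092,
  1300738266477966273463365751222790, 1312741333109207497345040588161547,
  1218850174845580328063236, 339180716746974256375644044353803,
  20818873473878011133252752549585434, 1331756401668477395168874490966534,
  1555152763837863241994500, 155084010351942057129882123, 155088732718407334589051403,
  19386993429628496607006984, 0, 2607668645444460124459269, 0, 0, 0, 0, 0,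
  677099044144496209341373836829712, 1247608646567310310068484, 337913066142023660473685509824778,
  38861276270070412645575177, 21870202754048841893754408, 10967084123366000132919791272542724,
  12203518527603473174246951, 10967004895203485868599789780419076,
  4562241130840210446161974224864488853448420607285365186185151881823532890631, 54750319485870342,
  12103757374234252701872647, 5239447540526293194523834539389192, 19547092394478530724446724,
  27165771296092678, 1311473682504256901443082053632522, 1247608646567310310068484,
  337913066142023660473685509824778, 5239447540526293159620937423206920,
  530907044016503254288259353156836842222086, 23001925023252996, 31446570514579812920930823,
  27165771296092678, 1311473682504256901443082053632522, 1247608646567310310068484,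
  337913066142023660473685509824778, 2643299101587472752409858707831303,
  530566759053433886557086980367772723720710, 23000825511625220, 31446570550591017753850376,
  4845627653935943733686790, 1312741333109207497345040588161547, 327182601870577511702049245974788,
  339180716746974256375644044353803, 20862127100507621112651415421690394,
  358121508903610349958249491026180, 5025520279680767551287814, 154927600415113873831055627,
  154932322781579151290224907, 9710274180618171099656711, 0, 0, 171613152405067360585500261380359,
  28061934395347306946481798722064, 334902395950838776594758837281028,
  336486959211454240083982158565641, 182457893824602969989894309069627935052037, 21582084,
  145333516241281289, 2150466229304514052645126, 145333516241281289, 2155188595787383697793286,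
  145333516232892681, 39627166497746430540144902, 39631888864229300185293062, 145441267840082182,
  308568180724048138, 144768504682926345, 145388491563807256, 6922594486472964, 149944867995738374,
  23079128644108013093409028, 145370899243610647, 6921494974845188, 149944867995803910,
  13412444453672749829345540, 530907038849718173627948462448840807244038, 198902890424201479,
  39943269932195329884889348, 9771223078703493481525511, 18422459166626310,
  19442629671649323990549000, 20651555450280692311077396, 19442629707115171225608968,
  4949963591377931983139334, 10980148893344967215821332,
  1749438258318163801228315502852480967608950, 306934306294178570, 19442629671649324158310200,
  4949963591338349564539398, 9775945445203955405189639, 10984871259845429013525012,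
  1053580755739621528413033579954380775058007, 324912489337430538,
  28784067228329943953329454529557808655343074895052727938577557246212, 12203518594631974025306903,
  24278332909124579835195926, 9771223078703493607479351, 4945241224837887733215750,
  19447352038149785821807112, 20656277816763561922736660,
  1750138763421663351456431212676330350668376, 360941286356394506,
  15304093894730104127250748911981078333623139277007876327518908338436, 21870202785066137911960344,
  14606926352206446925984278, 4875445032603908, 5776903116370440, 146512192702402825,
  149944867475644678, 60631385762965927225872649, 5759310796173831, 146494600516358409,
  149944867475710214, 50964701572530663961809161, 536351473663985552529205537672805439201542,
  63811394277503239, 39943270071841621669126409, 94645104415813168330846705094609068511492,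
  264933832815500667808297369465060265271562, 10432937790359271296547678010950153,
  2624210365430363880895872065090071, 18422459175432726, 5220358794698072843066299716678168,
  18440051361481238, 10432937790359271296547678010884617, 2624210365425641514413002419876375,
  18422459175498262, 5220358794693350476583430071464472, 18440051361546774,
  134561738197308275807324992940625879396615, 152195568314765577, 6885211170685446,
  152195568314765577, 6902803356664326, 0, 389506290492432, 18721521992541958,
  1310047575573392333147099837927945, 9714322704312069, 661010465838982379249509511893513,
  1237868765660107786819332, 39394646440474234120212745, 51512985017219961462410240347272040247831,
  36735920569334023, 72747125674547464, 5020797909731137717699094,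
  1818455010229911286149739847500292, 72747125674547464, 2602946270501879334732309,
  1169417902913057832582328294720004, 72747125670353160, 5025520276214007362908694,
  1818375791738803578729179566981636, 2607668636984748979941909,
  1169338684421950125161768014201348, 60972757583769832363127051473959028857510258168069,
  19547092394478530709770500, 9696730518267909, 661010465838982379249509511893513,
  6792233101760004, 39394646440474234120212745, 191900827635670238961900978589958,
  5794495024685588, 19659617569356956310123016, 99768723053367557,
  1310047575573392333147099837927945, 73237782602396168, 72801002421051930, 27206453461201413,
  81825793116291588, 80513435200132098120167941, 72783409698202137, 27188861275156997,
  81825793116357124, 41832531338945734663156229, 139646118376876107366696013568482516615684,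
  21794643689460929369674245, 221928794272469513, 4845609198730028534540294,
  352046035995029423280020789113359394554378, 6792233101759748, 336486959211454240083982158565641,
  191821597055304335393949573599493, 5793395513053716, 19659599122612882567016968,
  99768723053371654, 661010465838982379249509511893513, 73237713882919432, 72801002421047834,
  27206453494755846, 90832992337478148, 82930991691456177116754438, 72783409698198041,
  27188861308711430, 90832992337543684, 44250087830269813659742726,
  139624850728864320549920140411645622698500, 24212495328690187719086598, 221928794238915081,
  2427757550493570896898053, 177821463482471820252067888306623903056394,
  332287866578128170632792614912532, 5793395529630229, 1237019377877526,
  19518204829270306701390344, 99768723053302021, 1237019344323093, 19522927195753176313049608,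
  99768723053306118, 39394646440474234120212745, 1406775162298386078580314439329425845072136,
  60858577767949272860686732811164694220798920380677, 24212495328690187719086598,
  327177650100680489273747126228996, 90707847998192282062042945830404095627530,
  19527907744318410923208968, 3032202013574403961938453, 1328745731982104980423704410862086,
  37297573074178447068048719685477739549846344439812, 1323186112231493484437764,
  1328745732586567883368279669362950, 60675890367814355851543690511684373889928023644165,
  1328745731982105025988565712392454, 5565051907380755158360327, 216862313885098249,
  6779290502403001846227204, 29214366953345727844739335, 1819643442339031808113084352643588,
  20449958508982807, 36121366542897684, 11668159253846021, 16191550075257365,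
  4346386127763359502833669, 24971150339035668, 1819643428229653482590588476481796,
  2144161983096710885077719875858949,
  36252451181964479923752117275964543069900031838973482878660315814690858690826,
  397642846961234455, 1328745731982104971979455107597606,
  479830039408951067468515885466732648366612, 113916070436893207, 1923516964931045087080983,
  1323186112230393972805892, 679708622851862781565510024057093,
  107443942762403249883098712475458884085229939726342, 679708622247399933175403135783173,
  3147200268150397297316103, 216862313885094153, 4361438863173743496810756,
  29214071805439448980281607, 1170606335022178354545672799863300, 11442759254241815,
  36138958695391764, 20675358508587014, 25197649818370582, 6763942619087438499420166,
  15963951084298772, 1170606318495243537700197438738692, 2144161983096710894067326944555526,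
  36250684334899701539422533978458091160613380515473145953033430728145336228106,
  397641747449606679, 679708622247399870176685428737573,
  305605467545351346012458665211695172583956, 113914970925265431, 1923812103829025185165847,
  682640064365095701503380979863813, 7378735696586423612682758, 24363611052067917487686166,
  2150170940904911466562068, 7368110451075739079574038, 3147495388996595087724805,
  1932961682114321469493508, 724626302333980131348745, 15630537945871580423123749590159625,
  7842092686709881695370216833964295, 52214827687241445572726009816160808677897,
  1938569569453434435420676, 18177264041013766, 4668595462681094, 7201943267521030,
  19542369995890952325517572, 58204384535186259006935305,
  1408176163786558609062480936815406362558996, 417458143179963625275428256170500,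
  18212448413104390, 20732533008982278, 518875468853611247213523946262788,
  419993442803425170467493457314308, 541475081, 18142079669192966, 541475081,
  1170527087924322344090223162901014, 516340167653154788410530539720964,
  58213533983281827467063833, 4689485872325140, 216845820779725334, 72801001397641748,
  10480068643672169704602755554439705, 20732533359153670, 21586180, 21586180,
  2471015377578484040421636, 698723071885829161730137234231557, 4965606423879617327084038,
  1564597497910810738516500, 4960884066421676561609222, 4965606432886954020778502,
  77425672956075602198888986, 19527907815981826007578888, 5450053661810861535547654,
  96899160488709616296212746, 1819881126826574673127384868930052, 58213534116926294092888585,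
  1819801898664078855533864497660420,
  16354281600254488319550701017617257789625558009322750143661519205710730369545,
  180797782272733719, 3032202013574403931394309, 96899160488708516784584970,
  1170844019509721219561072827777540, 58213534116925194581260809,
  1170764791347225401967552456507908,
  15449655903087955542802520201696017620642260259083496111438912858560882022921,
  180815374425223703, 2789690681984816472641798865384669568252425, 221856845739274500,
  1237019394802198, 221856845739274500, 1237019361247765, 96899160635001219460837642,
  96899160635001219460837642, 2813222005281857848719104363546491081871621, 225851371497665029,
  72818593583686164, 234840978599916038, 72818593617236500, 9714322704312069,
  661010465838982379249509511893513, 6792164382283268, 39394646440474234120212745,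
  193168478240620834828675140964614, 5794495024685588, 9988210976411125759357447,
  63757518220448005, 1310047575573392333147099837927945, 37208985449280007, 36772205402087962,
  27205353815421445, 45796995963109892, 80513435164103300967051781, 36754612679238169,
  27187761629377029, 45796995963175428, 41832531302916937510040069,
  139646118376876107366696013568482382397956, 12127959499026696763544069, 185917589439549961,
  4845609198747620720584454, 352046035995029423280020789113359394554378, 6792164382283012,
  336486959211454240083982158565641, 193089247660254931260723735974149, 5793395513053716,
  9988192529667052016251399, 63757518220452102, 661010465838982379249509511893513,
  37208916729803271, 36772205402083866, 27205353848975878, 54804195184296452,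
  82930991655427379963638278, 36754612679234073, 27187761662931462, 54804195184361988,
  44250087794241016506626566, 139624850728864320549920140411645488480772,
  14545811138255955112956422, 185917589405995529, 2427757550511163082942213,
  177821463482471820252067888306623903056394, 332287866578128170650384800891412, 5793395529630229,
  1237019377877526, 9846798236324476150624775, 63757518220382469, 1237019344323093,
  9851520602807345762284039, 63757518220386566, 39394646440474234120212745,
  709876872248155666468502836098085832634631, 60858577767949270264538293872344287027312525201669,
  14545811138255955112956422, 327177650100680489273747126228740,
  90707847998192282062042945830404095627530, 9861223553883147659145479, 3032183566812738066276885,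
  1327478081381858304260541811995142, 37206229221504983267472400319722921108046948210436,
  1318463745731031653114116, 1327478081986321207222640537129222,
  60584546515140892050967371145929555448128627414789, 1327478081381858313814198280671494,
  5565347055285934511186184, 180851109052178697, 6779290466391797013307652,
  29214366953345727844739336, 1819722660830139515533644498944516, 20451058020614680,
  72150163561927188, 11685751439890181, 16173957889212949, 4341663761298082043664133,
  24972249850728980, 1819722656396890113411051665645828, 2144241211263947515898183199175173,
  32633948379818375432997910142578601968131761128582903407860588763676001659146,
  397642846961238552, 1327478081381858295816292508792102,
  479828710179687631952414752257076153184788, 113916070436897304, 1928239331415014243926552,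
  1318463745729932141482244, 678440972251616105419870891823365,
  107352598909729786082522393109704065643430543496966, 678440971647153221001035704062213,
  3147495416055576650141960, 180851109052174601, 4361438827162538663891204,
  29214071805439448980281608, 1170685553513286061966232946164228, 11443858765873688,
  72167755714421268, 20692950694631174, 25180057632326166, 6759220252622161040250630,
  15965050595992084, 1170685546662480168520660627902724, 2144241211263947524887790267871750,
  32632181532753597048668326845072150058845109805082566482233703677130479196426,
  397641747449610776, 678440971647153194013522829932069,
  305604138316087910496357532002038677402132, 113914970925269528, 1928534470312994342011416,
  682560836197859034671712957780229, 7378440548663651939660294, 14696926861632654223557142,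
  2154893307370188925727252, 7363388048581664601436694, 3147200205080210901979397,
  1932961682114321469493508, 724921450239159484174601, 13034389516604461756763680778375433,
  7842092686709881731399013852928264, 52236095335174004226692470729125160038921,
  1938274385519457929413124, 18177263906861574, 4668595328528902, 7201943133368838,
  9870963438973918927933700, 48532977978269225609351433,
  711277876332476635889489740812737251537428, 417458143184685955729500882420228, 18212448278952198,
  20731433497354502, 518875459182204690296490548613380, 419993442803425170466393811468804,
  541475081, 18159671721019654, 541475081, 1170527087924322308079018330046998,
  517607808581976460894993845342468, 48546849792847663714632217, 4689485872325140,
  180817023760757270, 36772204378677780, 10480068643672169668591550721524249, 20731433713308166,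
  21586180, 21586180, 2471015341567279207502084, 699990722485762243225355072983301,
  4965311275973338328478214, 1564597497910810738516500, 4960588918515397563003398,
  4965311284980675022172678, 77425377808170422846059034, 9861223589518865102027015,
  5450035215049195639951622, 87232476298257860223580426, 1819881117155168080199146504143364,
  48546849926474538020256265, 1819801888992672262605626132873732,
  16352514739716318569658364544920829064030658034042829129167912465492028430857,
  216826579291701784, 3032183566812738035798277, 87232476298256760711952650,
  1170844009838314626632834462990852, 48546849926473438508628489,
  1170764781675818809039314091721220,
  15447889042549785792910183728999588895047360283803575096945306118342180084233,
  216844171444191768, 2789690681984816472641798829373464601180681, 185828048586158340,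
  1237019394798102, 185828048586158340, 1237019361243669, 87232476444566986854773002,
  87232476444566986854773002, 2813222005281857848723826730029360727085317, 189822574344548869,
  36789796564722196, 198812181446799878, 36789796598272532, 1247608646567310309659908,
  336486959211454240083982158565641, 2607668645444460124459269, 109318662,
  4880307523806010131780105, 27165771296092678, 1311473682504256901443082053632522,
  4879717227976959730332166, 1311473682504256901443082053632522, 18158572074906118,
  1311473682504256901443082053632522, 661010465838982379249509511893513,
  1311156769848592033854717757436422, 1312741333109207497345040588161547,
  2456552917992631506970885, 177821463482471820252067888306623903056394,
  327177650110420370180949649069572, 90707847998192282062042945830404095627530,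
  1349027831671491068188133834510598, 9775945445713235354874119, 4914958802690308,
  19447352038659065788399880, 21865203620615592401658389, 19447352073561963147499016,
  1324071555983315426631940, 12193797063679867306402325,
  1488441681917515985891508942989660269546100, 293989687180895754, 19447352038659066031662904,
  1324071555947031542915332, 77475810043095714183672074, 79893661408864065512038933,
  5670595730753211199742850449033288733116218, 325439361490055431,
  28790649237148174023015285880692627520717105218563316931866540007684, 21865203620615592401854997,
  96748118624702161022902538, 9775945445713235480832055, 1319349189446569711591684,
  77475810043095714183676170, 79893661408864065511973397,
  5670255448385022610674436478523898296223802, 361468158509023496,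
  15310675903548334009955714536753220138323101741793715475620987298052, 12193797063697459492577813,
  87081434398239200251437322, 4967735289864452, 1329384217113260791902728,
  7189094145658826604946573421400325, 1329089069190489118880263,
  4594213366991345872177642607235333, 42887402854692617011646721382109451,
  41712617869554701800040399605625095, 352046035995029423280020789113359394554378,
  181758719904128391063976083069147768369669, 526270608507587026307973689920094819033610,
  20797254327498175154524666956833306, 4967735327617556, 20797254327497880006619487604007450,
  4967735327621652, 171843909895795209, 5812087746679044, 41566441761642208035129522992603675,
  4985327513727508, 41566441761641912887224343639777819, 4985327513731604, 171843909895795209,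
  5829679932657924, 10470902935650225163309142585659657, 10470902935650225163309142585594121,
  221675436758337860039602966169165540913415, 1300738266472653611713296142248198,
  352386318363218012348434759622749697294859, 327177650110420370180949649069316,
  90707847998192282062042945830404095627530, 699990721936785975391463932317957,
  9771223079230296990183687, 4913859257573636, 19442629672176127423709448,
  24278332902369180394148374, 19442629707079024782808328, 1323776408078136073801988,
  14606926345433455298892310, 1488101399549327396827798892236589369100916, 293988587669267722,
  19442629672176127666968376, 1323776408040752678457604, 77471087676612775818981642,
  82306790690617653504528918, 5670574463105199412926074575876451839199034, 325439292770578695,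
  28784067218917356703305443303159595633687972577648928343769483989252, 24278332902369180394344982,
  96748100177958018593870090, 9771223079230297116137527, 1319054041540290847133956,
  77471087676612775818985738, 82306790690617653504463382,
  5670234180737010823857660605367061402306618, 361468089789546760,
  15304093885317516690245871959220188251293969100879326887523931279620, 14606926345451047485067798,
  87081415951495057822404874, 4966635778232580, 1329384217114360269976072,
  7189094148076678253181931513929990, 1329089069191588596953607,
  4594213369409197520413000699764998, 42238365744957911918851150991548683,
  41712617869554996947944479446823175, 177821463482471820252067888306623903056394,
  355643010049685827465656197026778106507782, 526270608507587026307973689920094819033610,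
  20795986676897946916115971032437274, 4966635849544212, 20795986676897651768210791679611418,
  4966635849548308, 171843909895795209, 5810988235055364, 41565174111041979796720827068207643,
  4984228035654164, 41565174111041684648815647715381787, 4984228035658260, 171843909895795209,
  5828580421034244, 10470897983889772873881764124713225, 10470897983889772873881764124647689,
  395900009270895463067555866977000510484743, 651701156737948509910526463453445,
  178161745850660409320481858816014205796875, 89899677372555960577696215695561479242260,
  134221455829119686733893508059679253098759, 4950258718962968221467942, 7368110359317026919960837,
  18481833789051146, 145423676199358729, 2532407079732610326873637, 7368110359318126431592710,
  9474634534314250, 144315368478494985, 19522927195680745949120312, 146512192698069257,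
  40245501500906686365716741, 40245796648812965230170374, 146568267262750983, 325439224579596554,
  226035309654876791052832323909218896072965, 117764567308333319, 58208553510623508641317129,
  4945536352497690762233126, 7363387992851749460726021, 18481833789051146, 145423676199358729,
  2527684713267332867638821, 7363387992852848972357894, 9474634534314250, 144315368478494985,
  9851520602734915398289463, 146494600511959305, 40245501500924278551761157,
  40245796648830557416214790, 146569366774382856, 361468021598560522,
  225695024691807423321659987131359610425605, 117764567308337416, 48537146953706475243663625,
  418725792198474564112404626948629, 1331360260920542326990098251007270,
  1980397370655247428792867850178821, 149944867991605513, 149944867991539977,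
  825805353963143602161120463843591, 682323151185837225187328572147237,
  1980397370655247428792867850182918, 149943768479981833, 149943768479916297,
  1474842463697848703963890109149447, 90707847998192282062042945830404095627530,
  77475810042269847798915338, 1237020418195989, 1237020418195989,
  5622639843102357376648271765085338374533383, 5489789101221949781738790,
  2546574472175989826421269, 3071937452985492144031269, 4964426120394855244530198,
  5489493953316770428908838, 2546574472175989826417173, 3071642305080312791201317,
  4964426120394855244526102, 9469135876935941, 117577990, 576832669636650011, 576832669636584475,
  154847062797185515927393307, 154847062797185515927327771,
  23575991099789479995660439207563505899000444559620, 91048130366380871130456916339794398368011,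
  38875443368991324183892505, 18463141055264038, 4959703450837992471929092, 11706642056564997,
  6164792349093837474062596, 2607668645444460222235157, 9455941766968869,
  2541851811607634610823428, 20713841311310086, 3746940709864579124646148,
  5025520293680917826388502, 4951242619580676, 4954981079797647179780614,
  2948728928418563502683376023269639, 2537129440568388796813829,
  2947461277818335273280779808436487, 985608558429713178419132849606917,
  761025956369755786359969047217494162568956655202567, 134977591, 29118758630796553672694280,
  117860087359754501, 7816507251292198287086181281403672, 7815239600687247691201814932984600,
  29194426022347288645178136, 117860087359754501, 3067215086487229335963173, 20433465926845462,
  9469136439304452, 1933847135102114644840708, 1328793922449692397494532,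
  1472386390125393655341216520832294, 39626871489416555215081733, 39324935181293276985131542,
  1078280458, 21647620, 27501127134761220, 4702680518381828, 1005732512313094518369313228476676,
  21467910621537469745076124910960906, 5485066734762169880642854, 159678043715622102753707035,
  18476335694041348, 1328498774544513044664580, 823349280390688553538446841972261,
  39627166637322834079535366, 39324640033386998120677909, 1078345994, 21582084, 18194856422363396,
  4703780030013700, 1654690393885285346828389586723076, 22116947731272174837872794813219082,
  3067215086525712242935333, 157264914433868583480689691, 9469138049782020,
  49286453431933201983006969536803406258852961079557, 4954981108282767968571910,
  183606346833243237957829496593040221294853, 1559875285531711811309828, 1559875285531711811047684,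
  5810988235051268, 8, 7815239600687247691201814664532759, 77698295224695234436223242,
  159914758446129412, 18194855965180438, 288340397143831050, 288340397653442826, 4686187923247622,
  116096152091765809216831754, 5810988234789124, 12269483032314701312192775,
  77698295224695234436223242, 3066919938582049983133221, 20432366415213590, 9469136439304452,
  1933551987196935292014852, 1328793922448592885866756, 1472307161962879391003622976877862,
  39631593855881832674251013, 39329657547758554444296726, 1078280458, 21647620, 27501127134761220,
  4702680518381828, 1005732512312799370464133875650820, 21469178272132975607994751968952586,
  5484771586856990527812902, 159678043715621003242075163, 18476335694041348,
  1328498774543413533036804, 823270052228174289200853298017829, 39631889003788111538704646,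
  39329362399852275579843093, 1078345994, 21582084, 18194856422363396, 4703780030013700,
  1654690393884990198923210233897220, 22118215381867680700791421871210762,
  3066919938620532890105381, 157264914433867483969057819, 9469138049782020,
  49286453431933201984274620136736487737578125414661, 4954981108281668456944134,
  183606346834510888557762578071765385629957, 1559875285531711811113220, 1559875285531711811309828,
  5810988235051268, 7, 7815239600687247691201814798750488, 77698295224695234436288778,
  159914758446129412, 18194855965180438, 288340397653508362, 288340397143896586, 4686187923247622,
  5810988234854660, 116091429725265347385573642, 21940889589232834221469960,
  77698295224695234436288778, 4949043592122628, 9451543745618453, 4954981105745090282920198,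
  9451543745618453, 4954981105745090282920198, 13547701276336661, 4954981101115527871469830,
  4954981101115527871469830, 755168531817069920149359446350160365131052303667461, 9453742743852581,
  7443371932666088896827926, 7438649566183219251614230, 7443371941917375430628374,
  145333515683516677, 60383764, 22554900606566934, 3071642304803233155535114, 68764182, 18502164,
  433669445007270420, 288429458099557402, 3071937452707312996667658, 68764182, 18502164,
  433669445007270420, 288429458099491866, 189822573646213383,
  221675436758337860029863085298246897660167, 41548961886271812005148162116768011,
  48537257485645660746707207, 58208664042563793655984392, 4988626010726660,
  4954981079797646660178454, 4954981079797646660178454, 699990721936786120386188295950597,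
  1339124108417518514163972, 1852661852239959721267460, 10803319512079138080218063483457796,
  1847939485757090075988228, 10803319512079138080218063483392260, 189822573646213383,
  80412788945261538925039882, 221675436758337860029863085298246897660167, 145351107869561094,
  93934100, 13547701351825941, 5489493953039690759692554, 35209749, 18436628, 433669445040820756,
  288430557611189274, 5489789100943770600825098, 35209749, 18436628, 433669445040820756,
  288430557611123738, 198812180714909959, 395900009270895463057520838200902514405639,
  41549041114434621417390935013548299, 48532535128169990356234503, 58203941685088123265511688,
  4988626010722564, 2537129440568388277211669, 2537129440568388277211669,
  1349027831671491213182858198143238, 1339124117423618257281284, 1852957000146238585725188,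
  10803398742659503992791015119937796, 1848234633663368940445956,
  10803398742659503992791015119872260, 198812180714909959, 82830640584508389460500746,
  395900009270895463057520838200902514405639, 183606346815575705352680293293618769580293,
  290628481346917402, 290610889160872986, 18502164, 4954981108319051852288518,
  43540551043209879692591638, 18502164, 11732353901108336316713546897961478, 18502164,
  11733621551708564546115043601101318, 4965901580770005976617478,
  221675436758337860029863085298246897660167,
  281341800482654726743054640593280012444384588524170393698962514809803667640695756518172461831102405129,
  1497328771302775162601838723828568901815895526707466,
  761025956369755786359969047217494162568956655202567,
  108097771331891877653145904890813630592595912647792916205378860362506,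
  31411515432616408866777779824916005, 87218179962403425744335111,
  108097771331891877653237248743146812024983642949837683876515170036490,
  31411515432616408867886087545652773, 87222902328886295389548807,
  108104353350145682405968378989277593545782597933242754466420844014346,
  31411515432616408866760187638875685, 96889586555331664109056264,
  108104353350145682406059722841610774978170328235287522137557153688330,
  31411515432616408867903679731693093, 96894308921814533754269960,
  755168531817069920149359446350160365131052303667461, 5577987003798127861565013471873408625285898,
  20945950494479057512008224501803527, 48537276245333349874807047, 58208682838261588239528200,
  5577987003798127861565013471873408625285898, 20945950494479352659913403854563847,
  48532553878850480229593351, 58203960471778718594314504, 389506290492432, 72747125536405768,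
  144804720115396873, 5025520276214007362916886, 1818534248083164295193614667629060,
  144804720115396873, 2607668636984748979950101, 1169497140766310841626203114848772,
  844899360012643198303811207057669, 58379388792309244750148105, 7448094310428848559698438,
  24373055783005053530046998, 5565347046275436685767174, 36735920569334023, 144804719981244681,
  5020797909731137717703190, 1818534238416480104759450915193348, 144804719981244681,
  2602946270501879334736405, 1169497131099626651192039362413060, 844820122178722341037979432538373,
  48707982235392211218346505, 7448094310427748913918470, 14701649226105612318437910,
  5565051862341460179825158, 4874404566229089144613126, 352046035995029423280020789113359394554378,
  2456552917992631506970885, 177821463482471820252067888306623903056394,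
  90239959740744549646405334110131150201092, 90707847998192282062042945830404095627530,
  144822312028813833, 4954685949394562029342982, 58213534188962997409888776,
  1819722689844377777087931786936836, 48546849962517628690381319,
  1819643461681863512767930294813188,
  18159944072980329794936625647764393375569849845467033943980728922852649613831,
  58082340853948350063782408, 2536834301158104425189637, 58213534188962997409888776,
  1170685582527524323521619745784324, 48546849962517628690381319,
  1170606354365010059201618253660676,
  18158177225915551398052838832722593346695458974595388600926923666033222367751,
  58082045697036040175757832, 683986981284263148060114631938309, 5020797938252542919588358,
  5025520304735412564736518, 9710184108625554433389063, 10439429510600270860127349543506452,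
  162819117925679638, 36735920569399303, 72747125674946824, 5020797909731137717699094,
  1818455010258688206904726748021252, 72747125674946824, 2602946270501879334732309,
  1169417902941834753337315195240964, 844820122178722341037979432538373,
  29365169049500550116749832, 7448094335439435034423830, 7443371943944879268770310,
  5565051862341460179825158, 4879126932711958789826566, 352046035995029423280020789113359394554378,
  2461275284475501152184325, 177821463482471820252067888306623903056394,
  90239959740744549646405334110131150201092, 90707847998192282062042945830404095627530,
  72782309908494856, 4949963582894100198084870, 58213534188962997409888777,
  1819801898664078855533864497660420, 29208759143126429420042759,
  1819643442339050326893861379195396,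
  10922938468688120913788279361309184579857355237246224438888505907609869040135,
  58082340925988352184101385, 2532111934657642593931525, 58213534188962997409888777,
  1170764791347225401967552456507908, 29208759143126429420042759,
  1170606335022196873327549338042884,
  10921171621623342516904492546267384550982964366374579095834700650790441794055,
  58082045769076042296076809, 683907733783658064313729899974917, 5020797938251443139590662,
  5030242671217182429886982, 9714906403050829772304903, 5247132652070165598079722859495956,
  90761523887751702, 4879126932729550975870726, 352046035995029423280020789113359394554378,
  2461275284493093338228485, 177821463482471820252067888306623903056394,
  90239959740744549646405334110131150201092, 90707847998192282062042945830404095627530,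
  36753512755378695, 4945241216393638366826758, 48546849962517628690381321,
  1819801888992672262605626132873732, 29208759143126429420042760,
  1819722660830157998285624506532356,
  10922938468688120963980573502729642194832331764305518045229315675676792666632,
  48410934405082523753589257, 2527389568157180762673413, 48546849962517628690381321,
  1170764781675818809039314091721220, 29208759143126429420042760,
  1170685553513304544719312465379844,
  10921171621623342567096786687687842165957940893433872702175510418857365420552,
  48410639248170213865564681, 683828495949737207047898125455621, 5025520304733213138958854,
  5030242671216082784107014, 19386312959967863169954312, 2650984222802751783832066880926228,
  54750319054832150, 660693553183317511645683333411333, 177821463482471820252067888306623903056394,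
  1309730662918022614030163380611590, 352386318363218012348434759622749697294859,
  660693553183317512227393701816837, 178161745850660409320481858816014205796875,
  23575991102203358036005846432756819520469550309636, 91048130366380871130456916339794398368011,
  975703285272799611259017952958957136695983236402331245284368581598088603589186959879,
  188242611007058947630971947748813806391557, 19386312959967863169954312,
  19386312959967863169954312, 417458141598246369874531176690196, 4965311273945834422236454,
  13008804129169875994996623570123529, 7816507251292235180574466139306760,
  2547459625709376784528933, 13007536478564925399112257221704457,
  7815239600687284584690099790887688, 683828495949737207047898125455621, 5025520304733213138956806,
  5030242671216082784104966, 19386312959967863169954312, 20862127098241457076943796499395082,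
  4960588907462964776957222, 13008804129169857548252481141094921,
  7816507251292216733830323710278152, 2542737259226507139249701,
  13007536478564906952368114792675849, 7815239600687266137945957361859080,
  682560845349508977646401422250245, 5025520304715620952912390, 5030242671198490598060550,
  19386312959967863169954312, 41631314609752020334632357503447563,
  374803139964634516521812821604723397014594605496840, 5589204358896344641724165865148214429852186,
  358200737066419794180936682713348, 19386403167577543046410504, 19386403167577543046410504,
  20859671034727956229395850202948122, 682719291933772344573247636386309,
  29194463167545672016146696, 48537276353419740931698953, 19386403167577543046410504,
  20859591806565441965058256658997786, 1331756401668477446358425129202182,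
  29189740801062802370933000, 48532553986936871286485257, 19386403167577543046410504, 0, 0,
  1215166511584002, 331764693400486567960838, 1215372669948930, 90404285525419810616281643118855,
  1215372670014210, 90404285525419810616281643118855, 316822830663742032909570,
  24629265625570642339405047538174682300680, 1215372670014210, 90404285525419810616281643118855,
  316822830681334218953730, 24629265625570642339405047538174682300680, 316822830681334219019010,
  24629265625570642339405047538174682300680, 326286010373623752365570,
  6708420992610735924703440035724007562347989864713, 0, 0]

theorem verifies_triangleCertificate : verifies 3 928832929463129220048748544
    triangleCertificate = true := by decide +kernel

set_option maxRecDepth 100000 in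
/-- The certificate for the graphs whose shortest odd cycle is a pentagon. -/
def pentagonCertificate : List ℕ := [
  1, 4, 19080704, 0, 9847315, 794021654849122931650818, 1481390076473602, 5177815014593541,
  11226559318732967780185143, 41822192515183127, 7685433569664042927743238, 1229541642,
  183140429180002569, 41822192515183127, 10598480398147850, 86898870719115800,
  39489978057831853803004169, 10600679409877530, 29759523472892166, 11080205155987003689955863,
  2975587584878921950241170071777815, 20731433497223430, 12139156684086459199283466, 3, 21442818,
  19288870, 151200007, 5565346965195387587473672, 285417736, 5565051817272615914451207, 151200007,
  5565346967202962455811082, 2144399667599896702311275902218501, 41295672620245255,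
  5177815025148166, 5625888049402340424970775, 41150872092684551, 285417736, 151200007, 77230618,
  1229467911, 38442805, 539645705, 38442805, 110850581, 110793237,
  2144399667599896702311275902218501, 11879956386801030105938796047127561, 77179600526323976,
  77234714, 1363620104, 38443061, 539645961, 38443061, 110854677, 110793237,
  2144399667599896702311275902218501, 11879956386801030105938796047127561, 41150872092684551,
  5674261658664747231259634366651068265805578, 151675143, 3982744308972894600769797, 110789141,
  110785045, 1229676807, 43721218589755990171920137, 39395199987366213359707913, 136925991, 7,
  402858248, 285827336, 271143720, 146849815767767051, 164867512291709734, 151609607, 136925991,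
  146850915279394571, 164867512291709734, 41823292706990087, 116766452730932857766356746,
  136991527, 78080826503264724175759114, 673948455, 136991527, 19215906, 10206835179410213,
  153298951, 41278080333472006, 285417736, 136520711, 2840580695486094442586377, 1128804618,
  9871295512455599203246343, 144804032664647433, 216264522905317640, 288919221277374218,
  144804032664647433, 690169865, 39919197042169271390910217, 153298951, 14766510065262853,
  72712430943949608, 5, 41278080333472006, 285417736, 10476643869937733206692874, 690169865,
  287652136, 22116926734924721334460677, 22112204368441851689246981, 289747208, 19589186942554918,
  10581987992232197, 20902983392534014567473414, 423964935, 556087305, 1629693706,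
  77305778075767050, 423964935, 78193670, 27505670749848629, 1389909208308584135876870, 423964935,
  21185219545866693106334562163111690, 420111671, 38441221, 80221277960369086866665733, 51011845,
  51011845, 306728907691352326, 77216099156179240, 20902983465208288597398310, 423964935,
  1092958218, 59413165371093596713985801, 556087305, 98098773152017657131902730, 824387337,
  824387337, 76616237977195528, 77288185618912037, 422204199, 78074886, 290025730, 580272665,
  21455106, 110850582, 212489222, 212489222, 422204199, 1361258250, 20714940820509478,
  29739732352729621, 453189895, 21508354, 5569774186077654038029323, 175489394420367734570910729,
  20714940879438854, 72784585991541541, 1361258250, 55206146, 110723606, 323655426, 580272665,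
  323643138, 110723606, 361054545635926827, 422204199, 1361258250, 3147495318950012126647077,
  153298951, 110723606, 681986057, 690169865, 153298951, 5560624665739640154185990, 323444994,
  453189895, 662084189601624603, 2166564619, 1092823050, 653766532255655691, 21717250, 539711497,
  545671977, 2150180617, 293352454293653258, 21651714, 168452359, 2, 6, 116933512077576, 555952137,
  653748940069611275, 21717250, 1076582410, 1082542890, 2150246154, 149237265680992009, 21586178,
  168386823, 2, 6, 111779551322376, 580272665, 146758556318902281, 1629693706, 1629693706,
  1629693706, 287516424, 78140422, 110789141, 106595378, 39948398314673579330053897,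
  77305777804956453, 824387337, 1117143578, 78205958, 110858774, 824387337, 824387337,
  221438558869858057, 422220583, 77165078, 638857750, 19288870, 308980502477112330,
  113334575015035911, 19624371368395826, 21508354, 78166159839900601655386922, 422220583,
  45220784063791637, 824387337, 1151882246, 1117143573, 299974401601196837, 824387337, 824387337,
  824387337, 422132263, 59443436482000929645864713, 43610645, 30417835062543918496764935, 19288870,
  5632465413532411600542775185806377007724298, 1117143573, 72802178177585957, 824387337, 110789142,
  1117143578, 110789142, 29758424225571078, 824387337, 824387337, 221438558869858057, 153707303,
  422220583, 422142759, 20897375736053784289489154, 78623712883843344829196298, 149364472157987081,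
  216917366790574889, 299973302089569061, 299973302089569061, 822765321, 21651714,
  30423018597628630880977927, 30423018597628630880977927, 1151955974, 80523470134239223467300869,
  40715547342164775, 21651714, 2, 82264429253177605, 5773605353236482, 323563781, 323563781,
  80523470134239223467169797, 19215906, 72675794472165640, 54997253, 77289285166457094, 151200007,
  38023429, 20143032948477922573374473, 1361258250, 2769686399247414295155493, 148710597463648009,
  180235794471616775, 292825786076374794, 148710597463648009, 591868169,
  39928641779041575480338185, 287516424, 14784102385524997, 36683633924985639, 5,
  77306877352435974, 151200007, 20147755314978384404698122, 824387337, 153434407,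
  12445815325912867289637125, 12441092959429997644423429, 155529479, 19588087430927142,
  10580888346386693, 11231576835616981169824006, 423964936, 556087049, 1629828874,
  41276980922585354, 423964936, 78193670, 27504571238216757, 1389909172279787116912902, 423964936,
  21183951895275909613770116457637642, 420111672, 38441221, 80220982776435110494810373, 51011845,
  51011845, 306727808179724550, 41187302002997543, 11231576872262458180784934, 423964936,
  1092957962, 49741758814175532524185609, 556087049, 88427366595099592942102538, 690169865,
  690169865, 40587440958166023, 41259388599948069, 422204200, 78140422, 155812098, 580272665,
  21520642, 110719510, 346706950, 346706950, 422204200, 1227040778, 20713841308881702,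
  29738632841097749, 453189896, 21442818, 5570069333982833390855179, 165817987863449601661629449,
  20713841367806982, 36755788972577573, 1227040778, 55206146, 110719510, 189437954, 580272665,
  189425666, 110719510, 325025748616962859, 422204200, 1227040778, 3147200171043733262193445,
  287516424, 110719510, 816203529, 824387337, 287516424, 5560329481805663648178438, 189292802,
  453189896, 626055392582664731, 2166564875, 1092822794, 617737735236691979, 21717250, 539711241,
  545671977, 2150180873, 865420655512987402, 21651714, 302670088, 2, 6, 116941565141256, 555951881,
  617720143050647563, 21717250, 1076582154, 1082542890, 2150246410, 721323059086305033, 21586178,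
  302604552, 2, 6, 111787604386056, 580272665, 146758556318902025, 1629693706, 1629693706,
  1629693706, 153298951, 78074886, 110785045, 106591282, 39948416725388855886424073,
  41276980785992485, 690169865, 1117143578, 78205958, 110858774, 690169865, 690169865,
  185409761716676617, 422220584, 77169174, 638857750, 19288870, 308979402965480458,
  113334575149249544, 19623271856763954, 21442818, 78161437473400208409387818, 422220584,
  81248481571127829, 690169865, 1151816710, 1117143573, 299974401601196837, 690169865, 690169865,
  690169865, 422132264, 49772029925066372781647881, 43614741, 30417835098572646930404360, 19288870,
  5632125130879160082771945112928578173085450, 1117143573, 36773381158621989, 690169865, 110785046,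
  1117143578, 110785046, 29758424091353350, 690169865, 690169865, 185409761716676617, 287925032,
  422220584, 422142760, 11225969179119158571577602, 78614268150895197724813066, 149364472023769353,
  180888569771610921, 299972202577941285, 299972202577941285, 688547849, 21651714,
  30423018633657359314678792, 30423018633657359314678792, 1151960070, 80523174986334044114474757,
  76744344361128744, 21651714, 2, 46235632234213637, 5756013167257346, 189346053, 189346053,
  80523174986334044114409221, 213143564993298922559692702557186, 19288869, 19215906, 136520711,
  2845303057446672991212552, 270738440, 2845007909523901318190087, 136520711,
  2845303062268250264592650, 2063280551373431696970177571148806, 41187370714407943,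
  40623724976165895, 20132997919628011403158536, 10206835179337250, 2845303065327972339098632,
  13658202439296008, 8004124166559207253561858678486071, 10466313658300636061135927,
  2845303126720509517521160, 148674313616852025, 113244896301294599, 106660918,
  2845007914082476403351818, 87837566149740467164098823, 50880774, 20151001940242169288220936,
  79832529175826044614629130, 77179600516043784, 157773390789764873, 52023378550744142955358215,
  10923737606614082327827463, 722174217, 14784102356300034, 20975658307650614,
  10923737678671676365755399, 40094424973838659571389449, 346706950, 363269021644777226,
  76652522129478664, 10206835179337250, 2845007917405200666076167, 10465428222466397350556727,
  2845007942786533145665799, 148674244897371193, 113244896301294600, 106656822, 13640610119033863,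
  8004124176230318698602509742277688, 2845303061986556244549898, 97504250376203428069716232,
  50815238, 10479595347296338871542023, 79832529171959062234081034, 41150872082338823,
  157755798603655177, 61690062777207103860975368, 20595144199559912744440840, 856387849,
  14766510036037890, 20958066121602102, 20595144235588709763404808, 40094424973838728156648457,
  212489222, 327241324137441290, 40623724976296967, 10206835179337250, 75050739621716232,
  154732360708620553, 763701072135926101122183711631114, 363269021677854985, 39021942602686727,
  154731261196988681, 763780300293717998976907476150282, 327241324170518793, 189346055,
  2845303062268250293952778, 2063280551373431696966879036253190, 2845007914082476432711946,
  87836680713906228453519623, 21520646, 75054038420496648, 42351972102442219544798985,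
  2845303061986556273910026, 97503364940369189359137032, 21455110, 39025241267314951,
  42347249735941757713475593, 189346055, 787138249834244060547527111672810718254087,
  20566514886534572894925064, 20147165064182985404915976, 78160552029681372753114890,
  2649840993497449803886611787231490, 1550725651639229030277384, 19542702143717211256729864,
  19547424510182488715899144, 21455106, 5177815014659077, 11707741590090265, 1117143578, 558526722,
  690169863, 824387336, 824387336, 690169863, 690169863, 1219060743, 110793238, 1117143578,
  41150872082207751, 21455106, 38951573914219030, 1218991114, 420032776, 346510344, 110719510,
  77179600650261512, 7978181128352378066064390, 287516424, 21455106, 75001261965595432, 2191098395,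
  77169174, 113334575218447368, 29722140259931142, 11085222707848595228009483,
  157885277964766510496502792, 41150872082207751, 413815816, 77179600516043784, 55075074,
  110724902, 54186407063344135, 7902918376206944168413990, 21520642, 29722140335285254, 413815815,
  1361258250, 413815815, 14784102142675746, 210338823, 56462396026942519, 110723606, 2191098395,
  346706950, 363303108133680714, 346706950, 588168494129554443, 346706950, 363303108133680714,
  346706950, 55075074, 20409409819345974, 221420966685910793, 78140422, 2181730843, 78140422,
  638857750, 77324469763019787, 157884982816861331143676935, 20756629300794425778840587,
  113334576995725847, 77179600516043784, 21520642, 1361258250, 41150872082338823, 55009538,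
  110721062, 90197612030481416, 7902623228300665303956262, 21455106, 29721040689439750, 413815816,
  1227040778, 413815816, 14766509956627234, 344552456, 92490093534282808, 110719510, 2191094299,
  212489222, 327274311114720842, 212489222, 588167394483708939, 212489222, 327274311114720842,
  212489222, 55009538, 20391817633297462, 185392169532729353, 78074886, 2181730843, 78074886,
  638857750, 41295672609838091, 157885277964766510496502792, 11085222707848595228009483,
  113334576995729944, 41150872082338823, 21455106, 1227040778,
  787138249834244060547527111672810718254087, 21455106, 554133513, 293352383426537482, 1629693705,
  553854729, 1629693706, 1629693706, 21455106, 19495788640412678, 189346050,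
  13639983811756723742122248, 13639983811774315928101128, 20151887383961006267310344,
  20151887359757250231558408, 78746180816040954809493514, 235017222, 721625353, 189206229204756489,
  576353330, 243405830, 3258580059948196618585049553051914, 2150049803, 2149787403, 189346050,
  50827194886792962, 1076307978, 1076045578, 189346050, 50827193813051138, 1227040778,
  149237263549802249, 78205958, 54205098760950791, 40698023623877415, 1627596554, 212575238,
  212435974, 77289285589537800, 1629693962, 76726820911276840, 30267475399507148030962232,
  88447030720096843522582538, 403415304, 40698023623877415, 41259388725974023, 145596578152395010,
  609498390, 1629693962, 145596578286612738, 542389522, 39083283848377791601531682, 271143944,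
  40694093720409095, 1389909280313883184621318, 21573890, 153477671390172165, 287913512, 212345863,
  153477671390172165, 346498056, 153695783, 212542471, 1629693706, 1629693706, 725259241508262923,
  151597319, 288848784350734346, 76722891007955976, 76722891007955976, 39025241101849381,
  441708047623678266, 88457361004832626091173898, 21455106, 76722891007955976, 113356565451084808,
  436996980525443082, 113356565451084808, 436996980525443082, 279532552, 76726820777059112,
  49580863684516179247457287, 29824474568511061672736775, 77288185879155720, 292881792986458122,
  184827355563501575, 572224565, 21455106, 542864434, 153605360717288229, 542864434,
  110541875687536168, 21455106, 1627875338, 41276982394578954, 615471700289218571,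
  615471700289218571, 615471700289218571, 145314823, 40698023623877415, 59252251794689138935555080,
  29824474568511061806954248, 41259388725974023, 292864269519890186, 220856083997206280, 572228661,
  21520642, 542868530, 153606460228916005, 542868530, 110541875553318439, 21520642, 1627940618,
  77305779413608202, 651499397796554507, 651499397796554507, 651499397796554507,
  437467640775255818, 2158580747, 78205958, 690639655, 5030870123622632752965382,
  149380964028928805, 1629693706, 824387336, 690169863, 79884475351252799339046666, 110785046,
  2191159835, 110785046, 437467640775255818, 2158580747, 153768743, 579439604737467179,
  162311293836612614, 5635332889947741882831654, 690639655, 43687276708678010413803270, 153298951,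
  10966019, 21455106, 21103099554372901507686088369985546, 421734664, 216352071918757897,
  421734664, 216350972407130121, 421734664, 155991147147357091019577355,
  154933041911229760827516939, 232148733258155828044834827, 232148438114192397877585931,
  62641469625633851678826418001367851, 421734664, 690169865, 690169865, 690169865, 421734664,
  421734664, 421734664, 1361258248, 1361258248, 21103099554372901507686088369985546,
  869325023434201099, 41276980785992485, 421734664, 585504785619968811, 185266060837201673,
  216790983216670729, 1344886538, 421734664, 690169865, 184852450520676906, 690169865, 421734664,
  112794856482748970, 421734664, 453189896, 3, 20152477679773563839013896,
  30427740748064826042241829, 113334575092683557, 113352167278662437, 21455106, 144733389176643849,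
  78615153734749059541051146, 72675794870280456, 78615172109435607663716106,
  19546539033201020168775944, 2190476194643216124341105679261517897474309, 21455106,
  41276980785992485, 2961259843170563, 75036446337214728, 11031555, 799629465068421486620931,
  421734664, 539173897, 270738440, 690169865, 421734664, 617048745305122827, 110854678, 1117487642,
  110854678, 2249470486, 421734664, 11056132194108809759330570, 419635464, 690169865, 690169865,
  11056132194108809759326474, 688070921, 421734664, 421734664, 453189896,
  78615172041322992358336266, 422204200, 3, 75056237544878344, 2, 72798940177273096, 19288870,
  1146844210, 21455106, 1146844210, 21455106, 1146844210, 5158231103730195, 11162627, 690639657,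
  690639657, 5177816080013061, 11150339, 287516424, 721625353, 1175728662, 11162627, 422204200,
  422204200, 5177816079947525, 11150339, 555951881, 453189896, 1175728662, 10966019,
  148673832677483529, 77557048498622828860614410, 76616238371120136, 77557066873309376983279370,
  20604588930221135800510728, 2192511242704842059763142065197885155386374, 10966019,
  41278080297620262, 421734664, 594549368270050091, 185266060837201673, 220731426732189705,
  1359570698, 421734664, 690169865, 180911865271563818, 690169865, 421734664, 108854271233635882,
  421734664, 472065032, 2, 20908000979615029563707656, 30428035895971104906695462,
  113335674604315430, 113353266790294310, 41278080297620262, 36770142755512578, 77852089457518856,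
  21520642, 1555447912816166050604034, 421734664, 553853193, 285417736, 690169865, 421734664,
  613108095616493579, 106660917, 1146848314, 106660917, 2249470485, 421734664,
  11079670235605320138920970, 404956168, 690169865, 690169865, 11079670235605320138916874,
  673391625, 421734664, 421734664, 472065032, 77557066797313263306745610, 422208296, 3,
  76740483193934856, 2, 108827737062011144, 19288869, 1117483539, 10966019, 1117483539, 10966019,
  1117483539, 5158231065982002, 690643753, 21651714, 690643753, 5177816094697222, 21639426,
  287516424, 740500489, 1175728661, 422208296, 21651714, 422208296, 5177816094631686, 21639426,
  555951881, 472065032, 1175728661, 36773381158621989, 76652522254836744,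
  58052955213086276941194249, 421734664, 2181175307, 139100418, 164463662921861148040717099,
  21520642, 155991147155782645821711147, 40060554513993058220188681, 49731979522157971381625865,
  90799044762951942, 421734664, 9847206379004377248194826, 419635464, 148710116561200137,
  690169865, 9847206379003277736567050, 688070921, 76652522254836744, 421734664, 453189896, 3,
  144733389042426121, 48556905707344183595258661, 48561628073809461054427941, 72675794736062728,
  29214092521452522762031909, 29218814887917800221201189, 20717741258441837815428104,
  371689641275285757207928291664902, 30398945380565765832990986, 30398963827327431728652555,
  19288869, 555951881, 287516424, 453189896, 2166564619, 690705193, 422269736, 1092822794,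
  690639657, 422204200, 1117143578, 40715130344198950, 72728571428413704,
  38865740453084437313429769, 421734664, 2214869003, 143295491, 164463662930905730690798379,
  11031555, 154933041924759248591102763, 49731979522157971396305161, 40060554517933501750386953,
  85733388520674309, 421734664, 10928554525612636562412554, 404956168, 144786165734777097,
  690169865, 10928554525611537050784778, 673391625, 72728571428413704, 421734664, 472065032, 2,
  144733389042426121, 49615010951353912661529382, 49619733317819190120698662, 72675794736062728,
  30272197765462251828302630, 30276920131927529287471910, 20878006573768770019029256,
  371689641275285748163345622704389, 30422483426004918717797386, 30427205792505380549121035,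
  19288870, 558176009, 289740552, 472065032, 2168788747, 690709289, 422273832, 1095046922,
  690643753, 422208296, 1146369306, 19288870, 287516424, 21586178, 555951881, 21520642, 287516424,
  472065032, 21097702072801614120987859834524682, 21520642, 2166564619, 690709289, 690709289,
  422273832, 422273832, 472065032, 21520642, 1092822794, 690643753, 690643753, 422208296,
  422208296, 472065032, 21520642, 72728571433017608, 72728571433017608, 5794495019376898,
  553853193, 285417736, 77179600660685064, 2150127371, 1076385546, 285417736, 307853648072432426,
  307853648072432426, 82638834401586916757221642, 285417736, 596066432038165035,
  596066432038165035, 160005364490457837759836427, 1146369306, 5158230022509573, 270738440,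
  721625353, 405492520, 405426984, 5158230022444037, 539173897, 453189896, 673927977, 673862441,
  153298951, 421734664, 421734664, 21455106, 421734664, 10966019, 421734664, 421734664, 421734664,
  421734664, 153298951, 2, 0, 5736633219749636, 153298951, 71577862, 38023429, 10488658182886181,
  422204200, 90164420350145590, 41260488198812726, 1227040778, 422204200, 113353266541790264,
  1227040778, 10317005405647925, 28331403948684342, 72627478, 289806088, 279602179,
  113335674730079239, 163739559980709145, 816473091, 7, 38391097896625155,
  11789413383887029997324272554038057, 20882728935636301950649400, 106529845, 54079754712339239,
  609498393, 1363482378, 422208295, 113356565109175351, 609498393, 609498393, 609498393, 106514485,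
  43953503448379534021563401, 39416885, 7675177245802421245194501, 541340953, 7,
  577942213246719755, 56331554247103491, 243406853, 436412680, 9, 10, 78478621479576,
  289711836021266186, 56331554247037955, 243406853, 436412680, 9, 11, 127956644729496, 1227040778,
  10456647597690634516456451, 39073301, 289740552, 279598083, 113334575218447367,
  154732360692413977, 816468995, 7, 38373505710576643, 11140381228325611318795090952545065,
  20878006569171024457925688, 106529846, 54080029590180647, 575944217, 1363482378, 422204199,
  113356565075620919, 575944217, 575944217, 575944217, 106514486, 41535651800143145103397897,
  72971318, 7675177254792028313891078, 541341209, 7, 577942144527177483, 47324354992366595,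
  243406854, 469967112, 9, 10, 78478542836376, 289711767301723914, 47324354992301059, 243406854,
  469967112, 9, 11, 127956566086296, 1227040778, 10451925231206665359610883, 21590279,
  10488658182886181, 422204200, 413815811, 145380355, 41260488147505417, 323445000, 1227040778,
  10488658084192517, 5233360917149587838611718, 41259388732269353, 422220584, 88703238, 143156227,
  609498390, 145249283, 575944213, 357208326, 319459589, 422220584, 1227040778, 19495788653211910,
  112755132464718632, 14820386269651205, 1095046922, 30418591145460725197730056,
  163720868283036953, 941827080, 3, 8005708737334989396312818007639096, 5267877081229274380972299,
  165817987727215858469728517, 19495788653211910, 41260488243893033, 422220584, 55148805,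
  145253379, 609498390, 143152131, 575944213, 323653893, 323653893, 422220584, 1227040778,
  10488658084393221, 112754032953086760, 23827585557942534, 1095112458, 30418295988565938742653192,
  154713668994741785, 941827080, 3, 8005629509177197498458094075348024, 2850025432992816743264523,
  165818282875121037822554374, 10488658084393221, 39083302434927246993691433, 184754437,
  1616131354, 122319110, 251863302, 184754437, 218308870, 184754437, 576353333,
  77768910251144458122449930, 682263555, 941827080, 757222938890699835, 2298685451,
  617721242694395915, 143369219, 51089669, 38435637, 2164602885, 599068360856248582, 143287299,
  302670088, 3, 10, 110480422081176, 163610976713339958, 143287299, 2168854283, 2164668427,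
  71990075, 590078753753997573, 143283203, 336220424, 3, 10, 110480343437976,
  20875932916242988599388358586996490, 79908455692260003520672005, 82326288893752387448828166,
  1129017605, 1129017605, 542798905, 576418869, 290091272, 413815811, 2845007914099600467308805,
  2845007918584977575720469, 1616131609, 1363547912, 866172521752631051, 73384773594800392,
  157285375324117554017212171, 145596647392687385, 433827024618140954, 155089416110397250377172251,
  39420981, 318972168, 81269372791043354, 79832898116730381512488474, 72975414, 356849416,
  39420981, 323360520, 433827024618140954, 576431157, 576357429, 576353333, 145724062560363527,
  10580888212041989, 5258137203695373544681734, 19588087500337414, 10580888212041989,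
  433827024618140954, 576431157, 576357429, 360906171145225272, 673391623, 88764678, 55210245,
  48557217032161694003246362, 941827080, 216790983606240312, 289711767819854858,
  125894232439447775800997146, 125894232439447775800997402, 77803131520181425053836298,
  108291115774010376, 108291115774006280, 5, 122392838, 159697486580495610449961227, 106665014,
  157279634950272451843662091, 27465942318158086, 28632670184118022, 289711767822808602, 39486517,
  39482421, 1747133447, 1747133447, 153303123888866357, 88764678, 1747133447, 289711836542285082,
  73040950, 73036854, 1747133447, 1747133447, 162310254457685046, 55210245, 1747133447,
  5736633219749636, 153298951, 167908357, 690169865, 162222014388139062, 421734664,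
  90164420350211126, 422269736, 71577862, 558241545, 547768323, 38317156284442631,
  82261651790750685412472090, 289806088, 279333123, 38317156016007431, 82261356642844406548018458,
  1504759204048171603136806263685512469688584, 422273831, 38023429, 558176009, 547702787,
  38317156284442631, 79843818589258301484316186, 289740552, 279267587, 38317156016007431,
  79843523441352022619862554, 1504418921682518312860441836725989412188424, 422269735, 21655815,
  41278080432100138, 421734664, 323653893, 690169865, 421734664, 41276980918379306, 421734664,
  88768774, 1112815125, 357208326, 357208326, 421734664, 690169865, 421734664,
  20878006573768770018828552, 113334575224824618, 8168280603569429273959767640056842,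
  113357664836801322, 41278080430002986, 421734664, 1146369302, 55214341, 323653893, 323653893,
  421734664, 690169865, 421734664, 20882728940251639664038152, 8168280603569429273959767640056842,
  113335674736452394, 113357664836805418, 151757610, 218308870, 184754437, 1113289781, 688070921,
  690643753, 690639657, 419635464, 422208296, 422204200, 1478697992, 3, 38479127544219911,
  111099671806101768, 357118214, 111099671806101768, 323563781, 38479058824742919,
  183157197392988169, 625488134, 183157197392988169, 591933701, 71577862, 39043932998541575,
  39026340812497159, 1146369306, 1146369306, 38023429, 39042833453359367, 39025241267314951,
  1112815130, 1112815130, 5736633219749636, 77794227526113032, 40587441352156167, 4, 6, 290021640,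
  27376881808990469, 7665769348136281464017434, 216282802554429705, 20903278613127762388078858,
  60475824304852756609917189, 19549879454353715, 19570495302685208, 1142375706, 106383925,
  592064777, 19570495302828568, 110576149, 1146369306, 558522633, 147040439309591555,
  180817436649088007, 158859089840595205, 110858771, 19549948173830195, 19588087488795161,
  1142375706, 106383925, 323629320, 19588087488877081, 110576149, 1146369306, 290087176,
  74982913722704899, 108759911062201351, 86801564253708549, 110854675, 71780915,
  5565642115109241322370106, 110576149, 608649481, 14743901764739333, 5565346965795733607453210,
  110576149, 608649481, 159990404739897673392658443, 340214024, 14743970215780613,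
  5565642113700912960274970, 110576149, 340214024, 159990386293153599414671627,
  3957804295990506676703765, 7379070050617887187170362, 162218922446500105, 90161328140136712,
  142742535, 373567752, 3957804295990506705862917, 6655264710603844438067694558458120, 143361031,
  102401861, 143361031, 5187301790279645513520135, 202015255, 360976883020177946,
  293967147884222474, 290087176, 234276516819906825, 234276516769981721,
  96767948874616788507910408, 116110743613764307180544265, 1363894536, 1363894536, 5, 290017544,
  27376881842540806, 7665769348136281464017434, 216265210368381193, 20903278613127762388082954,
  62888953586605245090779398, 10542680166058291, 10563296014393880, 1108821530, 106383926,
  625619209, 10563296014533144, 110576150, 1112815130, 558518537, 147022847123543043,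
  180799844463039495, 167848696942842118, 110858771, 10542748885534771, 10580888200503833,
  1108821530, 106383926, 357183752, 10580888200581657, 110576150, 1112815130, 290083080,
  74965321536656387, 108742318876152839, 95791171355955462, 110854675, 38226483,
  3147790466872783684662330, 110576150, 575095049, 23733508866986246, 3147495317559275969745434,
  110576150, 575095049, 157572553091661284508047371, 306659592, 23733577318027526,
  3147790465464455322567194, 110576150, 306659592, 157572534644917210530060555,
  6370933577726502416048662, 7379070050617887153615930, 153229315377869065, 81171721071505672,
  142742535, 373567752, 6370933577726502478758150, 6006227600873861702747794558365960, 143361031,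
  102401862, 143361031, 2769450151032794944508935, 168460823, 360976882986623514,
  293949555698112522, 290083080, 225286909717655817, 225286909701281305,
  96767653726711609155080456, 116110448465859127827714313, 1363890440, 1363890440,
  112018031304814250020177080211748206293251, 3, 144327191, 108704591759499528, 91271628541473030,
  108704591759495432, 82264429253177605, 177881621, 19549948190732550, 162184631444451593,
  2830047621504106848923909, 10542748902437125, 153177432189645065, 5247899260733365231890694,
  144327191, 541339913, 541339913, 541339913, 88682758, 8808117409308063236243989, 55128325,
  8808117409308063269798422, 177881621, 145370899632574729, 3132147630971340506542341,
  40231629440749306441720841, 290891337244054538, 6390265905111464377082390, 167943874002756618,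
  20675358471303430, 40231334292845226600518665, 290891337244054538, 3972414256875006772924949,
  158936674748015626, 11668159183008005, 177881621, 2830047609154392245743877,
  7982018023762627574575366, 6390265771464799501889798, 591796233, 19549879471190278,
  90127037138088200, 2830029174742440953262341, 10542680182894853, 81119837883281672,
  5247880813971699336229126, 144327191, 88617222, 8803395042842717057597973, 55062789,
  8803395042842717091152406, 177881621, 272904456, 272904456, 272904456, 73313305326211336,
  3132147630953748052062469, 20888816326897647460312072, 290891337244050442,
  6385543466571000694006294, 95887379476456458, 20675358471237894, 20888521178993567619109896,
  290891337244050442, 3967691818334543089848853, 86880180221715466, 11668159182942469, 177881621,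
  2830029162410318536126725, 6385543404981929856676102, 7982018023762627574575366, 323361032,
  20132112477055965322359048, 39474925735005220730384649, 2835563185544470722785541,
  58817738848839287257248009, 58817738848821695071269129, 142742535, 74997963298320648,
  91271628541489414, 71577862, 10580888211828997, 153247800933888265, 40226021630550898738029577,
  324614458379572234, 6391446496732181788385814, 167943873877189642, 147055557604684041, 71577862,
  289812744, 2835563185544470718783749, 20883208516699239756620808, 324614458379568138,
  6386724058191718105309718, 95887379350889482, 74997963298320648, 71577862, 71577862,
  2813332640235399354208264246547461, 54931717, 28630471160854790, 28630471160854534, 145445893,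
  413750280, 682251273, 413815816, 843473234269642544719487005110806, 88813830, 95791171288903944,
  413754375, 167848696875790601, 682124295, 142742535, 74997963298255112, 82264429253193989,
  558182665, 2840285552048231357362437, 38023429, 40221299264069128604439561, 324614458379572234,
  3973594848495724184228373, 158936674622448650, 147055557604618505, 289747208,
  2835563185565361443713285, 38023429, 20878486150217469623030792, 324614458379568138,
  3968872409955260501152277, 86880180096148490, 74997963298255112, 38023429,
  2813332640235399354208264246547461, 88420614, 28630471160854789, 28630471160854533, 38023429,
  145449990, 413754376, 682255369, 413819912, 1492431115841538216265085244158485, 55259397,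
  86801564220207368, 413750279, 158859089807094025, 682120199, 142742535,
  2793278466906476133862968500958491, 2793357695064268031717692399695131, 88813830,
  595956543103768843, 595956543103768587, 55259397, 586949412535015691, 586949412535015435,
  177881621, 19588087500452102, 10580888212156677, 177881621, 19570495314407686, 10563296026112261,
  177881621, 55259397, 27430757946046726, 27430757946046470, 145445893, 413750280, 682251273,
  413815816, 3277362395774786642698477797589526, 145449990, 413754376, 682255369, 413819912,
  3926320277346682314244076036637205, 38023429, 10563296258369800, 43680275, 19214034525651478,
  558321929, 106599478, 54135696929269767, 10563296009221175, 106591286, 690709289, 71577862,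
  1112815130, 555952137, 28313811762639926, 217480170498699528, 1615140874, 185392169532729351,
  177967635, 289886472, 106595382, 54135696660834567, 10580888195200055, 106591286, 422273832,
  71577862, 1112815130, 287516936, 28296219576529974, 217480170767134985, 1346705674,
  113334575226366215, 177963539, 41150940809734151, 422204200, 11046371561089994221843511,
  71577862, 78746199017117712939385370, 42079235, 236204566, 177619475, 28348996134663222,
  71577862, 28348996168283190, 54527124564096539, 287986472, 71577862, 28348996168217654,
  306458888, 54528224075724315, 422204200, 3, 156117470451355292759435275,
  78746217707788648352786442, 40099147336962109153628969, 20756334151070448051966760, 21455110,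
  77179737748304952, 106595381, 110789139, 77234707, 19588087701729543, 323576069, 1146369306,
  77179737965420808, 40060572893838240439804169, 19570495297516599, 106591285, 558321929, 76108307,
  690169865, 77091347, 421734664, 592081161, 306868488, 106591285, 1146369306, 149237263552373001,
  28313811729085493, 82356788464869640, 1095112714, 7675988974599327441379589, 185393269044357127,
  236204565, 3, 2144320435411674250678353647063845, 40099147341593252127781131,
  159995919942122710168658184, 149237263552373001, 19588087483495479, 106591285, 289886472,
  77156883, 690169865, 76042771, 421734664, 323645704, 323645704, 106591285, 1146369306,
  77179737965486344, 28296219542975541, 154396790585188617, 1095112970, 7671266536058932209279237,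
  113335674737993991, 236204565, 3, 2144241207249178433084833544229669, 20756334155701591026118923,
  160000642308605579813871881, 77179737965486344, 11046371561089994255397943, 105132293,
  1227040778, 323641608, 373567752, 105132293, 78746199026124912227680794, 211440147, 236204565,
  630859232914920235, 2219062555, 608448777, 596048841934124315, 76259859, 273379592, 285895480,
  2152215832, 721791451092234505, 76190227, 302682373, 3, 10, 125002383050136, 340013320,
  185266060569240361, 76190227, 2168854795, 2152281371, 554330939, 649733925505347848, 76186131,
  571113733, 3, 10, 124293713446296, 422208296, 21182565402563841102004203678996490, 153772839,
  422273832, 55206149, 373567752, 20751906935997532662804744, 20751906937105209841170696,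
  1227041031, 1128667397, 221422066250035465, 81250679515607301, 174285560318852625663924491,
  96898994255833742004936968, 116241788994981329397047561, 1363894536, 1363894536, 71577862,
  19588087484544055, 211436819, 10329980569023541, 1146369306, 106656821, 323711240, 558326025,
  547768323, 38390690419517447, 307855848105063706, 1621510147, 19570495297516599, 1146369306,
  558526729, 421734664, 690725673, 106591285, 1146369306, 307853649077613850, 105550901, 106595381,
  1747133449, 9, 49770849081735557937787143, 149363373099987482, 7675988974599327441445125,
  147040439309657091, 3, 2142656681475575247271574274462501, 289890568, 279333123,
  38390690151082247, 307854748593435930, 1353074947, 19588087483495479, 1146369306, 690169865,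
  290091272, 422290216, 106591285, 1146369306, 307853649077613850, 106599477, 105546805,
  1478697992, 8, 30428035895843965555601671, 77305779062059546, 7671266536058932209344773,
  74982913722770435, 3, 2142656662132780508123986882351909, 7, 422273832, 38672164851173635,
  149874499243421961, 177955349, 1678054410, 8, 11, 124452216726936, 38672164851173379,
  77816904937058568, 177955349, 1409618954, 9, 11, 124258943198616, 10456666044344823150502915,
  24202497249840787425079560, 1142654234, 28350095675851829, 76251667, 27224612317721653, 76251667,
  307519397480133690, 7671266536058932259205381, 7671266536058932259205381, 810176777,
  113208534766416951, 113208534766416951, 30389184653114986122080519, 3, 29309956383195669,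
  20302757357760771, 110772757, 110772757, 30389184653114986121875719, 21451013, 77179737714750520,
  106595382, 110789139, 43680275, 10580888446988551, 357126406, 1112815130, 77179737965416712,
  40060572893837140928176393, 10563296009221175, 106591286, 558326025, 42557971, 690169865,
  43541011, 421734664, 625635593, 340422920, 106591286, 1112815130, 149237263552368905,
  28313811762639926, 91363987719606536, 1095047178, 7675988983588934543626502, 185392169532729351,
  236204566, 3, 2144320437824803532430842094379814, 40099442489498431480606987,
  157578068302892352307613960, 149237263552368905, 10580888195200055, 106591286, 289890568,
  43606547, 690169865, 42492435, 421734664, 357200136, 357200136, 106591286, 1112815130,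
  77179737965482248, 28296219576529974, 163403989839925513, 1095047434, 7671266545048539311526150,
  113334575226366215, 236204566, 3, 2144241209662307714837321991545638, 20756629303606770378944779,
  157582790669375221952827657, 77179737965482248, 11046371561089994221843511, 105132294,
  1227040778, 357191944, 373567752, 105132294, 78746199017117712939385370, 177889811, 236204566,
  621852033660183339, 2185508379, 574894345, 587041642645829147, 42705427, 273379592, 285891384,
  2152216088, 721809043244724489, 42635795, 336236806, 3, 10, 125002508879256, 306458888,
  185266060569236265, 42635795, 2168789259, 2152281627, 554326843, 649751517657837832, 42631699,
  604668166, 3, 10, 124293839275416, 422204200, 21181297751963612872602706975725578, 153768743,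
  422269736, 88756486, 373567752, 20751611788091253798351112, 20751611789198930976717064,
  1227041031, 1162156294, 221420966704853257, 90257878803902726, 174285265170947446311033099,
  96898994255832642493305096, 116241788994980229885415689, 1363890440, 1363890440, 38023429,
  10580888196248631, 177882643, 19337179823764534, 1112815130, 106656822, 357265672, 558321929,
  547702787, 38373098233473031, 298848648816768538, 1621444611, 10563296009221175, 1112815130,
  558526729, 421734664, 690725673, 106591286, 1112815130, 298846449789318682, 105550902, 106595382,
  1747133449, 9, 49770553933830378584961287, 149364472578060826, 7675988983588934543692038,
  147022847123608579, 3, 2142656683888704529024062721778470, 289886472, 279267587,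
  38373097965037831, 298847549305140762, 1353009411, 10580888195200055, 1112815130, 690169865,
  290091272, 422290216, 106591286, 1112815130, 298846449789318682, 106599478, 105546806,
  1478697992, 8, 30427740747938786202775815, 77306878540132890, 7671266545048539311591686,
  74965321536721923, 3, 2142656664545909789876475329667878, 7, 422269736, 38654572665063683,
  149873399731794185, 211505686, 1644565514, 8, 11, 124452090897816, 38654572665063427,
  77815805425430792, 211505686, 1376130058, 9, 11, 124258817369496, 10451943677844361319240707,
  21789367968087199432585480, 1109100058, 28350095675851830, 42697235, 27224612351276086, 42697235,
  298512198225392698, 7671266545048539327901958, 7671266545048539327901958, 810180873,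
  113208534732862519, 113208534732862519, 30389184644107786867339527, 3, 29309956416750102,
  11295558103085315, 110772758, 110772758, 30389184644107786867138823, 21655818, 55206149,
  23825386299400454, 88768774, 77306877654503688, 20751906937031541823578376,
  80186780189065044256522501, 336285960, 88768774, 55214341, 77305778109321480,
  20751611789108770251153672, 82604613381550228896383238, 302735624, 55214341, 289804066133406775,
  421734664, 55214341, 145253379, 1146369302, 145249283, 1112815125, 323653893, 323653893,
  1112815125, 1146369302, 1112815125, 290099464, 1146647606, 1113093173, 149929475107955497,
  221444056432748057, 221444056432746761, 1113158709, 221444056432747801, 221444056432746761,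
  1146713142, 558518537, 20751611933315218300096776, 20751611933315218300096776,
  59437238160983351890694408, 55079173, 558518537, 1112815125, 558321929, 1084838915, 556426025,
  826958088, 1084838915, 558321929, 558182665, 77869682330928664, 285893944, 287990568,
  76744069350764808, 279389187, 149927276368860697, 592077065, 592077065, 592077065,
  149364471893745929, 625285126, 1146369302, 558326025, 1084843011, 556421929, 826953992,
  1084843011, 558326025, 558248201, 77868582852855064, 285890104, 287986472, 76743038558679304,
  279389187, 149926176890787097, 625627401, 625627401, 625627401, 149363372382114057, 591796229,
  14841276726415621, 558321929, 553988361, 80220983024394992795284535, 553988361, 558321929,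
  690169863, 80206815924664908882080823, 80206815924700093254038583, 3, 279389192, 1113158711,
  404956168, 80220983024394992795284535, 80220983024394992795284535, 553988361, 558321929,
  690725671, 80220982736164615569830967, 80220982736164615569830967, 591796233, 591796233,
  591796233, 290083080, 40094425047149285095395593, 40094425047149285095395593,
  59437238160983351890694409, 55144709, 290083080, 1112815125, 289886472, 1084773379, 287990568,
  826958089, 554329401, 556426025, 148801663657128201, 547824643, 77869682330928664, 1084773379,
  289886472, 289747208, 149927276368860697, 323641608, 323641608, 323641608, 77306877587382536,
  356849926, 1146369302, 289890568, 1084777475, 287986472, 826953993, 554325561, 556421929,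
  148800632865042697, 547824643, 77868582852855064, 1084777475, 289890568, 289812744,
  149926176890787097, 357191944, 357191944, 357191944, 77305778075750664, 323361029,
  14841276726411525, 289886472, 285552904, 80220983024377400609305655, 3, 547824649, 1113093175,
  289890568, 80220983024394992795284535, 80220983024394992795284535, 285552904, 289886472,
  421734663, 80211538291130186341250103, 80211538291182962899186743, 285552904, 289886472,
  422290215, 80220982736147023383852087, 80220982736164615569830967, 323361032, 323361032,
  323361032, 26011101026328708740797545159741704, 1084773379, 55079173, 1084777475, 88633606,
  54505133356639239, 1084773379, 55079173, 45497934101894151, 116241715280607840603623689,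
  1621853187, 31198327321167139289436855460319497, 1084838915, 1084838915, 1084773379,
  39007651544054610536899593, 1353421827, 1084777475, 84422918, 76744482737574923, 1478697991,
  1084773379, 50868485, 76743383225951243, 1478697991, 31203397923549162741111363692286217,
  55144709, 55206149, 27483534470566150, 556421929, 135423672642003972016001288,
  39949545398932668416340233, 27483534504206598, 157284357307714037344784651, 76766128302862600,
  287986472, 135423672714061566053929225, 20606732213041007314678024, 27483534504206598,
  157284357307714037344784651, 148823722609225993, 88842502, 360394897983431464,
  20751907219630425496760584, 96742768780255903626191112, 581019879484310811, 1353278467, 77218323,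
  20728136293884931, 149364472946234377, 40094720405522086145634569, 297722876768522501,
  40094720405522086145650953, 1621566467, 10762844555248826112579093653958921,
  36395694782083990243522378220675336, 77306878639870984, 20751907219630425312342280,
  297721777256890629, 20751907219630425312358664, 1353131011, 5570547677371185370196938343330056,
  36395694782083990315562380340994313, 55288069, 360377305797382952, 20751612071707653957824776,
  96738046413771934469345544, 581019879450756635, 1353274371, 43663891, 11720937039143939,
  149363373434541065, 40094425257599314573209865, 306730007303786758, 40094425257599314573226249,
  1621566467, 10762765327081589472751431176499465, 36395694782083990234516278477562120,
  77305779128177672, 20751612071707653739917576, 306728907792154886, 20751612071707653739933960,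
  1353131011, 5570468449203948730369275865870600, 36395694782083990306556280597881097, 3,
  741818240139980062603464092041749, 5564166387663605848355078, 5564166387663605848355078,
  5564166387663605848355078, 71577862, 145314824602198281, 7382408894101946295202053,
  145314824602198281, 7377686527619076649988357, 1146369306, 38023429, 145314824568643849,
  7382408903109145549943046, 145314824568643849, 7377686536626275904729350, 1112815130,
  2763488294676882133762581, 78095288604360100796445978, 290910028800734490, 1344742408,
  5568888742061816207192326, 1150767642, 10399869648147306389336327, 541339913, 591880457,
  323563784, 541544713, 2157466139, 2427078920, 5564166384603738002764038, 302735624, 1083728410,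
  541544713, 1083724314, 1353402632, 5568888751069015461933318, 302670088, 302473480, 541544713,
  1117201946, 71577862, 73257230295834888, 7382390447340280399540485, 73257230295834888,
  7377668080857410754326789, 1146369306, 38023429, 73257230262280456, 7382390456347479654281478,
  73257230262280456, 7377668089864610009067782, 1112815130, 2758765928194012488548885,
  290927620986778906, 1613177865, 78090566237859638965187866, 5568888742061816207126790,
  1150767642, 10399869648147306389336327, 272904456, 591933705, 323445000, 2157531675, 2695514121,
  273109256, 5564166384603738002698502, 571171081, 1083793946, 1083789850, 1621837833, 273109256,
  5568888751069015461867782, 571105545, 2157535771, 273109256, 1117201946, 38023429, 323367176,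
  323367176, 1112815130, 1112815130, 71577862, 1084695562, 865046690554915083, 865046690554914827,
  579159097730343947, 579141505544299531, 2158437387, 615203288046520583, 615203288046520327,
  88764682, 122323205, 22102222086274364661468599128892955, 625627401, 357191944,
  290928720504890378, 290911128318845962, 1084695562, 326990503007176967, 326990503007176711,
  88830219, 122388741, 42870141947179976746812109126837786, 625692937, 357257480, 1146369306,
  2790584563554073808515098133283351, 1146369306, 2789316912949123212630731784864279, 1146369306,
  38023429, 1084695562, 865046621835438347, 865046621835438091, 579157998218716171,
  579140406032671755, 2158437387, 615203288046520583, 615203288046520327, 55210250, 122323206,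
  21453184976539659568673028738327835, 592077065, 323641608, 290927620993262602,
  290910028807218186, 1084695562, 326990503007176967, 326990503007176711, 55275787, 122388742,
  42221104837445271654016538736272666, 592142601, 323707144, 1112815130,
  2790505335391264396272325236507159, 1112815130, 2789237684786313800387958888088087, 1112815130,
  4, 6, 1095112714, 291155696641525763, 324932693981022215, 302974347172517893, 110862867,
  558241801, 147040576748275715, 180817574087772167, 158859227279267845, 110858771, 289806600,
  74982982441912579, 108759979781409031, 86801632972904709, 110854675, 90161328207180040,
  876884233, 877084937, 5, 1095047178, 291138104455415811, 324915101794912263, 311963954274703366,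
  110862867, 558176265, 147022984562165763, 180799981901662215, 167848834381453318, 110858771,
  289741064, 74965390255802627, 108742387595299079, 95791240075090182, 110854675,
  81171721104929032, 843329801, 843530505, 30252299018877015801884533073257278488560946983171, 3,
  142742535, 177947157, 177947157, 324877374678589706, 324877374678585610, 142742535, 177947157,
  177947157, 180762186065862921, 180762186065858825, 142742535, 177947157, 177947157,
  108704591759499528, 108704591759495432, 74997963298320648, 111099740525644039, 74997963298255112,
  111099740525644039, 38023429, 10317006459054090, 329381318035187719, 177971731,
  10299413736138761, 185266198141937671, 177967635, 10281821281659144, 113208603835574535,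
  177963539, 77323370278170888, 71857206, 21455110, 149237263552373001, 78746199265639155097608458,
  77179737965486344, 78746199265621562643128586, 293352451141694522, 329381318035187719, 236204565,
  75633667, 78784773713376574331105547, 159995920086110759159566600, 293352452165165322,
  77179737965420808, 40060572893838240439804169, 149237263065773113, 185266198141937671, 236204565,
  75633667, 40099147341593252127781131, 159995919941995639266320648, 149237263552438537,
  77179737747256376, 113208603835574535, 236204565, 75633667, 20756334155701591026118923,
  160000642308478508911534345, 77179737965551880, 77324469823353096, 876884233, 876884233,
  876884233, 71577862, 71988282, 365410115190659336, 28577695604807685, 291155696641525763,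
  75633667, 71922745, 221294995297409544, 28577695067936773, 147040576748275715, 75633667,
  71857208, 221294995297409545, 28595286985545989, 74982982441912579, 75633667, 21451013,
  149237263552368905, 78746199265638055585980682, 77179737965482248, 78746199265620463131500810,
  293352451108140090, 329381318035187719, 236204566, 42079235, 78785068861281753683931403,
  157578068446881500810154248, 293352452165161226, 77179737965416712, 40060572893837140928176393,
  149237263032218681, 185266198141937671, 236204566, 42079235, 40099442489498431480606987,
  157578068302766380916908296, 149237263552434441, 77179737713701944, 113208603835574535,
  236204566, 42079235, 20756629303606770378944779, 157582790669249250562121993, 77179737965547784,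
  77323370278170888, 843329801, 843329801, 843329801, 38023429, 38433850, 365410115190593800,
  28577695638296582, 291138104455415811, 42079235, 38368313, 221294995297344008, 28577695101425670,
  147022984562165763, 42079235, 38302776, 221294995297344009, 28595287019034886, 74965390255802627,
  42079235, 73257230228726024, 86801632972904709, 106460214, 95791240075090182, 106460213,
  5611181126406456569504076994662663, 5610864213755218920512094686490883, 113208603835574535, 11,
  1095332106, 558526729, 221294995297409545, 97937767668907174619718666,
  8157539616784440854107561906630919, 55144709, 3247844634558043516003179224060709, 6,
  221294995297344009, 97937767668907174619718666, 8157539616784440854106462395003143, 88699142,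
  3896881744292748617805948869370662, 5, 21721351, 360976540441800970, 216861351829074185,
  86801632972904709, 22662102986028086, 86801632972904709, 2418484235, 826758681, 279389187,
  77887273514333238, 95791240075090182, 13654903731287093, 95791240075090182, 2418484235,
  826762521, 279389187, 77886174002705461, 20756629303041767166931211, 149888793177172489,
  20756629303041767166931211, 149949266316700169, 2220454966, 2186900533,
  22091710104508081348760357, 421734663, 12099164103544652930965767, 24504839386244077121659686,
  421734663, 14517015742773911280374023, 4, 30252299018877015801884533073257278488560946983171,
  77179737965205768, 826612233, 77179737965140232, 826612233, 0, 3, 4, 40587441092436999,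
  13565843222459445, 22573042544309302, 145236999, 72627478, 43460117, 106525750,
  90127037262091272, 19495788707668998, 276960264, 19606779523130376, 609498393, 106525749,
  28631570695410693, 110538577144341512, 19605679670654006, 609498393, 72627478, 84091140,
  5263154710504707931656458, 625284873, 5263154710504707931742474, 31580241799058485, 145236999,
  77014294, 106525749, 90197406006334472, 39073301, 10488658172400645, 276960264,
  10599580268385288, 575944217, 106525750, 28631570695414790, 110537477632709640,
  10598480382358581, 575944217, 39073301, 50536708, 2845303062268250293952778, 591795977,
  2845303062268250294034698, 31580241799058486, 142742535, 77165078, 413819912, 74513078990157081,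
  43610645, 413815816, 74513078956602905, 145596647392687385, 576353333, 153298948,
  11080205164901972952306693, 2974399156594363761575989841699078, 39007649039737865, 413832200,
  609977398, 276960264, 1218978826, 72627478, 110503392772187144, 29457158064182277, 1149707546,
  163720868283036953, 690709284, 39008748551361545, 413832200, 576422965, 276960264, 1218978826,
  39073301, 110502293260555272, 29457158097736710, 1116153370, 154713668994741785, 690705188,
  39083302434927246985303049, 276960264, 276960264, 276960264, 576353333,
  77768910251144397992907562, 151200004, 941827080, 690169860, 110541875679155208,
  110541875813377032, 216934960710820875, 39482421, 110541875813372936, 176296965,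
  216936060222448651, 4, 155140181551173242956559643, 77768928807606598549910810,
  5267581929779475699627062, 2849730281543018061919285, 7, 289711836005414170, 433827024618140953,
  690725668, 145596647392687385, 433827024618140954, 1227592484, 153298948, 690169865, 153298948,
  690169865, 151200004, 690169865, 690169865, 4, 153298951, 108141435645273864,
  3655572943473441241243909, 153298951, 108141435645273864, 6068702225227029233737990, 151200007,
  76616238371120136, 11080205231179232505914154, 76616238371120136, 11080500379084411858735914,
  108141435643175176, 20751611752067469018817322, 20751906899972648371639082, 8, 287516932,
  279389187, 38317155999228935, 29214403846270031697187850, 38317155999228935,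
  20147460165383315681612810, 39948752259248987274683401, 77306877585281834, 421734663, 1113289781,
  824943401, 592158981, 421734663, 287516932, 6, 279333123, 20733632778490890, 142742535,
  279267587, 413485319, 58817738879747865174217737, 77215892995716899, 77253001507066885,
  1344743690, 824850217, 625619206, 77253001507132421, 816260105, 1361258762, 279389187, 413812999,
  211436054, 108704591881049095, 211436054, 279333123, 10324311880595124758194439, 279267587,
  10324311880577532572150023, 77305778071561002, 421734663, 88764678, 1112815125, 1146844214,
  421734663, 113357664953772295, 72971318, 824660777, 1276391958, 421734663, 279389187, 1353131018,
  6, 20690957781074451, 160005660197528103556977179, 19588090366731273, 23733508330127620,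
  160005660197528103568503051, 19588089964078087, 4, 20409482804363795,
  8157534649785134416974277391250487, 3, 22607608423284996, 15788766533962564337232393574904889, 4,
  59442255621235227706949897, 113353266924038407, 211297555, 167848696942854409, 816538627,
  113353266924038407, 211452435, 287516932, 279333123, 413550855, 58817738879747865174152201, 5,
  279267587, 11726433523753994, 142742535, 77233485181695779, 77254101018698758, 1344743690,
  824850217, 592064773, 77254101018764294, 816260105, 1361258762, 279389187, 413812999, 177881621,
  108704591880983559, 177881621, 279333123, 10324311880595124758194439, 279267587,
  10324311880577532572150023, 77306877583184682, 421734663, 1146369302, 55210245, 1113289781,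
  421734663, 113357664953772295, 824664873, 39416885, 1242837525, 421734663, 279389187, 1353131018,
  5, 11683827212255763, 157587808549291714638746139, 10580891111990281, 14743901227876612,
  157587808549291714650272011, 10580890709337095, 4, 11402352235545107,
  8157534647367301215481893463094327, 3, 13618001321033988, 15788766531549435055478805582410809, 4,
  59441960464340441251873033, 113352167412410631, 177743379, 158859089840603401, 816534531,
  113352167412410631, 177898003, 285417732, 277498115, 413812999, 78089754614331144468440074,
  413812999, 78089736167587070758888458, 411715847, 87156698227663866199286794,
  87156679780919792489735178, 277498115, 20690957779805462, 15225593279699425423935751,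
  10305422414171064968096007, 211297558, 277498115, 11683827210987029, 12807760078207041529334023,
  10300700047688195322882311, 177743381, 277498115, 290907005150307338, 94630637622015254,
  290906936430830602, 85623438333720085, 335680518, 20690958047910147, 54467955120570903,
  74345952688870403, 38954116635591191, 38954116838024199, 302126085, 11683827479091459,
  45460824551752215, 74345952655315971, 38936524415992343, 38936524651975687, 285882147, 352788742,
  149834298433372425, 319234309, 149851890585862409, 10389908430214881539158823, 553853193,
  29214403846270031831405578, 22679695401623814, 13672496113328389, 444732421,
  40225560572775705589784841, 20147460165383315824210730, 816260105, 20147165019169125216969738,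
  816260105, 352788742, 175474711300314882346653963, 20147460167074304569791498, 816260105,
  319234309, 175469988933832012667951371, 6006227600855064403051959376355589, 808081193, 403330055,
  143348743, 12807760141839211140617223, 403330055, 297647010621400074, 276960259,
  10389908430214881664440583, 10389908430496283626968071, 10389889983752209917350919, 276960259,
  20751906936541305591469066, 421734663, 20751906936541305591538698, 110374750053935367,
  3957785848120601991598885, 421734663, 90108551415690294, 421734663, 1128667146, 106656822,
  28630471324361510, 421734663, 824522537, 30427740747375836395608327, 72971318, 421734663,
  421734663, 59413109756609159776903433, 151202055, 276960259, 344070406,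
  174870578069832988329714699, 5554186686698825508328454, 6370915129856597764498214, 421734663,
  81101352160949301, 421734663, 1162156042, 106656821, 28630471324357413, 421734663, 824588073,
  30428035895281015781988615, 39416885, 421734663, 421734663, 59417832132081636524368137,
  151202055, 276960259, 310515973, 174865855694342988149236747, 3136353485206510299649029,
  21770570735821113830613253, 216354691966718761, 405428487, 112789217191088935, 3,
  218461141236917257, 74345952664170755, 816260105, 816260105, 59441960464340441515630857,
  59441960464340441515630857, 814162947, 112771625256637447, 277500931, 277500931,
  298719034466870058, 586949410618581803, 157558032688330245459906827, 157558032688330245459898635,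
  4, 11, 155461007324402339660071443, 2186970165, 579137382375760899, 23846276987236614, 816538633,
  469899527, 5, 10, 24443771452056, 579137313656284163, 14839077698941189, 816534537, 436345095, 6,
  10, 24443818637976, 10, 78089754580835695253488147, 1113293877, 290907005150307331,
  23828684801257734, 816473097, 469899527, 5, 11, 106907143535256, 290906936430830595,
  14821485512962309, 816469001, 436345095, 6, 11, 106907190721176, 293967079164680202, 1129021701,
  79843523445478750694375685, 82261356646953542436487430, 1129021701, 1084761091,
  38764524096607239, 38764524901771527, 6, 581582829390272523, 92360353287583747, 2202409221,
  839065865, 7, 10, 24238418512536, 293352452164818954, 92360352213841923, 1128667397, 839065865,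
  7, 11, 106701790595736, 5554186687057059882107411, 1146369306, 5, 581582829390206987,
  83353154032842755, 2235898118, 872620297, 7, 10, 24238465698456, 293352452164753418,
  83353152959100931, 1162156294, 872620297, 7, 11, 106701837781656, 3136353485564675953951251,
  1112815130, 8, 287516932, 279389187, 1361520906, 361050146783843109, 824650249,
  216934958707987237, 816260105, 113208603835574535, 3641553409660784718010629, 287516932,
  279389187, 1361520906, 361051246295474982, 824650249, 216936058219619110, 816260105,
  113208603835574535, 6059405048891142579054854, 285417732, 40225560572775705589522697,
  15948585226673087447232275804266757, 15949852877273610833546151148593414,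
  78594954622045667010487306, 58062104799288611135760905, 96728841849238051168396298,
  58062104799271018949716489, 96728841849238051168396298, 7, 153299204, 145236995,
  74345953018192904, 29214403846270031831405578, 74345953018192904, 10476053572437485399217162,
  39949047371142961794589705, 41278080432100138, 421734664, 1113293877, 690725673, 592158981,
  421734664, 153299204, 6, 145115395, 20733632644273162, 276960264, 145049859, 413485320,
  49151054689313701421782025, 41187164562012195, 41241796539929605, 1210591498, 690632745,
  625619206, 41241796539995141, 682107913, 1227041034, 145236995, 413813000, 345653782,
  108704591881049096, 345653782, 145115395, 19995718437512158155843848, 145049859,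
  19995718437494565969799432, 41276980918379306, 421734664, 88768774, 1112815125, 1146848310,
  421734664, 113357664953772296, 72975414, 690508585, 1410609686, 421734664, 145236995, 1218978826,
  6, 20673365595025939, 160005365049622924204151323, 19589189744141321, 23733439610646788,
  160005365049622924215681291, 19589189475705864, 4, 20391890618315283,
  8157534659451818643436138651026488, 3, 22607539703804164, 13193885755295360305623468892324921, 4,
  49770849064318125589819657, 113353266924038408, 345449747, 167848628223373577, 682320899,
  113353266924038408, 345666067, 153299204, 145115395, 413550856, 49151054689313701421716489, 5,
  145049859, 11726433389536266, 276960264, 41204756747991075, 41242896051561478, 1210591498,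
  690632745, 592064773, 41242896051627014, 682107913, 1227041034, 145236995, 413813000, 312099349,
  108704591880983560, 312099349, 145115395, 19995718437512158155843848, 145049859,
  19995718437494565969799432, 41278080430002986, 421734664, 1146369302, 55214341, 1113293877,
  421734664, 113357664953772296, 690512681, 39420981, 1377055253, 421734664, 145236995, 1218978826,
  5, 11666235026207251, 157587513401386535285920283, 10581990489400329, 14743832508395780,
  157587513401386535297450251, 10581990220964872, 4, 11384760049496595,
  8157534657033985441943754722870328, 3, 13617932601553156, 13193885752882231023869880899830841, 4,
  49770553907423339134742793, 113352167412410632, 311895571, 158859021121122569, 682316803,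
  113352167412410632, 312111635, 151200004, 143280387, 413813000, 78085032283859479656080394,
  413813000, 78085013837115405946528778, 411715848, 96823382418080437899830282,
  96823363971336364190278666, 143280387, 20673365593826582, 24892277506162386195335432,
  19976828971088098365745416, 345449750, 143280387, 11666235025008149, 22474444304670002300733704,
  19972106604605228720531720, 311895573, 143280387, 290889412964197386, 58601840603051286,
  290889344244720650, 49594641314756117, 201462790, 20673365727648003, 90479160087704088,
  38317155669906435, 74982913788768792, 74982913856988168, 167908357, 11666235158829315,
  81472029518885400, 38317155636352003, 74965321569169944, 74965321670939656, 151664675, 218636550,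
  149834229713891593, 185082117, 149851821866381577, 20056592656660249990300456, 553853193,
  29214403846270031697187850, 22679695267471622, 13672495979176197, 444732421,
  40225542126031563026604297, 10476053572437485273383722, 682107913, 10475758426224394177766410,
  682107913, 218636550, 165803323154113125639592203, 10476053574129573530588170, 682107913,
  185082117, 165798600787630255960889611, 3410079161916244031869677679943941, 673863721, 403330056,
  277566472, 22474444332273374893052936, 403330056, 297664602673226762, 142742531,
  20056592656660250249795848, 20056592656941652212323336, 20056574210197578502706184, 142742531,
  11080500343595475040637962, 421734664, 11080500343595475040707594, 110374750053935368,
  3957767401376528147829541, 421734664, 77324469589931062, 421734664, 1128666890, 106591286,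
  28631570701771558, 421734664, 690305065, 30427740747375836395608328, 72975414, 421734664,
  421734664, 49741721646436131235111177, 285419784, 142742531, 209852678,
  165199171512933546983957515, 5549464320233547914941446, 6370896683112523920728870, 421734664,
  77323370078303285, 421734664, 1162155786, 106591285, 28631570701767461, 421734664, 690370601,
  30428035895281015781988616, 39420981, 421734664, 421734664, 49746444021908607982575881,
  285419784, 142742531, 176298245, 165194449137443546803479563, 3131631118741232706262021,
  12099164142892875465826565, 180325963533013801, 405428488, 112789217325306664, 3,
  182432344218018825, 38317155645206787, 682107913, 682107913, 49770553907423339264286985,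
  49770553907423339264286985, 680010755, 112771625256637448, 143283203, 143283203,
  298719034332652330, 586949410484364075, 157558032652301448440942859, 157558032652301448440938763,
  4, 11, 155456284957901877828809235, 2186966069, 579119790189650947, 23845177475608838, 682320905,
  469899528, 5, 10, 24415585729176, 579119721470174211, 14837978187313413, 682316809, 436345096, 6,
  10, 24415632915096, 10, 78085032214335233422225939, 1113289781, 290889412964197379,
  23827585289629958, 682255369, 469899528, 5, 11, 106878957812376, 290889344244720643,
  14820386001334533, 682251273, 436345096, 6, 11, 106879004998296, 293967010445203210, 1129017605,
  79843228297573502622068997, 82261061499048294364180742, 1129017605, 1084695555,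
  74792221603943432, 74792222543259912, 6, 581582760670795531, 56331556268619523, 2202409221,
  704848137, 8, 10, 24222312385176, 293352383445341962, 56331555194877699, 1128667397, 704848137,
  8, 11, 106685684468376, 5549464320573090725261843, 1146369306, 5, 581582760670729995,
  47324357013878531, 2235898118, 738402569, 8, 10, 24222359571096, 293352383445276426,
  47324355940136707, 1162156294, 738402569, 8, 11, 106685731654296, 3131631119080706797105683,
  1112815130, 7, 153299204, 145236995, 1227368714, 325021349630726949, 690498057,
  180906161554871077, 682107913, 113208603835574536, 3641553409660784718010629, 153299204,
  145236995, 1227368714, 325022449142358822, 690498057, 180907261066502950, 682107913,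
  113208603835574536, 6059405048891142579054854, 151200004, 40225542126031563026276617,
  13352441739499146548025166330536197, 13353709390099669934339041674862854,
  78594954586034462043350026, 48395420608854378529630729, 87057435292320948917117962,
  48395420608836786343586313, 87057435292320948917117962, 3, 4, 3136869997471801818034437,
  7972573293944717059895558, 7972573293927124873916678, 40084980242122652992610569,
  5554721654715458744037638, 3132147630988932172820741, 7967850927461847414681862,
  7967850927444255228702982, 5549999288232589098823942, 40080257875639783347396873,
  10380980208528859146168583, 29723793394420520113613064, 29723793394420451394136584,
  40060609787308795538645257, 20052386837503486850181384, 10376257842045989500954887,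
  29719071027937650468399368, 29719071027937581748922888, 20047664471020617204967688,
  40060609787307696027017481, 553853193, 592064773, 592064773, 690170375, 690170375, 4,
  293406336824520970, 23823188316659974, 40075037729597431388451081, 293406268105044234,
  23823188316594438, 40075019282853357678899465, 293406336822425386, 1227041031, 1090724106,
  307444411724734726, 116237364081592293927563529, 307444411724669190, 116237345634848220218011913,
  1227041031, 4, 293388744638411018, 14815989028364549, 40070315363096969557127433,
  293388675918934282, 14815989028299013, 40070296916352895847575817, 293388744636315434,
  1227041031, 1090724106, 298437212436439301, 116232641715091832096239881, 298437212436373765,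
  116232623268347758386688265, 1227041031, 4, 3136869994323973042221317,
  10390424939368830166242311, 6394988137965261321355798, 7972573293944717048234518,
  7967850927461847403086358, 74700962004355592, 20692950912735750, 10380980275574333715663367,
  74683369818245640, 11685751624440325, 10376257909073871884339719, 1090724106, 276960264,
  276960264, 276960264, 276960264, 38707349223531527, 54080166684017174, 38707349223527431,
  45072967395721749, 21189339410639607242172045990514951, 144196119, 74774629417985032,
  74774629417985032, 74772431325307912, 3136870066008965782319365, 20071866779480096919544072,
  437614640328574489, 5554721714245424426475782, 438175245210428425, 20692950657413382,
  20071571631576017078341896, 437614640328574233, 3136870066008966822318341, 438174145698800649,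
  11685751369117957, 1095463175, 1128751365, 1162440966, 1128886533,
  2971863861231306866630366507246600, 278610456, 219186131976528905, 625619206, 219186131976528905,
  592064773, 38672164851173895, 20675358592473606, 20052386832491367247530504, 38654572665063943,
  11668159304178181, 20047664465990905416206856, 1090724106, 142742535, 74718554190668808,
  90108963702915606, 43467285, 10400164820239748809495559, 21189339410639607242172045990514951,
  278348312, 38746931910648839, 38746931910648839, 142742535, 142742535, 142742535,
  38743634172126215, 3132147663497299118141701, 10400460222545471335784711, 437613540816942617,
  5549999311733757762363654, 438175245210428425, 20675358471368966, 10400165074641391494582535,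
  437613540816942361, 3132147663497300158206213, 438174145698800649, 11668159183073541, 1095467272,
  1128816901, 1162445062, 1128890629, 5566744649565176605899484702123015, 144392727,
  183157334823412745, 625619206, 183157334823412745, 592064773, 1092823306, 74683369826494984,
  3127425333043227548463365, 38654572673313287, 3127425297014430529499397, 1227041031, 1092823306,
  38672164859357703, 56331554180989462, 75633670, 278282776, 29723793391731956351445255,
  20052387017738259633037576, 437614640328574489, 5565347038831881128206598, 438175244153465353,
  74700962012539400, 75633670, 144065047, 29723793391731956485662984, 10380980460803634049278215,
  437613540816942617, 5565051854897904756482310, 438175244153465353, 38672164859357703, 75633670,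
  1227041031, 1227041031, 10380980206137975398353415, 20128091122260417380565528,
  20052386837503486850181384, 211297558, 1092823306, 38654572673313287, 47324354892694037,
  278217240, 29719071025250117498382599, 42079237, 20047664651256489499447560, 437614640328574233,
  3147495390595423524049157, 438174144641837577, 74683369826494984, 143999511,
  29719071025250117632600328, 42079237, 10376258094321863915688199, 437613540816942361,
  3147200206661447152324869, 438174144641837577, 38654572673313287, 1227041031, 42079237,
  1227041031, 10376257839655105753074183, 20047664471020617204967688, 20123368755777547735351832,
  177743381, 1090724106, 278610456, 579178889208079371, 579178889208079371, 144392727,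
  579177789562299403, 579177789562299403, 41734078798241330512510802775712779,
  41733999570078521100268029878936587, 144392727, 74788923069123080, 74788923069123080,
  75055137891762712, 75054038380134936, 1095463175, 1128751365, 1162440966, 1128886533,
  23416532817874517289684235683310088, 39026340738581015, 39025241226953239, 1095467272,
  1128816901, 1162445062, 1128890629, 26011413606208387028953353878186503, 1227041031, 1227041031,
  1227041031, 4, 1095446794, 88455682239020179722297607, 211304982, 88455682239020179722293511,
  177750549, 1095446794, 98127070385221936429424904, 345457174, 98127070385221936429420808,
  311902741, 1092823306, 88455681955293403197956359, 211452438, 98127070101495159905083656,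
  345666070, 1092823306, 88455681955293403197952263, 177898005, 98127070101495159905079560,
  312111637, 4, 149291148211794185, 23805595593744646, 78760663957265565515919626,
  149291079492317449, 23805595593679110, 78760645510521491806368010, 149291148209698601, 690170375,
  553853193, 163329223112007942, 116237364225707482003419402, 163329223111942406,
  116237345778963408293867786, 690170375, 4, 149273556025684233, 14798396305449221,
  78755941590765103684595978, 149273487306207497, 14798396305383685, 78755923144021029975044362,
  149273556023588649, 690170375, 553853193, 154322023823712517, 116232641859207020172095754,
  154322023823646981, 116232623412462946462544138, 690170375, 4, 3136869994323973042155781,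
  6390265771482391676142102, 10390424939351237980197895, 7972573293927124862190102,
  7967850927444255217041942, 74700962004355336, 20692950912735494, 10380980275574333715663111,
  74683369818245384, 11685751624440069, 10376257909073871884339463, 553853193, 276960264,
  276960264, 276960264, 276960264, 38707349223465991, 54080097964540438, 38707349223461895,
  45072898676245013, 10804745654889047979810600773964039, 144196119, 74757037231936520,
  74757037231936520, 74754838602392584, 3136870066008965782253829, 20067144268882038661603592,
  437614640328574490, 5554721714245423889604870, 438175245210428426, 20692950657347846,
  20066849120977958820401416, 437614640328574234, 3136870066008966285447429, 438174145698800650,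
  11685751369052421, 558592263, 591880453, 625635590, 592081157,
  2971863861231306866629266458747912, 278610456, 363301251869778954, 1162424582,
  363301251869778954, 1128870149, 38672164851173639, 20675358592473350, 20052386832491367247530248,
  38654572665063687, 11668159304177925, 20047664465990905416206600, 553853193, 142742535,
  74718554190603272, 90108894983438870, 43467285, 10395442453739286978237447,
  10804745654889047979810600773964039, 278348312, 38729339724600327, 38729339724600327, 142742535,
  142742535, 142742535, 38726041449210887, 3132147663497299118076165, 10395737711947413077844231,
  437613540816942618, 5549999311733757225492742, 438175245210428426, 20675358471303430,
  10395442564043333236642055, 437613540816942362, 3132147663497299621335301, 438174145698800650,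
  11668159183008005, 558596360, 591945989, 625639686, 592085253,
  5566744649565176605898384653624327, 144392727, 327272454716662794, 1162424582,
  327272454716662794, 1128870149, 555952649, 74683369826494728, 3127425333043227011592453,
  38654572673313031, 3127425297014429992628485, 690170375, 555952649, 38672164859357447,
  56331554180923926, 75633670, 278282776, 29723793391714364165401095, 20052386873623071020310792,
  437614640328574490, 5560624672349010946121990, 438175244690336010, 74700962012539144, 75633670,
  144065047, 29723793391714364299618824, 10380980316688445436551431, 437613540816942618,
  5560329488415034574397702, 438175244690336010, 38672164859357447, 75633670, 690170375, 690170375,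
  10380980206137975398353159, 30389203193725797724275224, 20052386837503486850181384, 211297558,
  555952649, 38654572673313031, 47324354892628501, 278217240, 29719071025232525312338439, 42079237,
  20047664507141300886720776, 437614640328574234, 3142773024112553341964549, 438174145178708234,
  74683369826494728, 143999511, 29719071025232525446556168, 42079237, 10376257950206675302961415,
  437613540816942362, 3142477840178576970240261, 438174145178708234, 38654572673313031, 690170375,
  42079237, 690170375, 10376257839655105753073927, 20047664471020617204967688,
  30389203193725797724275224, 177743381, 553853193, 278610456, 579161297022034955,
  579161297022034955, 144392727, 579160197376254987, 579160197376254987,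
  41732811147636379916626436427293707, 41732731919473570504383663530517515, 144392727,
  74788923069122824, 74788923069122824, 75037545705718296, 75036446194090520, 558592263, 591880453,
  625635590, 592081157, 13031939062119235804955109434272008, 39008748552536599, 39007649040908823,
  558596360, 591945989, 625639686, 592085253, 15626819850453105544224227629148423, 690170375,
  690170375, 690170375, 4, 558575881, 49770055867236926238449927, 211304982,
  49770055867236926238445831, 177750549, 558575881, 59441444013438682945577224, 345457174,
  59441444013438682945573128, 311902741, 555952649, 49770055727625337789964551, 211386902,
  59441443873827094497091848, 345600534, 555952649, 49770055727625337789960455, 177832469,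
  59441443873827094497087752, 312046101, 5, 291188338393031690, 435303527005758473, 592158980,
  147073149780304905, 435303527005758474, 1129025796, 54931716, 591802633, 54931716, 591802633,
  50536708, 591802633, 591802633, 147073149780304905, 38727140432765959,
  20067144227677144351335432, 145314823, 169095701, 297403672003290122, 87081194587861305965159434,
  608448774, 278553112, 144335383, 43873164419283687842456586, 642003205, 154322024320947205,
  291170746737504522, 121214607064003178110854154, 121214607064003178110919690,
  78180622233600282348237066, 27226395260911877, 27226395260907781, 7, 412848664,
  164509282972537840546030603, 110823217646244872, 413897736, 174180689529454873809527819,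
  108441675460482056, 74755937585947656, 279532552, 311895573, 291170746743923722, 1682190598,
  145384455, 145380359, 1682190598, 278553112, 180287608946578439, 1682190598, 38727140432765959,
  145314823, 177743381, 291188338929902602, 1682190598, 279602184, 279598088, 1682190598,
  144335383, 216298813913715720, 1682190598, 435303527005758474, 155391390464930322472970507,
  435303527005758474, 682337287, 11705543094049285, 298437211859932165, 435303527005758474,
  682337287, 682255367, 682251271, 147130324982444294, 4, 40075037447084515701174537,
  78760663960097014116200714, 78609416799593660825678090, 625285638, 40075019000340441991622921,
  116850900770199089005146378, 78911648254497318119354634, 625285638, 22607745857689862, 625684745,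
  625684745, 147073149780304905, 145318919, 202650134, 306410871258031114,
  87081194587862405476787210, 38726040921134087, 20066849079771964998505480, 574894341, 278549016,
  144331287, 41455312771047230238303242, 642003206, 163329223575692294, 291170746737438986,
  118796755424772820249814026, 118796755424772820249879562, 78180327085695102961856778,
  27226395294466310, 27226395294462214, 7, 412848664, 164509282972537840546030603, 413897736,
  174180689529454873809527819, 110823217646244872, 108441675460482056, 279536648, 345449750,
  74754838074315784, 291170746743923722, 1648636165, 145384455, 145380359, 1648636165,
  180287608946582535, 278549016, 1648636165, 145318919, 211297558, 38726040921134087,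
  291188338929902602, 1648636165, 279602184, 279598088, 1648636165, 216298813913719816, 144331287,
  1648636165, 435303527005758474, 155391095317024043608516875, 435303527005758474, 682337287,
  682255367, 682251271, 147129225437262085, 435303527005758474, 682337287, 20711642870651398,
  307444411114677254, 4, 40070315080601646055895305, 78604694433110791180464394,
  78755941593614144470987018, 591796741, 40070296633857572346343689, 78906925888014448474140938,
  116850900770199089005146378, 591796741, 13618138755504389, 592130313, 592130313, 4, 142742535,
  177750549, 177750549, 682107913, 682107913, 276960264, 90427276881172998,
  29119330409795291959413255, 90427276881172742, 29119330409795291959412999, 816260105, 276960264,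
  81420077592877573, 29114608043294830128089607, 81420077592877317, 29114608043294830128089351,
  816260105, 276960264, 1095446794, 869813275335203083, 869813275335137547, 558575881,
  725698155441953291, 725698155441887755, 5409481215320285776207743373486347,
  5409560443482504892640157564610827, 558575881, 433051727202825754, 433051727202825498,
  293444476134437130, 293443376622809354, 278630937, 312042005, 345600534, 312046101,
  15630627135058111226905985867588618, 149329287521710345, 149328188010082569, 278635034,
  312107541, 345666070, 312111637, 26013953240208441971635557692351497, 816260105, 816260105,
  816260105, 142742535, 54398479727991302, 29119330445824088978377224, 54398479727991046,
  29119330445824088978376968, 682107913, 142742535, 45391280439695877, 29114608079323627147053576,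
  45391280439695621, 29114608079323627147053320, 682107913, 142742535, 1095446794,
  869813275335203083, 869813275335137547, 558575881, 725698155441953291, 725698155441887755,
  2813332786048149595459625563662603, 2813412014210368711892039754787083, 558575881,
  433034135016781338, 433034135016781082, 293426883948392714, 293425784436764938, 144413209,
  177824277, 211386902, 177832469, 13034478696119290855723704305263626, 149311695335665929,
  149310595824038153, 144417306, 177889813, 211452438, 177898005,
  23417804801269621600453276130026505, 682107913, 682107913, 682107913,
  2766340745654077694123523665242375, 20717778187568322623777288, 20717796634312396333328648,
  19976828971281135670864136, 10305422344802944822749447, 20717796600779967441551896, 816260105,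
  76247574, 1093096234, 1128667397, 20717778187585914809821704, 556290857, 168460821, 76247574,
  556225321, 591796741, 20717796634329988519373064, 168526357, 168395285, 76247574, 682107913,
  40080553023495484635292681, 149310595811189769, 575353093, 156117469912461346061652507, 75633670,
  211517974, 177619477, 10300699978320075177535751, 20717796600779967441486360, 816260105,
  1093100330, 1162156294, 42693141, 20717778187568322623777288, 556294953, 202015254, 556229417,
  625285638, 42693141, 20717796634312396333328648, 1093165866, 201949718, 42693141, 682107913,
  149311695322817545, 608907526, 40080257875589205770839049, 156117469912461346061652507, 42079237,
  211108374, 177963541, 3, 4, 2164465931, 41957259271549942270459179010838791, 725698155441953289,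
  233337459465798418744943626, 725698155441887753, 233337459465798418744943626, 2164465931,
  41957259271549942270459179010838791, 725698155441953289, 233337459465798418745009162,
  725698155441887753, 233337459465798418745009162, 11046408454578279194765575,
  29723793358391723094649096, 29723793358391723094649096, 20717815081074062228924680,
  11046408454578279194765575, 29719070991908853449435400, 29719070991908853449435400,
  20717815081056470042880264, 4, 1090724106, 21189339410639607242172045990514951,
  437467846935976713, 233337459754011203784352779, 437467846935911177, 233337459754011203784352779,
  1090724106, 21189339410639607242172045990514951, 437467846935976713, 233337459754011203784418315,
  437467846935911177, 233337459754011203784418315, 11046408454578279194765575,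
  29723793358391791814125832, 20717796634329988519373064, 29723793358391791814125832,
  11046408454578279194765575, 29719070991908922168912136, 20717796634312396333328648,
  29719070991908922168912136, 4, 553853193, 10804745654889047979810600773964039,
  437467846935976714, 194651833670440666620437515, 437467846935911178, 194651833670440666620437515,
  553853193, 10804745654889047979810600773964039, 437467846935976714, 194651833670440666620503051,
  437467846935911178, 194651833670440666620503051, 11046408454578279194765575,
  20717778187585914809821704, 29723793358391791814126088, 29723793358391791814126088,
  11046408454578279194765575, 20717778187568322623777288, 29719070991908922168912392,
  29719070991908922168912392, 147073149780304905, 1621566474, 147073149780304905, 1621566474, 0, 0,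
  0, 4, 1544693460998653278099458, 138686727, 3962526662490968604029189, 46645969232303163,
  46647068743926843, 12521727169620821494441019, 3962545109235042313580805, 46645969232307259,
  12522022317526000847262779, 46648168255554619, 3962545109235111033057541,
  12522022317527100358886459, 46647068743935035, 46648168255558715, 1539971094498191446775810,
  71577862, 3957804295990506705662213, 28631570655712315, 28632670167335995,
  7686023873147906219025467, 3957822742734580415213829, 28631570655716411,
  7686319021053085571847227, 28633769678963771, 3957822742734649134690565,
  7686319021054185083470907, 28632670167344187, 28633769678967867, 1535248727997729615452162,
  38023429, 6370933577726502478557446, 28631570655712315, 28632670167335995,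
  7686023873147906185471035, 6370952024470576188109062, 28631570655716411,
  7686319021053085538292795, 28633769678963771, 6370952024470644907585798,
  7686319021054185049916475, 28632670167344187, 28633769678967867, 2,
  30160955166203552001308213702798540308034334568707, 1090724106, 20882784280372330151223560,
  365553747483124523, 365554846994748203, 98127882046608411569386283, 20887506646855199796437256,
  365553747483128619, 98128177194513590922208043, 365555946506375979, 20887506646872791982481672,
  98128177194514690433831723, 365554846994756395, 365555946506380075, 553853193,
  20882765833628187185324296, 221438558870397739, 221439658382021419, 59442255674825089366061867,
  20887488200111056830537992, 221438558870401835, 59442550822730268718883627, 221440757893649195,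
  20887488200128649016582408, 59442550822731368230507307, 221439658382029611, 221440757893653291,
  285417736, 40225560572775705589522697, 221438558870397739, 221439658382021419,
  59442255674825089097626411, 40230282939258575234736393, 221438558870401835,
  59442550822730268450448171, 221440757893649195, 40230282939276167420780809,
  59442550822731367962071851, 221439658382029611, 221440757893653291, 0, 0]

theorem verifies_pentagonCertificate : verifies 5 46756027834046232818277986663923712
    pentagonCertificate = true := by decide +kernel

/-- The certificate for the graphs whose shortest odd cycle is a heptagon. -/
def heptagonCertificate : List ℕ := [
  1, 4, 0, 3, 6, 2, 5, 10, 302265864, 10, 2236035339, 10, 2225424651, 2236256514, 6, 7, 2233673995,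
  2192143877, 135680535, 165145908381184809, 165145908381184809, 7, 177750549, 3, 6,
  144733526531850505, 11, 11, 11, 11, 11, 11, 277168664, 2, 6, 2164675371, 5, 6, 2164675371, 5,
  165037383147006473, 3, 6, 144733526531850505, 0, 3, 6, 277168664, 2, 545604121, 2, 0, 0, 0, 4, 3,
  6, 5, 2, 1141195018, 604324105, 6, 2, 5, 5, 272904456, 5, 272904456, 7, 2, 5, 222908677,
  222974213, 2156216859, 2, 6, 2, 5, 5, 138686727, 5, 138686727, 8, 2, 5, 357126405, 357191941,
  2156216859, 2, 4, 0, 0, 4]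

theorem verifies_heptagonCertificate : verifies 7 2876407055299923280282680303059647619661824
    heptagonCertificate = true := by decide +kernel

/-- The certificate for the graphs whose shortest odd cycle is a nonagon. -/
def nonagonCertificate : List ℕ := [
  0, 3, 6, 4, 2, 335888648, 2236117259, 135680535, 1, 156653874, 1, 346781000, 357265666, 3, 6, 4,
  335888648, 2, 2236109067, 2, 2236117259, 1, 335888648, 144733526800285961, 2156216859, 2,
  2225424641, 2225424385, 2, 4, 2, 9, 1078210826, 1, 2, 5, 5, 177809943, 5, 177744407, 7, 2, 5,
  178857477, 178791941, 354625800, 312961285, 2, 2170058331, 1, 6, 4, 335888648, 3, 6, 4,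
  335888648, 3, 3, 6, 7, 5, 5519122, 173777978, 10831873, 4, 178874373, 4, 89684754, 178923525, 3,
  6, 5, 10823681, 7, 2323781643, 7, 2323781643, 8, 2215146795, 7, 2215146827, 7, 2491762952,
  2491760904, 7, 5, 10823681, 6, 7, 5, 10, 2181522491, 4, 8, 1, 11, 357183746, 5, 173683730, 1, 8,
  354755333, 355095301, 2282117131, 8, 5, 713168905, 4, 6, 3, 5, 10823681, 6, 3, 6, 1, 8, 42426901,
  313239402, 84439844, 7, 354625800, 7, 177947157, 355095336, 6, 4, 1, 8, 219118048236478729,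
  312961285, 234279609135752521, 312961285, 354625800, 312961285, 7, 177816085, 177816085, 7, 8,
  357183746, 310897024320295994, 168048645, 1, 5, 312961288, 147022847464907017, 21639426, 3, 6, 1,
  8, 42426901, 8, 42426901, 8, 874857257, 84431652, 1, 42426901, 6, 8, 84431652, 6, 3, 1, 8]

theorem verifies_nonagonCertificate : verifies 9 188647904970770321872234610705413783889973862203392
    nonagonCertificate = true := by decide +kernel

/-- The certificate for the graphs whose shortest odd cycle is a hendecagon. -/
def hendecagonCertificate : List ℕ := [
  8, 0, 1, 0, 3, 0, 1, 1353147722, 0, 0, 2, 4, 357208326, 0, 0, 3, 2, 291149396, 3, 5, 3,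
  336237894, 9, 1418019082, 9, 576414770, 10, 336229702, 336229702, 3, 1353147713, 1353147713, 3,
  1, 1353147722, 1353147722, 0, 0, 2, 1, 1, 9, 10, 10, 3, 1, 10, 5, 1378313002, 0, 5, 3, 4, 4, 6,
  4, 4, 1426268426, 4, 0, 5, 3, 4, 4, 6, 7, 6, 6, 4, 4, 354062864, 4, 0, 7, 5, 2, 3, 312961537, 2,
  0, 6, 2, 21385476, 11, 1, 1342660874, 2181313051, 2181313051, 6, 1342660874, 2, 42426899, 6,
  177832471, 6, 357249284, 42426899, 6, 0, 6, 1342660874, 2, 6, 357208324, 357208324, 357208324,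
  357208324, 5, 2, 0, 7, 705966617, 5, 0, 2, 3, 0, 9, 7, 7, 7, 713169411, 0, 9, 705966615,
  705966615, 9, 7, 7, 2, 709112071]

theorem verifies_hendecagonCertificate : verifies 11 12586386812606786840558817208303049562662210793258251976704
    hendecagonCertificate = true := by decide +kernel

theorem unique_twoExtendable_twelve (V : Type) [Fintype V] (G : SimpleGraph V)
    (hcard : Fintype.card V = 12) (hext : IsExtendable G 2)
    (hnb : ¬ G.Colorable 2) (hsize : G.edgeSet.ncard ≤ 20) :
    Nonempty (G ≃g GTwo) := by
  classical
  have hex := exists_odd_isClosedWalk hnb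
  obtain ⟨hodd, w, hw⟩ := Nat.find_spec hex
  have hmin (m : ℕ) (hm : m < Nat.find hex) (hm' : Odd m) (w : ℕ → V) : ¬ IsClosedWalk G m w :=
    fun h => Nat.find_min hex hm ⟨hm', w, h⟩
  generalize Nat.find hex = R at *
  have hle : R ≤ 12 := by
    rw [← hcard, ← Fintype.card_fin R]
    refine Fintype.card_le_of_injective (fun i : Fin R => w i) fun i j hij => ?_
    rcases lt_trichotomy i j with h | h | h
    · exact absurd hij (hw.injOn hodd hmin h j.2)
    · exact h
    · exact absurd hij.symm (hw.injOn hodd hmin h i.2)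
  have hone : R ≠ 1 := by
    rintro rfl
    have := hw.2 0
    rw [hw.1] at this
    exact G.irrefl this
  have iso {M : ℕ} {s : List ℕ} (hM : IsCycleMatrix R M) (hs : verifies R M s = true) :
      Nonempty (G ≃g GTwo) :=
    nonempty_iso_of_isClosedWalk hcard hext hsize hM hs (by have := hodd.pos; omega) hle hodd
      hmin hw
  obtain rfl | rfl | rfl | rfl | rfl : R = 3 ∨ R = 5 ∨ R = 7 ∨ R = 9 ∨ R = 11 := by
    obtain ⟨k, rfl⟩ := hodd
    omega
  · exact iso (by decide +kernel) verifies_triangleCertificate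
  · exact iso (by decide +kernel) verifies_pentagonCertificate
  · exact iso (by decide +kernel) verifies_heptagonCertificate
  · exact iso (by decide +kernel) verifies_nonagonCertificate
  · exact iso (by decide +kernel) verifies_hendecagonCertificate
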